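/- arXiv:0907.2430 — 2 statements merged into one kernel-verified Lean document; each statement's English description precedes it below -/
import Mathlib

section
/- Let b ≥ 2 be an integer and let ξ be a positive real number whose base-b digit sequence d(n) = ⌊b·{ξ b^n}⌋, n ≥ 0, takes its values in {k, k+1} for some integer 0 ≤ k ≤ b − 2 and is Sturmian (exactly m + 1 distinct factors of each length m ≥ 1). Then ξ is transcendental. -/
/-- The finite word `s(i) s(i+1) ⋯ s(i+k−1)`. -/
def window {A : Type*} (s : ℕ → A) (i k : ℕ) : List A :=
  (List.range k).map fun j => s (i + j)

/-- `l` is a factor of the sequence `s`. -/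
def IsFactor {A : Type*} (s : ℕ → A) (l : List A) : Prop :=
  ∃ i, l = window s i l.length

/-- The number of distinct factors of `s` of length `k` (complexity function). -/
noncomputable def complexity {A : Type*} (s : ℕ → A) (k : ℕ) : ℕ :=
  Set.ncard {l : List A | l.length = k ∧ IsFactor s l}

/-- The shift map. -/
def shiftMap {A : Type*} (s : ℕ → A) : ℕ → A := fun n => s (n + 1)

/-- The sequence `x·u`. -/
def pre {A : Type*} (x : A) (u : ℕ → A) : ℕ → A
  | 0 => x
  | n + 1 => u n

/-- Strict lexicographic order on sequences. -/
def SeqLt {A : Type*} [LT A] (u v : ℕ → A) : Prop :=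
  ∃ i, (∀ j < i, u j = v j) ∧ u i < v i

/-- Lexicographic order on sequences. -/
def SeqLe {A : Type*} [LT A] (u v : ℕ → A) : Prop :=
  (∀ n, u n = v n) ∨ SeqLt u v

/-- Lexicographic order on (equal-length) finite words. -/
def WordLe {A : Type*} [LT A] (u v : List A) : Prop :=
  u = v ∨ List.Lex (· < ·) u v

def UltimatelyPeriodic {A : Type*} (s : ℕ → A) : Prop :=
  ∃ N, ∃ q ≥ 1, ∀ n ≥ N, s (n + q) = s n

/-- A binary sequence is Sturmian if it has complexity `k + 1` for all `k ≥ 1`. -/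
def Sturmian (s : ℕ → Fin 2) : Prop :=
  ∀ k ≥ 1, complexity s k = k + 1

/-- `w` is a left special factor of `s`. -/
def LeftSpecial {A : Type*} (s : ℕ → A) (w : List A) : Prop :=
  ∃ x y : A, x ≠ y ∧ IsFactor s (x :: w) ∧ IsFactor s (y :: w)

/-- A binary sequence is balanced. -/
def BalancedSeq (s : ℕ → Fin 2) : Prop :=
  ∀ u v : List (Fin 2), IsFactor s u → IsFactor s v → u.length = v.length →
    ((u.count 1 : ℤ) - (v.count 1 : ℤ)).natAbs ≤ 1

/-- `u` is the characteristic Sturmian sequence of slope `α`. -/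
def IsCharSturmian (α : ℝ) (u : ℕ → Fin 2) : Prop :=
  ∀ n : ℕ, ((u n : ℕ) : ℤ) = ⌊((n : ℝ) + 2) * α⌋ - ⌊((n : ℝ) + 1) * α⌋

section

set_option linter.all false

section

/-- agreement of the length `n` factors at `i` and `j` -/
def Ag (u : ℕ → Bool) (n i j : ℕ) : Prop := ∀ t < n, u (i + t) = u (j + t)

def RS (u : ℕ → Bool) (n i : ℕ) : Prop := ∃ j, Ag u n i j ∧ u (i + n) ≠ u (j + n)

def UR (u : ℕ → Bool) : Prop := ∀ n i i', RS u n i → RS u n i' → Ag u n i i'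

def NP (u : ℕ → Bool) : Prop := ∀ i j, i ≠ j → ∃ n, u (i + n) ≠ u (j + n)

def RSinf (u : ℕ → Bool) (n : ℕ) : Prop :=
  ∃ p : ℕ → Bool, ∀ c : Bool, ∀ N, ∃ i ≥ N, (∀ t < n, u (i + t) = p t) ∧ u (i + n) = c

def NA (a : Bool) (u : ℕ → Bool) : Prop := ∀ i, u i = !a → u (i + 1) = a

lemma Ag.symm {u : ℕ → Bool} {n i j : ℕ} (h : Ag u n i j) : Ag u n j i :=
  fun t ht => (h t ht).symm

lemma Ag.trans {u : ℕ → Bool} {n i j k : ℕ} (h : Ag u n i j) (h' : Ag u n j k) : Ag u n i k :=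
  fun t ht => (h t ht).trans (h' t ht)

lemma NP.rsinf {u : ℕ → Bool} (h : NP u) (n : ℕ) : RSinf u n := by
  by_contra hcon
  have h1 : ∀ p : Fin n → Bool, ∃ c : Bool, ∃ N, ∀ i ≥ N,
      (∀ t : Fin n, u (i + t) = p t) → u (i + n) ≠ c := by
    intro p
    by_contra h2
    push Not at h2
    apply hcon
    refine ⟨fun t => if ht : t < n then p ⟨t, ht⟩ else false, fun c N => ?_⟩
    obtain ⟨i, hi, h3, h4⟩ := h2 c N
    refine ⟨i, hi, fun t ht => ?_, h4⟩
    simp [ht, h3 ⟨t, ht⟩]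
  choose c N hN using h1
  set N0 := Finset.univ.sup N with hN0
  have key : ∀ i j, N0 ≤ i → N0 ≤ j → Ag u n i j → u (i + n) = u (j + n) := by
    intro i j hi hj hA
    have hle : N (fun t => u (i + t)) ≤ N0 := Finset.le_sup (Finset.mem_univ _)
    have e1 := hN (fun t => u (i + t)) i (hle.trans hi) (fun t => rfl)
    have e2 := hN (fun t => u (i + t)) j (hle.trans hj) (fun t => (hA t t.2).symm)
    revert e1 e2
    cases u (i+n) <;> cases u (j+n) <;> cases c (fun t => u (i + t)) <;> simp
  obtain ⟨x, y, hxy, he⟩ := Finite.exists_ne_map_eq_of_infinite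
    (fun x : ℕ => fun t : Fin n => u (N0 + x + t))
  have hA : Ag u n (N0 + x) (N0 + y) := fun t ht => congrFun he ⟨t, ht⟩
  have hall : ∀ m, Ag u n (N0 + x + m) (N0 + y + m) := by
    intro m
    induction m with
    | zero => exact hA
    | succ m ih =>
      intro t ht
      by_cases h' : t + 1 < n
      · have := ih (t+1) h'
        rw [show N0 + x + (m+1) + t = N0 + x + m + (t+1) by ring, this]
        congr 1; ring
      · have h'' : n = t + 1 := by omega
        have := key _ _ (by omega) (by omega) ih
        rw [show N0 + x + (m+1) + t = N0 + x + m + n by omega, this]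
        congr 1; omega
  obtain ⟨m, hm⟩ := h (N0 + x) (N0 + y) (by omega)
  apply hm
  by_cases hmn : m < n
  · exact hA m hmn
  · have := key _ _ (by omega) (by omega) (hall (m - n))
    rwa [show N0 + x + (m - n) + n = N0 + x + m by omega,
      show N0 + y + (m - n) + n = N0 + y + m by omega] at this

lemma RSinf.mono {u : ℕ → Bool} {n m : ℕ} (h : RSinf u n) (hm : m ≤ n) : RSinf u m := by
  obtain ⟨p, hp⟩ := h
  refine ⟨fun t => p (t + (n - m)), fun c N => ?_⟩
  obtain ⟨i, hi, h1, h2⟩ := hp c N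
  refine ⟨i + (n - m), by omega, fun t ht => ?_, ?_⟩
  · change _ = p (t + (n - m))
    rw [← h1 _ (by omega : t + (n - m) < n)]; congr 1; omega
  · rw [← h2]; congr 1; omega

lemma prefix_rec {u : ℕ → Bool} (h : NP u) (hu : UR u) (n : ℕ) : ∃ i ≥ 1, Ag u n 0 i := by
  induction n with
  | zero => exact ⟨1, le_rfl, fun t ht => by omega⟩
  | succ n ih =>
    obtain ⟨i, hi, hA⟩ := ih
    by_cases he : u (0 + n) = u (i + n)
    · refine ⟨i, hi, fun t ht => ?_⟩
      rcases Nat.lt_succ_iff_lt_or_eq.mp ht with h' | h'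
      · exact hA t h'
      · subst h'; exact he
    · have hRS : RS u n 0 := ⟨i, hA, he⟩
      obtain ⟨p, hp⟩ := h.rsinf n
      obtain ⟨i1, hi1, h1, h2⟩ := hp (u (0 + n)) 1
      obtain ⟨i2, hi2, h3, h4⟩ := hp (!u (0 + n)) 1
      have hRS1 : RS u n i1 := ⟨i2, fun t ht => (h1 t ht).trans (h3 t ht).symm, by
        rw [h2, h4]; cases u (0+n) <;> simp⟩
      have := hu n _ _ hRS hRS1
      refine ⟨i1, hi1, fun t ht => ?_⟩
      rcases Nat.lt_succ_iff_lt_or_eq.mp ht with h' | h'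
      · exact this t h'
      · subst h'; exact h2.symm

lemma exists_letter {u : ℕ → Bool} (h : NP u) (hu : UR u) : ∃ a, NA a u := by
  obtain ⟨p, hp⟩ := h.rsinf 1
  refine ⟨p 0, fun i hi => ?_⟩
  by_contra hcon
  have hi1 : u (i + 1) = !(p 0) := by
    revert hcon; cases u (i+1) <;> cases p 0 <;> simp
  obtain ⟨i1, hi1', h1, h2⟩ := hp (p 0) (i + 1)
  obtain ⟨i2, hi2', h3, h4⟩ := hp (!(p 0)) (i + 1)
  have hRS1 : RS u 1 i1 := ⟨i2, fun t ht => (h1 t ht).trans (h3 t ht).symm, by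
        rw [h2, h4]; cases p 0 <;> simp⟩
  have hj : ∃ j ≥ i, u j = (!(p 0)) ∧ u (j + 1) = p 0 := by
    by_contra hno
    push Not at hno
    have : ∀ m, u (i + m) = !(p 0) := by
      intro m
      induction m with
      | zero => exact hi
      | succ m ih =>
        have := hno (i + m) (by omega) ih
        revert this
        rw [show i + (m + 1) = i + m + 1 by ring]
        cases u (i+m+1) <;> cases p 0 <;> simp
    have h5 := h1 0 (by norm_num)
    have h6 := this (i1 - i)
    rw [show i + (i1 - i) = i1 + 0 by omega, h5] at h6
    revert h6; cases p 0 <;> simp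
  obtain ⟨j, hj1, hj2, hj3⟩ := hj
  have hRSi : RS u 1 i := ⟨j, fun t ht => by
    have : t = 0 := by omega
    subst this; simpa [hi] using hj2.symm, by rw [hi1, hj3]; cases p 0 <;> simp⟩
  have h7 := hu 1 _ _ hRSi hRS1 0 (by norm_num)
  have h5 := h1 0 (by norm_num)
  rw [h5] at h7
  simp only [add_zero] at h7
  rw [hi] at h7
  revert h7; cases p 0 <;> simp

/-- block starts -/
def bpos (a : Bool) (v : ℕ → Bool) : ℕ → ℕ
  | 0 => 0
  | n + 1 => bpos a v n + if v (bpos a v n) = a then 1 else 2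

def der (a : Bool) (v : ℕ → Bool) (n : ℕ) : Bool := v (bpos a v n)

lemma bpos_succ (a : Bool) (v : ℕ → Bool) (n : ℕ) :
    bpos a v (n+1) = bpos a v n + if der a v n = a then 1 else 2 := rfl

lemma bpos_cover (a : Bool) (v : ℕ → Bool) (y : ℕ) :
    ∃ k, bpos a v k = y ∨ (bpos a v k + 1 = y ∧ v (bpos a v k) = !a) := by
  induction y with
  | zero => exact ⟨0, Or.inl rfl⟩
  | succ y ih =>
    obtain ⟨k, hk | ⟨hk, hk'⟩⟩ := ih
    · by_cases h : v (bpos a v k) = a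
      · refine ⟨k + 1, Or.inl ?_⟩
        rw [bpos_succ, der, if_pos h, hk]
      · refine ⟨k, Or.inr ⟨by rw [hk], ?_⟩⟩
        revert h; cases v (bpos a v k) <;> cases a <;> simp
    · refine ⟨k + 1, Or.inl ?_⟩
      rw [bpos_succ, der, hk', if_neg (by cases a <;> simp)]; omega

lemma bpos_lt_succ (a : Bool) (v : ℕ → Bool) (n : ℕ) : bpos a v n < bpos a v (n+1) := by
  rw [bpos_succ]; split_ifs <;> omega

lemma bpos_strictMono (a : Bool) (v : ℕ → Bool) : StrictMono (bpos a v) :=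
  strictMono_nat_of_lt_succ (bpos_lt_succ a v)

lemma bpos_ge (a : Bool) (v : ℕ → Bool) (n : ℕ) : n ≤ bpos a v n :=
  (bpos_strictMono a v).id_le n

lemma bpos_le (a : Bool) (v : ℕ → Bool) (n : ℕ) : bpos a v n ≤ 2 * n := by
  induction n with
  | zero => simp [bpos]
  | succ n ih => rw [bpos_succ]; split_ifs <;> omega

/-- the letter before a (non initial) block start is `a` -/
lemma bpos_pred {a : Bool} {v : ℕ → Bool} (hv : NA a v) (k : ℕ) :
    ∃ y, bpos a v (k+1) = y + 1 ∧ v y = a := by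
  rw [bpos_succ]
  split_ifs with h
  · exact ⟨_, rfl, h⟩
  · exact ⟨bpos a v k + 1, rfl, hv _ (by
      have h' : v (bpos a v k) ≠ a := h
      revert h'; cases v (bpos a v k) <;> cases a <;> simp)⟩

lemma der_ag {a : Bool} {v : ℕ → Bool} (hv : NA a v) {n i j : ℕ} (h : Ag (der a v) n i j) :
    ∃ m, n ≤ m ∧ bpos a v (i + n) = bpos a v i + m ∧ bpos a v (j + n) = bpos a v j + m ∧
      Ag v m (bpos a v i) (bpos a v j) := by
  induction n with
  | zero => exact ⟨0, le_rfl, rfl, rfl, fun t ht => by omega⟩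
  | succ n ih =>
    obtain ⟨m, hm0, hm1, hm2, hm3⟩ := ih (fun t ht => h t (by omega))
    have hn := h n (by omega)
    have hn' : v (bpos a v i + m) = v (bpos a v j + m) := by
      rw [← hm1, ← hm2]; exact hn
    have e1 : bpos a v (i + (n+1)) = bpos a v i + m + if der a v (i+n) = a then 1 else 2 := by
      rw [← add_assoc, bpos_succ, hm1]
    have e2 : bpos a v (j + (n+1)) = bpos a v j + m + if der a v (i+n) = a then 1 else 2 := by
      rw [← add_assoc, bpos_succ, hm2, hn]
    by_cases ha : der a v (i + n) = a
    · rw [if_pos ha] at e1 e2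
      refine ⟨m + 1, by omega, by omega, by omega, fun t ht => ?_⟩
      rcases Nat.lt_succ_iff_lt_or_eq.mp ht with h' | h'
      · exact hm3 t h'
      · subst h'; exact hn'
    · rw [if_neg ha] at e1 e2
      have hb : v (bpos a v i + m) = !a := by
        rw [← hm1]; change der a v (i+n) = _
        revert ha; cases der a v (i+n) <;> cases a <;> simp
      refine ⟨m + 2, by omega, by omega, by omega, fun t ht => ?_⟩
      rcases (by omega : t < m ∨ t = m ∨ t = m + 1) with h' | h' | h'
      · exact hm3 t h'
      · subst h'; exact hn'
      · subst h'
        rw [← add_assoc, ← add_assoc, hv _ hb, hv _ (hn' ▸ hb)]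

lemma np_der {a : Bool} {v : ℕ → Bool} (hv : NA a v) (h : NP v) : NP (der a v) := by
  intro i j hij
  by_contra hcon
  push Not at hcon
  obtain ⟨n, hn⟩ := h (bpos a v i) (bpos a v j) (fun he => hij ((bpos_strictMono a v).injective he))
  obtain ⟨m, hm0, -, -, hm⟩ := der_ag hv (n := n + 1) (i := i) (j := j) (fun t _ => hcon t)
  exact hn (hm n (by omega))

lemma der_rec {a : Bool} {v : ℕ → Bool} (hv : NA a v)
    (H : ∀ n, ∃ y ≥ 1, Ag v n 0 y ∧ v (y - 1) = a) (n : ℕ) : ∃ k ≥ 1, Ag (der a v) n 0 k := by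
  obtain ⟨y, hy, hA, hya⟩ := H (2 * n + 1)
  obtain ⟨k, hk | ⟨hk, hk'⟩⟩ := bpos_cover a v y
  swap
  · exfalso
    rw [show y - 1 = bpos a v k by omega, hk'] at hya
    revert hya; cases a <;> simp
  have key : ∀ m ≤ n, bpos a v (k + m) = y + bpos a v m := by
    intro m hm
    induction m with
    | zero => simp [hk, bpos]
    | succ m ih =>
      have ih := ih (by omega)
      have h1 := hA (bpos a v m) (by have := bpos_le a v m; omega)
      rw [← add_assoc, bpos_succ, bpos_succ, der, der, ih, ← h1]; simp [add_assoc]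
  refine ⟨k, ?_, fun t ht => ?_⟩
  · rcases Nat.eq_zero_or_pos k with h | h
    · subst h; simp [bpos] at hk; omega
    · exact h
  · have h1 := hA (bpos a v t) (by have := bpos_le a v t; omega)
    rw [der, der, key t ht.le, ← h1]; simp

lemma exists_last_diff {u : ℕ → Bool} {n i j : ℕ} (h : ¬ Ag u n i j) :
    ∃ t < n, u (i + t) ≠ u (j + t) ∧ Ag u (n - t - 1) (i + t + 1) (j + t + 1) := by
  classical
  unfold Ag at h
  push Not at h
  obtain ⟨t0, ht0, hne⟩ := h
  let S := (Finset.range n).filter (fun t => u (i + t) ≠ u (j + t))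
  have hS : S.Nonempty := ⟨t0, by simp [S, ht0, hne]⟩
  have hm := S.max'_mem hS
  set t := S.max' hS with htdef
  simp only [S, Finset.mem_filter, Finset.mem_range] at hm
  refine ⟨t, hm.1, hm.2, fun s hs => ?_⟩
  by_contra hcon
  have : t + 1 + s ∈ S := by
    simp only [S, Finset.mem_filter, Finset.mem_range]
    refine ⟨by omega, ?_⟩
    rwa [show i + (t + 1 + s) = i + t + 1 + s by ring, show j + (t + 1 + s) = j + t + 1 + s by ring]
  have := S.le_max' _ this
  omega

/-- the key synchronisation step -/
lemma der_rs_ext {a : Bool} {v : ℕ → Bool} (hv : NA a v) {n i j : ℕ}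
    (h : Ag (der a v) n (i+1) (j+1)) (hne : der a v (i + 1 + n) ≠ der a v (j + 1 + n)) :
    ∀ t ≤ n, ∃ m, bpos a v (i + 1 + n) = bpos a v (i + 1 + t) + m ∧
      RS v (m + 1) (bpos a v (i + 1 + t) - 1) := by
  intro t ht
  have h' : Ag (der a v) (n - t) (i + 1 + t) (j + 1 + t) := fun s hs => by
    have := h (t + s) (by omega)
    rwa [← add_assoc, ← add_assoc] at this
  obtain ⟨m, hm0, hm1, hm2, hm3⟩ := der_ag hv h'
  rw [show i + 1 + t + (n - t) = i + 1 + n by omega] at hm1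
  rw [show j + 1 + t + (n - t) = j + 1 + n by omega] at hm2
  refine ⟨m, hm1, ?_⟩
  obtain ⟨y, hy1, hy2⟩ := bpos_pred hv (i + t)
  obtain ⟨y', hy1', hy2'⟩ := bpos_pred hv (j + t)
  rw [show i + t + 1 = i + 1 + t by ring] at hy1
  rw [show j + t + 1 = j + 1 + t by ring] at hy1'
  refine ⟨y', ?_, ?_⟩
  · intro s hs
    rw [hy1, Nat.add_sub_cancel]
    rcases Nat.eq_zero_or_pos s with h0 | h0
    · subst h0; simp [hy2, hy2']
    · have := hm3 (s - 1) (by omega)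
      rw [hy1, hy1'] at this
      rwa [show y + 1 + (s - 1) = y + s by omega, show y' + 1 + (s - 1) = y' + s by omega] at this
  · have e1 : bpos a v (i + 1 + t) - 1 + (m + 1) = bpos a v (i + 1 + n) := by omega
    have e2 : y' + (m + 1) = bpos a v (j + 1 + n) := by omega
    rw [e1, e2]; exact hne

lemma ur_der {a : Bool} {v : ℕ → Bool} (hv : NA a v) (h : UR v)
    (H : ∀ n, ∃ y ≥ 1, Ag v n 0 y ∧ v (y - 1) = a) : UR (der a v) := by
  -- first for positions at least one
  have main : ∀ n i j i' j', Ag (der a v) n (i+1) (j+1) →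
      der a v (i + 1 + n) ≠ der a v (j + 1 + n) → Ag (der a v) n (i'+1) (j'+1) →
      der a v (i' + 1 + n) ≠ der a v (j' + 1 + n) →
      Ag (der a v) n (i+1) (i'+1) := by
    intro n i j i' j' h1 h2 h3 h4
    by_contra hcon
    obtain ⟨t, htn, hne, hAg⟩ := exists_last_diff hcon
    -- WLOG
    have core : ∀ i j i' j', Ag (der a v) n (i+1) (j+1) →
      der a v (i + 1 + n) ≠ der a v (j + 1 + n) → Ag (der a v) n (i'+1) (j'+1) →
      der a v (i' + 1 + n) ≠ der a v (j' + 1 + n) → der a v (i + 1 + t) = a →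
      der a v (i' + 1 + t) = (!a) →
      Ag (der a v) (n - t - 1) (i + 1 + t + 1) (i' + 1 + t + 1) → False := by
      intro i j i' j' h1 h2 h3 h4 ha hb hAg
      obtain ⟨m0, -, hm1, hm2, -⟩ := der_ag hv hAg
      rw [show i + 1 + t + 1 + (n - t - 1) = i + 1 + n by omega] at hm1
      rw [show i' + 1 + t + 1 + (n - t - 1) = i' + 1 + n by omega] at hm2
      obtain ⟨m, hm, hRS⟩ := der_rs_ext hv h1 h2 t htn.le
      obtain ⟨m', hm', hRS'⟩ := der_rs_ext hv h3 h4 (t+1) (by omega)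
      have e1 := bpos_succ a v (i + 1 + t)
      have e2 := bpos_succ a v (i' + 1 + t)
      rw [if_pos ha] at e1
      rw [hb, if_neg (by cases a <;> simp)] at e2
      rw [← add_assoc (i' + 1) t 1] at hm' hRS'
      have em : m = m0 + 1 := by omega
      have em' : m' = m0 := by omega
      -- extend the second one to the left within the block
      obtain ⟨m'', hm'', hRS''⟩ := der_rs_ext hv h3 h4 t htn.le
      have em'' : m'' = m0 + 2 := by omega
      subst em em' em''
      obtain ⟨y, hy1, hy2⟩ := bpos_pred hv (i + t)
      rw [show i + t + 1 = i + 1 + t by ring] at hy1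
      -- restrict hRS'' to suffix starting at block start
      have hRS3 : RS v (m' + 2) (bpos a v (i' + 1 + t)) := by
        obtain ⟨z, hz1, hz2⟩ := hRS''
        obtain ⟨y', hy1', hy2'⟩ := bpos_pred hv (i' + t)
        rw [show i' + t + 1 = i' + 1 + t by ring] at hy1'
        refine ⟨z + 1, fun s hs => ?_, ?_⟩
        · have := hz1 (s + 1) (by omega)
          rw [hy1'] at this ⊢
          rwa [Nat.add_sub_cancel, show y' + (s + 1) = y' + 1 + s by ring,
            show z + (s + 1) = z + 1 + s by ring] at this
        · rw [hy1'] at hz2 ⊢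
          rwa [Nat.add_sub_cancel, show y' + (m' + 2 + 1) = y' + 1 + (m' + 2) by ring,
            show z + (m' + 2 + 1) = z + 1 + (m' + 2) by ring] at hz2
      have := h _ _ _ hRS hRS3 0 (by omega)
      rw [hy1, Nat.add_sub_cancel, add_zero, add_zero, hy2] at this
      have hb' : v (bpos a v (i' + 1 + t)) = !a := hb
      rw [hb'] at this
      revert this; cases a <;> simp
    by_cases ha : der a v (i + 1 + t) = a
    · refine core i j i' j' h1 h2 h3 h4 ha ?_ hAg
      rw [ha] at hne
      revert hne; cases der a v (i' + 1 + t) <;> cases a <;> simp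
    · refine core i' j' i j h3 h4 h1 h2 ?_ ?_ hAg.symm
      · revert hne ha
        cases der a v (i' + 1 + t) <;> cases der a v (i + 1 + t) <;> cases a <;> simp
      · revert ha; cases der a v (i + 1 + t) <;> cases a <;> simp
  have hrec : ∀ i n, ∃ k, Ag (der a v) n i (k + 1) := by
    intro i n
    obtain ⟨k, hk, hA⟩ := der_rec hv H (i + n)
    refine ⟨i + k - 1, fun t ht => ?_⟩
    have := hA (i + t) (by omega)
    rw [zero_add] at this
    rw [this]; congr 1; omega
  rintro n i i' ⟨j, h1, h2⟩ ⟨j', h1', h2'⟩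
  obtain ⟨x, hx⟩ := hrec i (n+1)
  obtain ⟨y, hy⟩ := hrec j (n+1)
  obtain ⟨x', hx'⟩ := hrec i' (n+1)
  obtain ⟨y', hy'⟩ := hrec j' (n+1)
  have w : ∀ {i k}, Ag (der a v) (n+1) i k → Ag (der a v) n i k :=
    fun h t ht => h t (by omega)
  have := main n x y x' y' ((w hx).symm.trans (h1.trans (w hy)))
    (by rw [← hx n (by omega), ← hy n (by omega)]; exact h2)
    ((w hx').symm.trans (h1'.trans (w hy')))
    (by rw [← hx' n (by omega), ← hy' n (by omega)]; exact h2')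
  exact (w hx).trans (this.trans (w hx').symm)

def preS (a : Bool) (u : ℕ → Bool) : ℕ → Bool := if u 0 = a then fun n => u (n+1) else u

def stepW (a : Bool) (u : ℕ → Bool) : ℕ → Bool := der a (preS a u)

lemma NA.preS {a : Bool} {u : ℕ → Bool} (h : NA a u) : NA a (preS a u) := by
  unfold _root_.preS
  split_ifs
  · exact fun i hi => h (i+1) hi
  · exact h

lemma step_class {a : Bool} {u : ℕ → Bool} (ha : NA a u) (h1 : NP u) (h2 : UR u) :
    NP (stepW a u) ∧ UR (stepW a u) := by
  have hNP : NP (preS a u) := by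
    unfold preS
    split_ifs
    · intro i j hij
      obtain ⟨n, hn⟩ := h1 (i+1) (j+1) (by omega)
      refine ⟨n, ?_⟩
      rwa [show i + 1 + n = i + n + 1 by ring, show j + 1 + n = j + n + 1 by ring] at hn
    · exact h1
  have hUR : UR (preS a u) := by
    unfold preS
    split_ifs
    · have e : ∀ n i j, Ag (fun n => u (n+1)) n i j ↔ Ag u n (i+1) (j+1) := by
        intro n i j
        unfold Ag
        simp only [add_right_comm]
      rintro n i i' ⟨j, hj1, hj2⟩ ⟨j', hj1', hj2'⟩
      rw [e]
      refine h2 n _ _ ⟨j+1, (e _ _ _).1 hj1, ?_⟩ ⟨j'+1, (e _ _ _).1 hj1', ?_⟩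
      · simpa only [add_right_comm] using hj2
      · simpa only [add_right_comm] using hj2'
    · exact h2
  have H : ∀ n, ∃ y ≥ 1, Ag (preS a u) n 0 y ∧ preS a u (y - 1) = a := by
    intro n
    unfold preS
    split_ifs with h0
    · obtain ⟨y, hy, hA⟩ := prefix_rec h1 h2 (n+1+1)
      -- need an occurrence at least 2
      have hex : ∃ y ≥ 2, Ag u (n+1) 0 y := by
        by_cases h2y : 2 ≤ y
        · exact ⟨y, h2y, fun t ht => hA t (by omega)⟩
        · obtain ⟨z, hz, hz'⟩ := prefix_rec h1 h2 (n+1+y)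
          refine ⟨y + z, by omega, fun t ht => ?_⟩
          have e1 := hA t (by omega)
          have e2 := hz' (y + t) (by omega)
          rw [e1, ← zero_add (y + t), e2]; congr 1; ring
      obtain ⟨y, hy, hA⟩ := hex
      refine ⟨y, by omega, fun t ht => ?_, ?_⟩
      · have := hA (t+1) (by omega)
        exact (congrArg u (by ring)).trans (this.trans (congrArg u (by ring)))
      · have := hA 0 (by omega)
        change u (y - 1 + 1) = a
        rw [show y - 1 + 1 = y + 0 by omega, ← this]; exact h0
    · obtain ⟨y, hy, hA⟩ := prefix_rec h1 h2 (n+1)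
      refine ⟨y, hy, fun t ht => hA t (by omega), ?_⟩
      by_contra hcon
      have e := ha (y-1) (by revert hcon; cases u (y-1) <;> cases a <;> simp)
      rw [show y - 1 + 1 = y + 0 by omega, ← hA 0 (by omega)] at e
      exact h0 e
  exact ⟨np_der ha.preS hNP, ur_der ha.preS hUR H⟩

end

section
open Filter

lemma exists_chain {w : ℕ → Bool} (h1 : NP w) (h2 : UR w) :
    ∃ (U : ℕ → ℕ → Bool) (a : ℕ → Bool), U 0 = w ∧ ∀ k, NA (a k) (U k) ∧
      U (k+1) = stepW (a k) (U k) ∧ NP (U k) := by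
  classical
  let lt : (ℕ → Bool) → Bool := fun u => if h : ∃ a, NA a u then h.choose else false
  let U : ℕ → ℕ → Bool := fun k => Nat.rec w (fun _ u => stepW (lt u) u) k
  have hlt : ∀ u, NP u → UR u → NA (lt u) u := by
    intro u hu hu'
    have h := exists_letter hu hu'
    simp only [lt, dif_pos h]
    exact h.choose_spec
  have hc : ∀ k, NP (U k) ∧ UR (U k) := by
    intro k
    induction k with
    | zero => exact ⟨h1, h2⟩
    | succ k ih => exact step_class (hlt _ ih.1 ih.2) ih.1 ih.2
  exact ⟨U, fun k => lt (U k), rfl, fun k => ⟨hlt _ (hc k).1 (hc k).2, rfl, (hc k).1⟩⟩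

def Win (u : ℕ → Bool) (c : Bool) (B : ℕ) : Prop := ∀ i, ∃ t ≤ B, u (i + t) = c

lemma Win.mono {u : ℕ → Bool} {c : Bool} {B B' : ℕ} (h : Win u c B) (hB : B ≤ B') :
    Win u c B' := fun i => by
  obtain ⟨t, ht, h'⟩ := h i
  exact ⟨t, by omega, h'⟩

lemma bpos_add_le (a : Bool) (v : ℕ → Bool) (k t : ℕ) : bpos a v (k + t) ≤ bpos a v k + 2 * t := by
  induction t with
  | zero => simp
  | succ n ih => rw [← add_assoc, bpos_succ]; split_ifs <;> omega

lemma win_lift {a : Bool} {u : ℕ → Bool} {c : Bool} {B : ℕ} (h : Win (stepW a u) c B) :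
    Win u c (2 * B + 2) := by
  have hv : Win (preS a u) c (2 * B + 1) := by
    intro i
    have : ∃ k, i ≤ bpos a (preS a u) k ∧ bpos a (preS a u) k ≤ i + 1 := by
      obtain ⟨k, hk | ⟨hk, hk'⟩⟩ := bpos_cover a (preS a u) i
      · exact ⟨k, by omega, by omega⟩
      · refine ⟨k + 1, ?_⟩
        rw [bpos_succ, der, hk', if_neg (by cases a <;> simp)]; omega
    obtain ⟨k, hk1, hk2⟩ := this
    obtain ⟨t, ht, hc⟩ := h k
    have h3 := bpos_add_le a (preS a u) k t
    have h4 := (bpos_strictMono a (preS a u)).monotone (show k ≤ k + t by omega)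
    refine ⟨bpos a (preS a u) (k + t) - i, by omega, ?_⟩
    rw [← hc, show i + (bpos a (preS a u) (k + t) - i) = bpos a (preS a u) (k + t) by omega]
    rfl
  intro i
  obtain ⟨t, ht, hc⟩ := hv i
  unfold preS at hc
  split_ifs at hc
  · exact ⟨t + 1, by omega, hc⟩
  · exact ⟨t, by omega, hc⟩

lemma rs_lift {a : Bool} {u : ℕ → Bool} (ha : NA a u) {n : ℕ} (h : RSinf (stepW a u) n) :
    RSinf u (n+1) := by
  have hv := ha.preS
  have h' : RSinf (preS a u) (n+1) := by
    obtain ⟨p, hp⟩ := h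
    obtain ⟨i0, hi0, hp0, -⟩ := hp true 1
    have hA0 : Ag (der a (preS a u)) n i0 i0 := fun t _ => rfl
    obtain ⟨m, hm0, hm1, -, -⟩ := der_ag hv hA0
    have : RSinf (preS a u) (m+1) := by
      refine ⟨fun t => preS a u (bpos a (preS a u) i0 - 1 + t), fun c N => ?_⟩
      obtain ⟨i, hi, hpi, hc⟩ := hp c (N+1)
      have hA : Ag (der a (preS a u)) n i0 i := fun t ht => (hp0 t ht).trans (hpi t ht).symm
      obtain ⟨m', -, hm1', hm2', hm3'⟩ := der_ag hv hA
      have : m' = m := by omega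
      subst this
      obtain ⟨y, hy1, hy2⟩ := bpos_pred hv (i0 - 1)
      obtain ⟨y', hy1', hy2'⟩ := bpos_pred hv (i - 1)
      rw [show i0 - 1 + 1 = i0 by omega] at hy1
      rw [show i - 1 + 1 = i by omega] at hy1'
      have := bpos_ge a (preS a u) i
      refine ⟨y', by omega, fun t ht => ?_, ?_⟩
      · change _ = preS a u (bpos a (preS a u) i0 - 1 + t)
        rw [hy1, Nat.add_sub_cancel]
        rcases Nat.eq_zero_or_pos t with h0 | h0
        · subst h0; simp [hy2, hy2']
        · have := hm3' (t - 1) (by omega)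
          rw [hy1, hy1'] at this
          rw [show y + 1 + (t - 1) = y + t by omega, show y' + 1 + (t - 1) = y' + t by omega] at this
          exact this.symm
      · rw [← hc, show y' + (m' + 1) = bpos a (preS a u) (i + n) by omega]; rfl
    exact this.mono (by omega)
  obtain ⟨p, hp⟩ := h'
  refine ⟨p, fun c N => ?_⟩
  obtain ⟨i, hi, h1, h2⟩ := hp c N
  unfold preS at h1 h2
  split_ifs at h1 h2
  · refine ⟨i + 1, by omega, fun t ht => ?_, ?_⟩
    · rw [← h1 t ht]; exact congrArg u (by ring)
    · rw [← h2]; exact congrArg u (by ring)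
  · exact ⟨i, hi, h1, h2⟩

def Run (u : ℕ → Bool) (a : Bool) (L : ℕ) : Prop :=
  ∀ i, u i = (!a) → ∀ t, 1 ≤ t → t ≤ L → u (i + t) = a

lemma run_lift {a : Bool} {u : ℕ → Bool} (ha : NA a u) {L : ℕ} (h : Run (stepW a u) a L) :
    Run u a (L+1) := by
  have hv := ha.preS
  have h' : Run (preS a u) a (L+1) := by
    intro i hi t ht1 ht2
    obtain ⟨k, hk | ⟨hk, hk'⟩⟩ := bpos_cover a (preS a u) i
    swap
    · have := hv _ hk'
      rw [hk, hi] at this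
      revert this; cases a <;> simp
    have hdk : stepW a u k = !a := by rw [← hi, ← hk]; rfl
    have hr := h k hdk
    have key : ∀ s ≤ L, bpos a (preS a u) (k + 1 + s) = i + 2 + s := by
      intro s hs
      induction s with
      | zero =>
        have : der a (preS a u) k = !a := hdk
        rw [add_zero, bpos_succ, this, hk, if_neg (by cases a <;> simp)]
      | succ s ih =>
        have : der a (preS a u) (k + 1 + s) = a := by
          have := hr (1 + s) (by omega) (by omega)
          rwa [← add_assoc] at this
        rw [← add_assoc, bpos_succ, this, if_pos rfl, ih (by omega)]; ring
    rcases (show t = 1 ∨ ∃ s, t = s + 2 ∧ s < L by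
      by_cases h1 : t = 1
      · exact Or.inl h1
      · exact Or.inr ⟨t - 2, by omega, by omega⟩) with h1 | ⟨s, h1, h2⟩
    · subst h1; exact hv _ hi
    · subst h1
      rw [show i + (s + 2) = i + 2 + s by ring, ← key s h2.le]
      have := hr (1 + s) (by omega) (by omega)
      rw [← add_assoc] at this
      exact this
  intro i hi t ht1 ht2
  unfold preS at h'
  split_ifs at h' with h0
  · rcases Nat.eq_zero_or_pos i with h3 | h3
    · subst h3; rw [h0] at hi; revert hi; cases a <;> simp
    · have := h' (i - 1) (by change u (i - 1 + 1) = _; rw [Nat.sub_add_cancel h3]; exact hi) t ht1 ht2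
      rw [← this]; exact congrArg u (by omega)
  · exact h' i hi t ht1 ht2

lemma chain_run {U : ℕ → ℕ → Bool} {a : ℕ → Bool}
    (hU : ∀ k, NA (a k) (U k) ∧ U (k+1) = stepW (a k) (U k)) (c : Bool) (L k : ℕ)
    (h : ∀ j < L, a (k + j) = c) : Run (U k) c L := by
  induction L generalizing k with
  | zero => intro i hi t h1 h2; omega
  | succ L ih =>
    have h0 : a k = c := h 0 (by omega)
    have := ih (k+1) (fun j hj => by
      have := h (j+1) (by omega)
      rw [← this]; exact congrArg a (by ring))
    rw [(hU k).2, h0] at this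
    exact run_lift (h0 ▸ (hU k).1) this

lemma der_congr {a : Bool} {v v' : ℕ → Bool} {n : ℕ} (h : ∀ t ≤ 2 * n, v t = v' t) :
    der a v n = der a v' n := by
  have : ∀ k ≤ n, bpos a v k = bpos a v' k := by
    intro k hk
    induction k with
    | zero => rfl
    | succ k ih =>
      have ih := ih (by omega)
      have := bpos_le a v k
      rw [bpos_succ, bpos_succ, der, der, h _ (by omega), ih]
  have h2 := bpos_le a v n
  rw [der, der, h _ h2, this n le_rfl]

lemma stepW_congr {a : Bool} {v v' : ℕ → Bool} {n : ℕ} (h : ∀ t < 2 * n + 2, v t = v' t) :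
    stepW a v n = stepW a v' n := by
  apply der_congr
  intro t ht
  unfold preS
  rw [h 0 (by omega)]
  split_ifs
  · exact h _ (by omega)
  · exact h _ (by omega)

lemma chain_win {U : ℕ → ℕ → Bool} {a : ℕ → Bool} {L : ℕ}
    (hU : ∀ k, NA (a k) (U k) ∧ U (k+1) = stepW (a k) (U k))
    (hL : ∀ k c, ∃ j ≤ L, a (k + j) = c) : ∃ B, ∀ k c, Win (U k) c B := by
  have h1 : ∀ j, ∃ B, ∀ k c, a (k + j) = c → Win (U k) c B := by
    intro j
    induction j with
    | zero =>
      refine ⟨1, fun k c hc i => ?_⟩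
      by_cases h : U k i = c
      · exact ⟨0, by omega, h⟩
      · refine ⟨1, le_rfl, ?_⟩
        have := (hU k).1 i (by
          rw [add_zero] at hc; rw [hc]
          revert h; cases U k i <;> cases c <;> simp)
        rw [this]; exact hc
    | succ j ih =>
      obtain ⟨B, hB⟩ := ih
      refine ⟨2 * B + 2, fun k c hc => ?_⟩
      have := hB (k+1) c (by rw [← hc]; exact congrArg a (by ring))
      rw [(hU k).2] at this
      exact win_lift this
  choose B hB using h1
  refine ⟨(Finset.range (L+1)).sup B, fun k c => ?_⟩
  obtain ⟨j, hj, hjc⟩ := hL k c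
  exact (hB j k c hjc).mono (Finset.le_sup (Finset.mem_range.2 (by omega)))

lemma limit_word {U : ℕ → ℕ → Bool} {a : ℕ → Bool} {L : ℕ}
    (hU : ∀ k, NA (a k) (U k) ∧ U (k+1) = stepW (a k) (U k))
    (hL : ∀ k c, ∃ j ≤ L, a (k + j) = c) (F : Ultrafilter ℕ) :
    ∃ V : ℕ → Bool, (∀ N, ∀ᶠ k in F, ∀ t < N, U k t = V t) ∧ ∀ n, RSinf V n := by
  classical
  have lim : ∀ f : ℕ → Bool, ∃ c, ∀ᶠ k in F, f k = c := by
    intro f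
    by_cases h : ∀ᶠ k in F, f k = true
    · exact ⟨true, h⟩
    · refine ⟨false, ?_⟩
      rw [← Ultrafilter.eventually_not] at h
      filter_upwards [h] with k hk
      simpa using hk
  choose V hV using fun m n => lim (fun k => U (k + m) n)
  choose A hA using fun m => lim (fun k => a (k + m))
  have hVN : ∀ m N, ∀ᶠ k in F, ∀ t < N, U (k + m) t = V m t := by
    intro m N
    have := (Finset.eventually_all (l := (F : Filter ℕ)) (Finset.range N) (p := fun t k => U (k+m) t = V m t)).2
      (fun t _ => hV m t)
    filter_upwards [this] with k hk t ht
    exact hk t (Finset.mem_range.2 ht)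
  have hNA : ∀ m, NA (A m) (V m) := by
    intro m i hi
    obtain ⟨k, hk1, hk2⟩ := ((hVN m (i+2)).and (hA m)).exists
    have := (hU (k+m)).1 i
    rw [hk1 i (by omega), hk1 (i+1) (by omega), hk2] at this
    exact this hi
  have hst : ∀ m, V (m+1) = stepW (A m) (V m) := by
    intro m
    funext n
    obtain ⟨k, ⟨hk1, hk2⟩, hk3⟩ := (((hVN m (2*n+2)).and (hA m)).and (hV (m+1) n)).exists
    rw [← hk3, ← stepW_congr hk1, ← hk2]
    exact congrFun (hU (k+m)).2 n
  obtain ⟨B, hB⟩ := chain_win hU hL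
  have hW : ∀ m c, Win (V m) c B := by
    intro m c i
    obtain ⟨k, hk⟩ := (hVN m (i+B+1)).exists
    obtain ⟨t, ht, h⟩ := hB (k+m) c i
    exact ⟨t, ht, by rw [← hk _ (by omega)]; exact h⟩
  have hRS : ∀ n m, RSinf (V m) n := by
    intro n
    induction n with
    | zero =>
      intro m
      refine ⟨fun _ => true, fun c N => ?_⟩
      obtain ⟨t, ht, h⟩ := hW m c N
      exact ⟨N + t, by omega, fun t ht => by omega, h⟩
    | succ n ih =>
      intro m
      have := ih (m+1)
      rw [hst m] at this
      exact rs_lift (hNA m) this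
  exact ⟨V 0, fun N => by simpa using hVN 0 N, fun n => hRS n 0⟩

/-! lengths -/
def qs (a : ℕ → Bool) : ℕ → Bool → ℕ
  | 0 => fun _ => 1
  | k + 1 => fun c => if c = a k then qs a k c else qs a k c + qs a k (!c)

lemma qs_pos (a : ℕ → Bool) (k : ℕ) (c : Bool) : 1 ≤ qs a k c := by
  induction k generalizing c with
  | zero => simp [qs]
  | succ k ih => simp only [qs]; split_ifs; exact ih c; have := ih c; omega

lemma qs_sum_ge (a : ℕ → Bool) (k : ℕ) : k + 2 ≤ qs a k true + qs a k false := by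
  induction k with
  | zero => simp [qs]
  | succ k ih =>
    have h1 := qs_pos a k true
    have h2 := qs_pos a k false
    simp only [qs]
    cases a k <;> simp <;> omega

lemma qs_run (a : ℕ → Bool) (c : Bool) (k j : ℕ) (h : ∀ i < j, a (k + i) = c) :
    qs a (k + j) c = qs a k c ∧ qs a (k + j) (!c) = qs a k (!c) + j * qs a k c := by
  induction j with
  | zero => simp
  | succ j ih =>
    obtain ⟨h1, h2⟩ := ih (fun i hi => h i (by omega))
    have h3 := h j (by omega)
    rw [← add_assoc]
    simp only [qs, h3]
    refine ⟨by simpa using h1, ?_⟩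
    rw [if_neg (by cases c <;> simp), Bool.not_not, h1, h2]; ring

lemma qs_start (a : ℕ → Bool) (k : ℕ) : ∃ k0 ≤ k, ∃ c, qs a k0 (!c) ≤ qs a k0 c ∧
    (∀ i, k0 ≤ i → i < k → a i = c) ∧ (k0 = k → qs a k0 (!c) = qs a k0 c) := by
  induction k with
  | zero => exact ⟨0, le_rfl, true, by simp [qs], fun i _ _ => by omega, by simp [qs]⟩
  | succ k ih =>
    obtain ⟨k0, hk0, c, h1, h2, h3⟩ := ih
    by_cases hc : a k = c
    · refine ⟨k0, by omega, c, h1, fun i hi hi' => ?_, by omega⟩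
      rcases Nat.lt_succ_iff_lt_or_eq.mp hi' with h | h
      · exact h2 i hi h
      · subst h; exact hc
    · refine ⟨k, by omega, !c, ?_, fun i hi hi' => ?_, by omega⟩
      · rw [Bool.not_not]
        rcases Nat.eq_or_lt_of_le hk0 with h | h
        · subst h; exact (h3 rfl).ge
        · obtain ⟨e1, e2⟩ := qs_run a c k0 (k - k0) (fun i hi => h2 _ (by omega) (by omega))
          rw [show k0 + (k - k0) = k by omega] at e1 e2
          rw [e1, e2]
          have : 1 * qs a k0 c ≤ (k - k0) * qs a k0 c := Nat.mul_le_mul_right _ (by omega)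
          omega
      · have : i = k := by omega
        subst this
        revert hc; cases a i <;> cases c <;> simp

lemma qs_ratio {a : ℕ → Bool} {L : ℕ} (hL : ∀ k c, ∃ j ≤ L, a (k + j) = c) (k : ℕ) (c : Bool) :
    qs a k c ≤ (L + 1) * qs a k (!c) := by
  obtain ⟨k0, hk0, d, h1, h2, h3⟩ := qs_start a k
  have hlen : k - k0 ≤ L := by
    by_contra hcon
    obtain ⟨j, hj, hj'⟩ := hL k0 (!d)
    rw [h2 _ (by omega) (by omega)] at hj'
    revert hj'; cases d <;> simp
  obtain ⟨e1, e2⟩ := qs_run a d k0 (k - k0) (fun i hi => h2 _ (by omega) (by omega))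
  rw [show k0 + (k - k0) = k by omega] at e1 e2
  have key1 : qs a k (!d) ≤ (L+1) * qs a k d := by
    rw [e1, e2]; nlinarith [qs_pos a k0 d]
  have key2 : qs a k d ≤ (L+1) * qs a k (!d) := by
    have : qs a k d ≤ qs a k (!d) := by
      rcases Nat.eq_or_lt_of_le hk0 with h | h
      · subst h; exact (h3 rfl).ge
      · rw [e1, e2]
        have : 1 * qs a k0 d ≤ (k - k0) * qs a k0 d := Nat.mul_le_mul_right _ (by omega)
        omega
    nlinarith [qs_pos a k (!d)]
  by_cases hc : c = d
  · subst hc; exact key2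
  · have : c = !d := by revert hc; cases c <;> cases d <;> simp
    subst this; simpa using key1

lemma ratio_irrational {a : ℕ → Bool} {L : ℕ} (hL : ∀ k c, ∃ j ≤ L, a (k + j) = c) :
    ∀ n p q : ℕ, 0 < p → 0 < q → p + q ≤ n → ∀ l : Filter ℕ, l.NeBot → l ≤ atTop →
      ¬ Tendsto (fun k => (qs a k false : ℝ) / qs a k true) l (nhds ((p : ℝ) / q)) := by
  have pos : ∀ k c, (0:ℝ) < qs a k c := fun k c => by exact_mod_cast qs_pos a k c
  intro n
  induction n with
  | zero => intro p q hp hq h; omega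
  | succ n ih =>
    intro p q hp hq hpq l hl hle hT
    have hpR : (0:ℝ) < p := by exact_mod_cast hp
    have hqR : (0:ℝ) < q := by exact_mod_cast hq
    have hge : ∀ᶠ k in l, 1 ≤ k := hle (eventually_ge_atTop 1)
    -- predecessor filter
    have hle' : Filter.map (fun k => k - 1) l ≤ atTop :=
      (Filter.map_mono hle).trans (tendsto_sub_atTop_nat 1)
    -- step formula
    have stepT : ∀ k, a k = true → (qs a (k+1) false : ℝ) / qs a (k+1) true
        = (qs a k false : ℝ) / qs a k true + 1 := by
      intro k hk
      have := pos k true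
      simp only [qs, hk]; simp; field_simp
    have stepF : ∀ k, a k = false → (qs a (k+1) true : ℝ) / qs a (k+1) false
        = (qs a k true : ℝ) / qs a k false + 1 := by
      intro k hk
      have := pos k false
      simp only [qs, hk]; simp; field_simp
    have hlow : ∀ k c, 1 / ((L:ℝ) + 1) ≤ (qs a k c : ℝ) / qs a k (!c) := by
      intro k c
      have h := qs_ratio hL k (!c)
      rw [Bool.not_not] at h
      have h' : (qs a k (!c) : ℝ) ≤ ((L:ℝ) + 1) * qs a k c := by exact_mod_cast h
      rw [div_le_div_iff₀ (by positivity) (pos _ _)]; linarith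
    have hL1 : (0:ℝ) < 1 / ((L:ℝ)+1) := by positivity
    rcases lt_trichotomy ((p:ℝ)/q) 1 with hlt | heq | hgt
    · -- eventually a (k-1) = false
      have hpq' : p < q := by
        rw [div_lt_one hqR] at hlt; exact_mod_cast hlt
      have hTi : Tendsto (fun k => (qs a k true : ℝ) / qs a k false) l (nhds ((q:ℝ)/p)) := by
        have := hT.inv₀ (by positivity)
        simpa [inv_div] using this
      have hev : ∀ᶠ k in l, a (k-1) = false ∧ 1 ≤ k := by
        filter_upwards [hT.eventually_lt_const hlt, hge] with k hk hk1
        refine ⟨?_, hk1⟩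
        by_contra hcon
        have := stepT (k-1) (by simpa using hcon)
        rw [Nat.sub_add_cancel hk1] at this
        have h2 : (0:ℝ) < (qs a (k-1) false : ℝ) / qs a (k-1) true := div_pos (pos _ _) (pos _ _)
        linarith
      refine ih p (q - p) hp (by omega) (by omega) (Filter.map (fun k => k - 1) l) inferInstance hle' ?_
      rw [tendsto_map'_iff]
      have h3 : Tendsto (fun k => (qs a (k-1) true : ℝ) / qs a (k-1) false) l (nhds ((q:ℝ)/p - 1)) := by
        refine (hTi.sub_const 1).congr' ?_
        filter_upwards [hev] with k ⟨hk, hk1⟩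
        have := stepF (k-1) hk
        rw [Nat.sub_add_cancel hk1] at this
        rw [this]; ring
      have hqp : (q:ℝ)/p - 1 = ((q - p : ℕ):ℝ)/p := by
        rw [Nat.cast_sub hpq'.le]; field_simp
      rw [hqp] at h3
      have hqp' : (0:ℝ) < ((q - p : ℕ):ℝ) := by exact_mod_cast (by omega : 0 < q - p)
      have := h3.inv₀ (by positivity)
      simpa [inv_div, Function.comp_def] using this
    · -- limit 1 impossible
      rw [heq] at hT
      have hTi : Tendsto (fun k => (qs a k true : ℝ) / qs a k false) l (nhds 1) := by
        have := hT.inv₀ (by positivity)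
        simpa [inv_div] using this
      obtain ⟨k, ⟨hk1, hk2⟩, hk3⟩ := (((hT.eventually_lt_const (show (1:ℝ) < 1 + 1 / ((L:ℝ)+1) by linarith)).and
        (hTi.eventually_lt_const (show (1:ℝ) < 1 + 1 / ((L:ℝ)+1) by linarith))).and hge).exists
      cases hc : a (k-1)
      · have := stepF (k-1) hc
        rw [Nat.sub_add_cancel hk3] at this
        have := hlow (k-1) true
        simp only [Bool.not_true] at this
        linarith
      · have := stepT (k-1) hc
        rw [Nat.sub_add_cancel hk3] at this
        have := hlow (k-1) false
        simp only [Bool.not_false] at this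
        linarith
    · have hpq' : q < p := by
        rw [one_lt_div hqR] at hgt; exact_mod_cast hgt
      have hTi : Tendsto (fun k => (qs a k true : ℝ) / qs a k false) l (nhds ((q:ℝ)/p)) := by
        have := hT.inv₀ (by positivity)
        simpa [inv_div] using this
      have hgt' : (q:ℝ)/p < 1 := by rw [div_lt_one hpR]; exact_mod_cast hpq'
      have hev : ∀ᶠ k in l, a (k-1) = true ∧ 1 ≤ k := by
        filter_upwards [hTi.eventually_lt_const hgt', hge] with k hk hk1
        refine ⟨?_, hk1⟩
        by_contra hcon
        have := stepF (k-1) (by simpa using hcon)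
        rw [Nat.sub_add_cancel hk1] at this
        have h2 : (0:ℝ) < (qs a (k-1) true : ℝ) / qs a (k-1) false := div_pos (pos _ _) (pos _ _)
        linarith
      refine ih (p - q) q (by omega) hq (by omega) (Filter.map (fun k => k - 1) l) inferInstance hle' ?_
      rw [tendsto_map'_iff]
      have h3 : Tendsto (fun k => (qs a (k-1) false : ℝ) / qs a (k-1) true) l (nhds ((p:ℝ)/q - 1)) := by
        refine (hT.sub_const 1).congr' ?_
        filter_upwards [hev] with k ⟨hk, hk1⟩
        have := stepT (k-1) hk
        rw [Nat.sub_add_cancel hk1] at this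
        rw [this]; ring
      have hqp : (p:ℝ)/q - 1 = ((p - q : ℕ):ℝ)/q := by
        rw [Nat.cast_sub hpq'.le]; field_simp
      rw [hqp] at h3
      exact h3

end

section
open Filter

def cnt (V : ℕ → Bool) : ℕ → ℕ
  | 0 => 0
  | n + 1 => cnt V n + if V n then 1 else 0

lemma cnt_add {V p : ℕ → Bool} {i r : ℕ} (h : ∀ t < r, V (i + t) = p t) :
    ∀ t ≤ r, cnt V (i + t) = cnt V i + cnt p t := by
  intro t ht
  induction t with
  | zero => simp [cnt]
  | succ t ih => rw [← add_assoc]; simp only [cnt]; rw [ih (by omega), h t (by omega)]; ring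

noncomputable section

open Polynomial in
def DD : Derivation ℚ (PowerSeries ℚ) (PowerSeries ℚ) :=
  (PowerSeries.X : PowerSeries ℚ) • PowerSeries.derivative ℚ

lemma DD_apply (f : PowerSeries ℚ) : DD f = PowerSeries.X * PowerSeries.derivative ℚ f := rfl

lemma coeff_DD (f : PowerSeries ℚ) (n : ℕ) :
    PowerSeries.coeff n (DD f) = n * PowerSeries.coeff n f := by
  rw [DD_apply]
  cases n with
  | zero => simp
  | succ n => rw [PowerSeries.coeff_succ_X_mul, PowerSeries.coeff_derivative]; push_cast; ring

lemma coeff_DD_iter (f : PowerSeries ℚ) (n i : ℕ) :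
    PowerSeries.coeff n (DD^[i] f) = (n:ℚ)^i * PowerSeries.coeff n f := by
  induction i with
  | zero => simp
  | succ i ih => rw [Function.iterate_succ_apply', coeff_DD, ih]; ring

lemma DD_algebraMap (r : Polynomial ℚ) : DD (algebraMap (Polynomial ℚ) (PowerSeries ℚ) r)
    = algebraMap (Polynomial ℚ) (PowerSeries ℚ) (Polynomial.X * Polynomial.derivative r) := by
  rw [DD_apply, PowerSeries.algebraMap_apply', PowerSeries.algebraMap_apply']
  simp [PowerSeries.derivative_coe]

open Polynomial in
lemma DD_aeval (F : PowerSeries ℚ) (P : (ℚ[X])[X]) :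
    DD (aeval F P) - aeval F (derivative P) * DD F ∈ Algebra.adjoin ℚ[X] {F} := by
  have hF : F ∈ Algebra.adjoin ℚ[X] {F} := Algebra.self_mem_adjoin_singleton _ _
  induction P using Polynomial.induction_on' with
  | add p q hp hq =>
    have := add_mem hp hq
    convert this using 1
    simp; ring
  | monomial n a =>
    have e : DD (aeval F (monomial n a)) - aeval F (derivative (monomial n a)) * DD F
        = algebraMap ℚ[X] _ (X * derivative a) * F ^ n := by
      rw [aeval_monomial, Derivation.leibniz, derivative_monomial, aeval_monomial, DD_algebraMap,
        Derivation.leibniz_pow]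
      simp only [smul_eq_mul, nsmul_eq_mul, map_mul, map_natCast]
      ring
    rw [e]
    exact mul_mem (Subalgebra.algebraMap_mem _ _) (pow_mem hF n)

open Polynomial in
lemma DD_F {F : PowerSeries ℚ} (hF : IsAlgebraic ℚ[X] F) :
    ∃ q : ℚ[X], q ≠ 0 ∧ q • DD F ∈ Algebra.adjoin ℚ[X] {F} := by
  classical
  have hex : ∃ d, ∃ P : (ℚ[X])[X], P ≠ 0 ∧ aeval F P = 0 ∧ P.natDegree = d := by
    obtain ⟨P, h1, h2⟩ := hF
    exact ⟨_, P, h1, h2, rfl⟩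
  obtain ⟨P, hP0, hPF, hPd⟩ := Nat.find_spec hex
  have hinj : Function.Injective (algebraMap ℚ[X] (PowerSeries ℚ)) := by
    intro x y hxy
    rw [PowerSeries.algebraMap_apply', PowerSeries.algebraMap_apply'] at hxy
    simpa using hxy
  have hdeg : P.natDegree ≠ 0 := by
    intro h
    rw [Polynomial.eq_C_of_natDegree_eq_zero h, aeval_C] at hPF
    have : P.coeff 0 = 0 := hinj (by rw [hPF, map_zero])
    apply hP0
    rw [Polynomial.eq_C_of_natDegree_eq_zero h, this, C_0]
  have hd' : aeval F (derivative P) ≠ 0 := by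
    intro h
    refine Nat.find_min hex (m := (derivative P).natDegree) ?_ ⟨derivative P, ?_, h, rfl⟩
    · rw [← hPd]; exact Polynomial.natDegree_derivative_lt hdeg
    · intro h0
      exact hdeg (Polynomial.natDegree_eq_zero_of_derivative_eq_zero h0)
  have h1 := DD_aeval F P
  rw [hPF, map_zero, zero_sub] at h1
  set S := Algebra.adjoin ℚ[X] {F} with hS
  have hPmem : aeval F (derivative P) ∈ S := by
    rw [hS]; exact Polynomial.aeval_mem_adjoin_singleton _ _
  let x : S := ⟨aeval F (derivative P), hPmem⟩
  have hSalg : Algebra.IsAlgebraic ℚ[X] S := by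
    rw [hS]
    exact (Subalgebra.isAlgebraic_iff _).mp (Algebra.isAlgebraic_adjoin_singleton_iff.mpr hF)
  have hx : IsAlgebraic ℚ[X] x := Algebra.IsAlgebraic.isAlgebraic x
  obtain ⟨r, hr0, ⟨y, hy⟩⟩ := hx.exists_nonzero_dvd (mem_nonZeroDivisors_of_ne_zero (by
    intro h; exact hd' (congrArg Subtype.val h)))
  refine ⟨r, hr0, ?_⟩
  have hy' : algebraMap ℚ[X] (PowerSeries ℚ) r = aeval F (derivative P) * y := by
    have := congrArg Subtype.val hy
    exact this
  rw [Algebra.smul_def, hy', mul_assoc, mul_comm (y : PowerSeries ℚ), ← mul_assoc]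
  have := mul_mem (neg_mem h1) y.2
  simpa using this

open Polynomial in
lemma DD_adj {F : PowerSeries ℚ} {q : ℚ[X]} (hq : q • DD F ∈ Algebra.adjoin ℚ[X] {F})
    {g : PowerSeries ℚ} (hg : g ∈ Algebra.adjoin ℚ[X] {F}) :
    q • DD g ∈ Algebra.adjoin ℚ[X] {F} := by
  rw [Algebra.adjoin_singleton_eq_range_aeval] at hg
  obtain ⟨P, rfl⟩ := hg
  have h1 := Subalgebra.smul_mem _ (DD_aeval F P) q
  have h2 : aeval F (derivative P) * (q • DD F) ∈ Algebra.adjoin ℚ[X] {F} :=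
    mul_mem (Polynomial.aeval_mem_adjoin_singleton _ _) hq
  have := add_mem h1 h2
  convert this using 1
  simp only [smul_sub, AlgHom.coe_toRingHom, mul_smul_comm]
  simp

open Polynomial in
lemma DD_iter {F : PowerSeries ℚ} {q : ℚ[X]} (hq0 : q ≠ 0)
    (hq : q • DD F ∈ Algebra.adjoin ℚ[X] {F}) (i : ℕ) :
    ∃ r : ℚ[X], r ≠ 0 ∧ r • DD^[i] F ∈ Algebra.adjoin ℚ[X] {F} := by
  induction i with
  | zero => exact ⟨1, one_ne_zero, by simpa using Algebra.self_mem_adjoin_singleton _ _⟩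
  | succ i ih =>
    obtain ⟨r, hr, hm⟩ := ih
    refine ⟨r * (q * r), by simp [hr, hq0], ?_⟩
    have h1 := Subalgebra.smul_mem _ (DD_adj hq hm) r
    have h2 := Subalgebra.smul_mem _ hm (q * (X * derivative r))
    rw [Function.iterate_succ_apply']
    have := sub_mem h1 h2
    convert this using 1
    rw [Algebra.smul_def r (DD^[i] F), Derivation.leibniz, DD_algebraMap]
    simp only [Algebra.smul_def, smul_eq_mul, map_mul, Algebra.algebraMap_self, RingHom.id_apply]
    ring

open Polynomial in
lemma ode {F : PowerSeries ℚ} (hF : IsAlgebraic ℚ[X] F) :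
    ∃ (m : ℕ) (c : ℕ → ℚ[X]), (∃ i < m, c i ≠ 0) ∧
      ∑ i ∈ Finset.range m, c i • DD^[i] F = 0 := by
  classical
  obtain ⟨q, hq0, hq⟩ := DD_F hF
  obtain ⟨P, hP0, hPF⟩ := hF
  set d := P.natDegree with hd
  set M : Submodule ℚ[X] (PowerSeries ℚ) :=
    Submodule.span ℚ[X] ((Finset.range (d)).image (fun i => F ^ i) : Finset (PowerSeries ℚ)) with hM
  have hMi : ∀ i < d, F ^ i ∈ M := fun i hi => Submodule.subset_span (by
    simp only [Finset.coe_image, Set.mem_image, Finset.coe_range, Set.mem_Iio]; exact ⟨i, hi, rfl⟩)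
  set c := P.leadingCoeff with hc
  have hc0 : c ≠ 0 := by simpa [hc] using hP0
  have hcd : c • F ^ d ∈ M := by
    have h1 := hPF
    rw [aeval_eq_sum_range, Finset.sum_range_succ] at h1
    have h2 : c • F ^ d = - ∑ i ∈ Finset.range d, P.coeff i • F ^ i := by
      rw [eq_neg_iff_add_eq_zero, add_comm]; exact h1
    rw [h2]
    exact neg_mem (sum_mem fun i hi => M.smul_mem _ (hMi i (Finset.mem_range.mp hi)))
  have hFM : ∀ g ∈ M, c • (F * g) ∈ M := by
    intro g hg
    induction hg using Submodule.span_induction with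
    | mem x hx =>
      simp only [Finset.coe_image, Set.mem_image, Finset.coe_range, Set.mem_Iio] at hx
      obtain ⟨i, hi, rfl⟩ := hx
      rw [← pow_succ']
      by_cases h : i + 1 < d
      · exact M.smul_mem _ (hMi _ h)
      · rw [show i + 1 = d by omega]; exact hcd
    | zero => simp
    | add x y _ _ hx hy => rw [mul_add, smul_add]; exact add_mem hx hy
    | smul a x _ hx =>
      rw [mul_smul_comm, smul_comm]; exact M.smul_mem _ hx
  have hpow : ∀ n, ∃ r : ℚ[X], r ≠ 0 ∧ r • F ^ n ∈ M := by
    intro n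
    induction n with
    | zero =>
      by_cases h : 0 < d
      · exact ⟨1, one_ne_zero, by simpa using hMi 0 h⟩
      · exact ⟨c, hc0, by rw [show d = 0 by omega] at hcd; exact hcd⟩
    | succ n ih =>
      obtain ⟨r, hr, hm⟩ := ih
      refine ⟨c * r, mul_ne_zero hc0 hr, ?_⟩
      have := hFM _ hm
      rw [mul_smul_comm, ← pow_succ', smul_smul] at this
      exact this
  have hadj : ∀ g ∈ Algebra.adjoin ℚ[X] {F}, ∃ r : ℚ[X], r ≠ 0 ∧ r • g ∈ M := by
    intro g hg
    rw [Algebra.adjoin_singleton_eq_range_aeval] at hg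
    obtain ⟨Q, rfl⟩ := hg
    induction Q using Polynomial.induction_on' with
    | add p q hp hq =>
      obtain ⟨r, hr, h⟩ := hp
      obtain ⟨r', hr', h'⟩ := hq
      refine ⟨r * r', mul_ne_zero hr hr', ?_⟩
      have := add_mem (M.smul_mem r' h) (M.smul_mem r h')
      convert this using 1
      simp [smul_smul, mul_comm r r']
    | monomial n a =>
      obtain ⟨r, hr, h⟩ := hpow n
      refine ⟨r, hr, ?_⟩
      have := M.smul_mem a h
      rw [smul_comm] at this
      convert this using 2
      simp [aeval_monomial, Algebra.smul_def]
  have hall : ∀ i, ∃ r : ℚ[X], r ≠ 0 ∧ r • DD^[i] F ∈ M := by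
    intro i
    obtain ⟨r, hr, h⟩ := DD_iter hq0 hq i
    obtain ⟨r', hr', h'⟩ := hadj _ h
    exact ⟨r' * r, mul_ne_zero hr' hr, by rw [mul_smul]; exact h'⟩
  choose r hr hrM using hall
  have hdep : ¬ LinearIndependent ℚ[X] (fun i : Fin (d+1) => (⟨r i • DD^[i] F, hrM i⟩ : M)) := by
    intro hli
    have hli' : LinearIndependent ℚ[X] (fun i : Fin (d+1) => r i • DD^[i] F) :=
      hli.map' M.subtype (Submodule.ker_subtype _)
    have h1 := linearIndependent_le_span_aux' (R := ℚ[X]) _ hli'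
      (((Finset.range (d)).image (fun i => F ^ i) : Finset (PowerSeries ℚ)) : Set (PowerSeries ℚ)) (by
        rintro _ ⟨i, rfl⟩; exact hrM i)
    have h2 : ((Finset.range (d)).image (fun i => F ^ i)).card ≤ d := by
      simpa using Finset.card_image_le (s := Finset.range d) (f := fun i => F ^ i)
    rw [Fintype.card_fin] at h1
    have h3 : Fintype.card (((Finset.range (d)).image (fun i => F ^ i) : Finset (PowerSeries ℚ)) : Set (PowerSeries ℚ))
      = ((Finset.range (d)).image (fun i => F ^ i)).card := by
      rw [← Fintype.card_coe]; rfl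
    omega
  rw [Fintype.not_linearIndependent_iff] at hdep
  obtain ⟨g, hg, i0, hi0⟩ := hdep
  refine ⟨d + 1, fun i => if h : i < d + 1 then g ⟨i, h⟩ * r i else 0, ⟨i0, i0.2, ?_⟩, ?_⟩
  · simp only [i0.2, dif_pos]
    exact mul_ne_zero hi0 (hr _)
  · rw [Finset.sum_range]
    have := congrArg Subtype.val hg
    simp only [AddSubmonoidClass.coe_finset_sum, Submodule.coe_smul, ZeroMemClass.coe_zero] at this
    rw [← this]
    refine Finset.sum_congr rfl fun i _ => ?_
    simp only [i.2, dif_pos]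
    rw [smul_smul]

open Polynomial in
lemma rec_of_ode {g : ℕ → ℚ} (hF : IsAlgebraic ℚ[X] (PowerSeries.mk g)) :
    ∃ (J : ℕ) (C : ℕ → ℚ[X]), (∃ j < J, C j ≠ 0) ∧
      ∀ n ≥ J, ∑ j ∈ Finset.range J, (C j).eval (n:ℚ) * g (n - j) = 0 := by
  obtain ⟨m, c, ⟨i0, hi0, hc⟩, h⟩ := ode hF
  set J := (Finset.range m).sup (fun i => (c i).natDegree) + 1 with hJ
  have hJc : ∀ i < m, ∀ j ≥ J, (c i).coeff j = 0 := by
    intro i hi j hj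
    apply Polynomial.coeff_eq_zero_of_natDegree_lt
    have : (c i).natDegree ≤ _ := Finset.le_sup (f := fun i => (c i).natDegree) (Finset.mem_range.mpr hi)
    omega
  refine ⟨J, fun j => taylor (-(j:ℚ)) (∑ i ∈ Finset.range m, monomial i ((c i).coeff j)), ?_, ?_⟩
  · have : ∃ j, (c i0).coeff j ≠ 0 := by
      by_contra hh
      push Not at hh
      exact hc (Polynomial.ext (by simpa using hh))
    obtain ⟨j, hj⟩ := this
    refine ⟨j, ?_, ?_⟩
    · by_contra hh
      exact hj (hJc i0 hi0 j (by omega))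
    · intro h0
      have h1 := taylor_injective (-(j:ℚ)) (h0.trans (map_zero _).symm)
      have h2 := congrArg (fun P => P.coeff i0) h1
      simp [finset_sum_coeff, coeff_monomial, hi0] at h2
      exact hj (h2)
  · intro n hn
    have h1 := congrArg (PowerSeries.coeff n) h
    rw [map_sum, map_zero] at h1
    rw [← h1]
    have h2 : ∀ i ∈ Finset.range m, PowerSeries.coeff n (c i • DD^[i] (PowerSeries.mk g))
        = ∑ j ∈ Finset.range J, (c i).coeff j * (((n:ℚ) - j)^i * g (n - j)) := by
      intro i hi
      rw [Algebra.smul_def, PowerSeries.algebraMap_apply', PowerSeries.coeff_mul,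
        Finset.Nat.sum_antidiagonal_eq_sum_range_succ_mk]
      symm
      apply Finset.sum_subset_zero_on_sdiff
      · intro x hx; simp at hx ⊢; omega
      · intro x hx
        simp at hx
        simp [hJc i (Finset.mem_range.mp hi) x (by omega)]
      · intro x hx
        simp at hx
        rw [coeff_DD_iter, PowerSeries.coeff_mk, Nat.cast_sub (by omega)]
        simp
    rw [Finset.sum_congr rfl h2, Finset.sum_comm]
    refine Finset.sum_congr rfl fun j hj => ?_
    rw [taylor_eval, eval_finset_sum, Finset.sum_mul]
    refine Finset.sum_congr rfl fun i hi => ?_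
    rw [eval_monomial, sub_eq_add_neg]; ring

open Polynomial in
lemma inf_root {P : ℚ[X]} (h : ∀ N : ℕ, ∃ n ≥ N, P.eval (n:ℚ) = 0) : P = 0 := by
  apply Polynomial.eq_zero_of_infinite_isRoot
  have h1 : Set.Infinite {n : ℕ | P.eval (n:ℚ) = 0} := by
    rw [Set.infinite_iff_exists_gt]
    intro N
    obtain ⟨n, hn, h⟩ := h (N+1)
    exact ⟨n, h, by omega⟩
  refine (h1.image (f := fun n : ℕ => (n:ℚ)) (Nat.cast_injective.injOn)).mono ?_
  rintro _ ⟨n, hn, rfl⟩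
  exact hn

open Polynomial in
lemma F_transc {V : ℕ → Bool} (hV : ∀ n, RSinf V n) {s : ℚ} (hs : s ≠ 0) :
    ¬ IsAlgebraic ℚ[X] (PowerSeries.mk (fun n => if V n then s ^ (cnt V n) else 0)) := by
  classical
  intro halg
  obtain ⟨J, C, hC, hrec⟩ := rec_of_ode halg
  have hC' : ∃ j, j < J ∧ C j ≠ 0 := hC
  obtain ⟨hj0, hCj0⟩ := Nat.find_spec hC'
  have hmin := fun m hm => Nat.find_min hC' (m := m) hm
  set j0 := Nat.find hC' with hj0d
  obtain ⟨p, hp⟩ := hV J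
  set A : ℚ[X] := ∑ j ∈ Finset.Ioo j0 J,
    Polynomial.C (if p (J + j0 - j) then s ^ (cnt p (J + j0 - j)) else 0) * C j with hA
  have key : ∀ i c, (∀ t < J, V (i + t) = p t) → V (i + J) = c →
      (A + Polynomial.C (if c then s ^ (cnt p J) else 0) * C j0).eval ((i + J + j0 : ℕ):ℚ) = 0 := by
    intro i c h1 h2
    have h3 := hrec (i + J + j0) (by omega)
    have hsplit : Finset.range J = Finset.range j0 ∪ insert j0 (Finset.Ioo j0 J) := by
      ext x; simp; omega
    rw [hsplit, Finset.sum_union (by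
      rw [Finset.disjoint_left]; intro x hx; simp at hx ⊢; omega),
      Finset.sum_insert (by simp), Finset.sum_eq_zero (by
        intro j hj
        have := hmin j (by simpa using hj)
        push Not at this
        rw [this (by simp at hj; omega)]; simp), zero_add] at h3
    have hcn := cnt_add h1
    have h4 : s ^ (cnt V i) * (A + Polynomial.C (if c then s ^ (cnt p J) else 0) * C j0).eval
        ((i + J + j0 : ℕ):ℚ) = 0 := by
      refine Eq.trans ?_ h3
      rw [eval_add, mul_add, add_comm, hA, eval_finset_sum, Finset.mul_sum]
      congr 1
      · rw [eval_mul, eval_C, show i + J + j0 - j0 = i + J by omega, h2, hcn J le_rfl]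
        cases c <;> simp [pow_add] <;> ring
      · refine Finset.sum_congr rfl fun j hj => ?_
        simp at hj
        rw [eval_mul, eval_C, show i + J + j0 - j = i + (J + j0 - j) by omega,
          h1 _ (by omega), hcn _ (by omega)]
        split_ifs <;> simp [pow_add] <;> ring
    exact (mul_eq_zero.mp h4).resolve_left (pow_ne_zero _ hs)
  have hall : ∀ c : Bool, A + Polynomial.C (if c then s ^ (cnt p J) else 0) * C j0 = 0 := by
    intro c
    apply inf_root
    intro N
    obtain ⟨i, hi, h1, h2⟩ := hp c N
    exact ⟨i + J + j0, by omega, key i c h1 h2⟩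
  have e1 := hall false
  have e2 := hall true
  simp at e1
  rw [e1] at e2
  simp [hs, hCj0] at e2

end

end

section
open Filter

noncomputable section

def shf (u : ℕ → Bool) : ℕ → Bool := fun n => u (n + 1)

def pw (z : Bool → ℝ) (u : ℕ → Bool) : ℕ → ℝ
  | 0 => 1
  | n + 1 => pw z u n * z (u n)

lemma pw_shf (z : Bool → ℝ) (u : ℕ → Bool) (n : ℕ) :
    pw z u (n + 1) = z (u 0) * pw z (shf u) n := by
  induction n with
  | zero => simp [pw]
  | succ n ih => rw [pw, ih]; simp only [pw, shf]; ring

def GG (c : Bool) (u : ℕ → Bool) (z : Bool → ℝ) : ℝ := ∑' n, if u n = c then pw z u n else 0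

structure Zok (z : Bool → ℝ) (ρ : ℝ) : Prop where
  pos : ∀ c, 0 < z c
  le : ∀ c, z c ≤ ρ
  lt : ρ < 1

lemma Zok.rpos {z : Bool → ℝ} {ρ : ℝ} (h : Zok z ρ) : 0 < ρ := (h.pos true).trans_le (h.le true)

lemma Zok.pw_pos {z : Bool → ℝ} {ρ : ℝ} (h : Zok z ρ) (u : ℕ → Bool) (n : ℕ) : 0 < pw z u n := by
  induction n with
  | zero => simp [pw]
  | succ n ih => exact mul_pos ih (h.pos _)

lemma Zok.pw_le {z : Bool → ℝ} {ρ : ℝ} (h : Zok z ρ) (u : ℕ → Bool) (n : ℕ) : pw z u n ≤ ρ ^ n := by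
  induction n with
  | zero => simp [pw]
  | succ n ih =>
    rw [pow_succ]
    exact mul_le_mul ih (h.le _) (h.pos _).le (pow_nonneg h.rpos.le _)

lemma Zok.summable {z : Bool → ℝ} {ρ : ℝ} (h : Zok z ρ) (c : Bool) (u : ℕ → Bool) :
    Summable (fun n => if u n = c then pw z u n else 0) := by
  refine Summable.of_nonneg_of_le (fun n => ?_) (fun n => ?_)
    (summable_geometric_of_lt_one h.rpos.le h.lt)
  · split_ifs; exacts [(h.pw_pos u n).le, le_rfl]
  · split_ifs; exacts [h.pw_le u n, pow_nonneg h.rpos.le _]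

lemma Zok.GG_nonneg {z : Bool → ℝ} {ρ : ℝ} (h : Zok z ρ) (c : Bool) (u : ℕ → Bool) :
    0 ≤ GG c u z := by
  apply tsum_nonneg
  intro n
  split_ifs; exacts [(h.pw_pos u n).le, le_rfl]

lemma Zok.GG_le {z : Bool → ℝ} {ρ : ℝ} (h : Zok z ρ) (c : Bool) (u : ℕ → Bool) :
    GG c u z ≤ (1 - ρ)⁻¹ := by
  rw [← tsum_geometric_of_lt_one h.rpos.le h.lt]
  refine (h.summable c u).tsum_le_tsum (fun n => ?_) (summable_geometric_of_lt_one h.rpos.le h.lt)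
  split_ifs; exacts [h.pw_le u n, pow_nonneg h.rpos.le _]

lemma Zok.GG_shf {z : Bool → ℝ} {ρ : ℝ} (h : Zok z ρ) (c : Bool) (u : ℕ → Bool) :
    GG c u z = (if u 0 = c then 1 else 0) + z (u 0) * GG c (shf u) z := by
  rw [GG, (h.summable c u).tsum_eq_zero_add]
  congr 1
  rw [GG, ← tsum_mul_left]
  congr 1; ext n
  rw [pw_shf]
  by_cases hc : u (n+1) = c
  · rw [if_pos hc, if_pos (show shf u n = c from hc)]
  · rw [if_neg hc, if_neg (show ¬ shf u n = c from hc), mul_zero]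

lemma Zok.GG_tail {z : Bool → ℝ} {ρ : ℝ} (h : Zok z ρ) (c : Bool) (u : ℕ → Bool) (T : ℕ) :
    (∑ n ∈ Finset.range T, if u n = c then pw z u n else 0) ≤ GG c u z ∧
    GG c u z ≤ (∑ n ∈ Finset.range T, if u n = c then pw z u n else 0) + ρ ^ T * (1 - ρ)⁻¹ := by
  have hs := (h.summable c u).sum_add_tsum_nat_add T
  rw [GG, ← hs]
  constructor
  · have : 0 ≤ ∑' n, (if u (n + T) = c then pw z u (n + T) else 0) := tsum_nonneg fun n => by
      split_ifs; exacts [(h.pw_pos u _).le, le_rfl]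
    linarith
  · gcongr
    rw [← tsum_geometric_of_lt_one h.rpos.le h.lt, ← tsum_mul_left]
    refine Summable.tsum_le_tsum (fun n => ?_) ?_ ?_
    · rw [← pow_add, add_comm T n]
      split_ifs; exacts [h.pw_le u _, pow_nonneg h.rpos.le _]
    · exact (summable_nat_add_iff (f := fun n => if u n = c then pw z u n else 0) T).mpr (h.summable c u)
    · exact (summable_geometric_of_lt_one h.rpos.le h.lt).mul_left _

lemma contr {ρ B : ℝ} (hρ0 : 0 ≤ ρ) (hρ : ρ < 1) (C : (ℕ → Bool) → Prop) (H : (ℕ → Bool) → ℝ)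
    (hB : ∀ u, |H u| ≤ B) (hC : ∀ u, C u → ∃ u', C u' ∧ |H u| ≤ ρ * |H u'|) (u : ℕ → Bool) (hu : C u) :
    H u = 0 := by
  have h1 : ∀ n u, C u → |H u| ≤ ρ ^ n * B := by
    intro n
    induction n with
    | zero => intro u _; simpa using hB u
    | succ n ih =>
      intro u hu
      obtain ⟨u', h1, h2⟩ := hC u hu
      calc _ ≤ _ := h2
        _ ≤ ρ * (ρ ^ n * B) := mul_le_mul_of_nonneg_left (ih u' h1) hρ0
        _ = _ := by ring
  have h2 : Tendsto (fun n => ρ ^ n * B) atTop (nhds (0 * B)) :=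
    (tendsto_pow_atTop_nhds_zero_of_lt_one hρ0 hρ).mul_const B
  have h3 := ge_of_tendsto' h2 (fun n => h1 n u hu)
  rw [zero_mul] at h3
  exact abs_eq_zero.mp (le_antisymm h3 (abs_nonneg _))

lemma Zok.GG_abs {z : Bool → ℝ} {ρ : ℝ} (h : Zok z ρ) (c : Bool) (u : ℕ → Bool) :
    |GG c u z| ≤ (1 - ρ)⁻¹ := by
  rw [abs_of_nonneg (h.GG_nonneg c u)]; exact h.GG_le c u

lemma Zok.ident {z : Bool → ℝ} {ρ : ℝ} (h : Zok z ρ) (u : ℕ → Bool) :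
    (1 - z false) * GG false u z + (1 - z true) * GG true u z = 1 := by
  have := contr h.rpos.le h.lt (fun _ => True)
    (fun u => (1 - z false) * GG false u z + (1 - z true) * GG true u z - 1)
    (B := (1 - z false) * (1 - ρ)⁻¹ + (1 - z true) * (1 - ρ)⁻¹ + 1) (fun u => ?_) (fun u _ => ?_) u trivial
  · linarith
  · have h1 := h.GG_nonneg false u
    have h2 := h.GG_nonneg true u
    have h3 := h.GG_le false u
    have h4 := h.GG_le true u
    have h5 : 0 < 1 - z false := by linarith [h.le false, h.lt]
    have h6 : 0 < 1 - z true := by linarith [h.le true, h.lt]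
    have := mul_le_mul_of_nonneg_left h3 h5.le
    have := mul_le_mul_of_nonneg_left h4 h6.le
    have := mul_nonneg h5.le h1
    have := mul_nonneg h6.le h2
    rw [abs_le]; constructor <;> linarith
  · refine ⟨shf u, trivial, ?_⟩
    have e : (1 - z false) * GG false u z + (1 - z true) * GG true u z - 1
        = z (u 0) * ((1 - z false) * GG false (shf u) z + (1 - z true) * GG true (shf u) z - 1) := by
      rw [h.GG_shf false u, h.GG_shf true u]
      cases u 0 <;> simp <;> ring
    rw [e, abs_mul, abs_of_pos (h.pos _)]
    exact mul_le_mul_of_nonneg_right (h.le _) (abs_nonneg _)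

def zst (a : Bool) (z : Bool → ℝ) : Bool → ℝ := fun c => if c = a then z a else z a * z (!a)

lemma Zok.zst {z : Bool → ℝ} {ρ : ℝ} (h : Zok z ρ) (a : Bool) : Zok (zst a z) ρ := by
  refine ⟨fun c => ?_, fun c => ?_, h.lt⟩ <;> unfold _root_.zst <;> split_ifs
  · exact h.pos _
  · exact mul_pos (h.pos _) (h.pos _)
  · exact h.le _
  · calc _ ≤ z a * 1 := mul_le_mul_of_nonneg_left ((h.le _).trans h.lt.le) (h.pos _).le
      _ ≤ _ := by simpa using h.le a

lemma bpos_shf (a : Bool) (v : ℕ → Bool) (n : ℕ) :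
    bpos a v (n + 1) = if v 0 = a then 1 + bpos a (shf v) n else 2 + bpos a (shf (shf v)) n := by
  induction n with
  | zero => by_cases h : v 0 = a <;> simp [bpos, h]
  | succ n ih =>
    rw [bpos_succ, der, ih]
    split_ifs with h1 h2 h2
    · rw [bpos_succ, der, show shf v (bpos a (shf v) n) = v (1 + bpos a (shf v) n) by
        rw [shf, add_comm], if_pos h2]; ring
    · rw [bpos_succ, der, show shf v (bpos a (shf v) n) = v (1 + bpos a (shf v) n) by
        rw [shf, add_comm], if_neg h2]; ring
    · rw [bpos_succ, der, show shf (shf v) (bpos a (shf (shf v)) n) = v (2 + bpos a (shf (shf v)) n) by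
        simp only [shf]; congr 1; ring, if_pos h2]; ring
    · rw [bpos_succ, der, show shf (shf v) (bpos a (shf (shf v)) n) = v (2 + bpos a (shf (shf v)) n) by
        simp only [shf]; congr 1; ring, if_neg h2]; ring

lemma shf_der (a : Bool) (v : ℕ → Bool) :
    shf (der a v) = if v 0 = a then der a (shf v) else der a (shf (shf v)) := by
  ext n
  rw [shf, der, bpos_shf]
  split_ifs
  · rw [der, shf, add_comm]
  · rw [der]; simp only [shf]; congr 1; ring_nf

lemma der_zero (a : Bool) (v : ℕ → Bool) : der a v 0 = v 0 := rfl

lemma NA.shf {a : Bool} {u : ℕ → Bool} (h : NA a u) : NA a (shf u) := fun i hi => h (i+1) hi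

lemma ne_iff_not {x a : Bool} : ¬ x = a ↔ x = !a := by cases x <;> cases a <;> simp

lemma Zok.der_b {z : Bool → ℝ} {ρ : ℝ} (h : Zok z ρ) {a : Bool} (v : ℕ → Bool) (hv : NA a v) :
    GG (!a) v z = GG (!a) (der a v) (_root_.zst a z) := by
  have hz := h.zst a
  have := contr h.rpos.le h.lt (fun v => NA a v)
    (fun v => GG (!a) v z - GG (!a) (der a v) (_root_.zst a z))
    (B := (1 - ρ)⁻¹ + (1 - ρ)⁻¹) (fun u => ?_) (fun u hu => ?_) v hv
  · linarith
  · have h1 := h.GG_abs (!a) u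
    have h2 := hz.GG_abs (!a) (der a u)
    exact (abs_sub _ _).trans (add_le_add h1 h2)
  · by_cases h0 : u 0 = a
    · refine ⟨shf u, hu.shf, ?_⟩
      have e : GG (!a) u z - GG (!a) (der a u) (_root_.zst a z) =
          z a * (GG (!a) (shf u) z - GG (!a) (der a (shf u)) (_root_.zst a z)) := by
        rw [h.GG_shf _ u, hz.GG_shf _ (der a u), shf_der, der_zero, if_pos h0, h0]
        simp [_root_.zst]; ring
      rw [e, abs_mul, abs_of_pos (h.pos _)]
      exact mul_le_mul_of_nonneg_right (h.le _) (abs_nonneg _)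
    · refine ⟨shf (shf u), hu.shf.shf, ?_⟩
      have h0' := ne_iff_not.mp h0
      have h1 : shf u 0 = a := hu 0 h0'
      have e : GG (!a) u z - GG (!a) (der a u) (_root_.zst a z) =
          (z a * z (!a)) * (GG (!a) (shf (shf u)) z - GG (!a) (der a (shf (shf u))) (_root_.zst a z)) := by
        rw [h.GG_shf _ u, h.GG_shf _ (shf u), hz.GG_shf _ (der a u), shf_der, der_zero, if_neg h0, h0', h1]
        simp [_root_.zst]; ring
      rw [e, abs_mul, abs_of_pos (mul_pos (h.pos _) (h.pos _))]
      have := hz.le (!a)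
      simp [_root_.zst] at this
      exact mul_le_mul_of_nonneg_right this (abs_nonneg _)

lemma Zok.der_a {z : Bool → ℝ} {ρ : ℝ} (h : Zok z ρ) {a : Bool} (v : ℕ → Bool) (hv : NA a v) :
    GG a v z = GG a (der a v) (_root_.zst a z) + z (!a) * GG (!a) (der a v) (_root_.zst a z) := by
  have hb := h.der_b v hv
  have h1 := h.ident v
  have h2 := (h.zst a).ident (der a v)
  have h3 : 0 < 1 - z a := by linarith [h.le a, h.lt]
  have e1 : (1 - z a) * GG a v z + (1 - z (!a)) * GG (!a) v z = 1 := by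
    cases a <;> simp at * <;> linarith
  have e2 : (1 - z a) * GG a (der a v) (_root_.zst a z) + (1 - z a * z (!a)) * GG (!a) (der a v) (_root_.zst a z) = 1 := by
    cases a <;> simp [_root_.zst] at * <;> linarith
  apply mul_left_cancel₀ h3.ne'
  rw [hb] at e1
  linear_combination e1 - e2

/-- step relations -/
lemma Zok.stepR {z : Bool → ℝ} {ρ : ℝ} (h : Zok z ρ) {a : Bool} {u : ℕ → Bool} (hu : NA a u)
    (h0 : u 0 = !a) :
    GG (!a) u z = GG (!a) (stepW a u) (_root_.zst a z) ∧
    GG a u z = GG a (stepW a u) (_root_.zst a z) + z (!a) * GG (!a) (stepW a u) (_root_.zst a z) := by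
  have : preS a u = u := by unfold preS; rw [if_neg (by rw [h0]; cases a <;> simp)]
  rw [stepW, this]
  exact ⟨h.der_b u hu, h.der_a u hu⟩

lemma Zok.stepL {z : Bool → ℝ} {ρ : ℝ} (h : Zok z ρ) {a : Bool} {u : ℕ → Bool} (hu : NA a u)
    (h0 : u 0 = a) :
    GG (!a) u z = z a * GG (!a) (stepW a u) (_root_.zst a z) ∧
    GG a u z = GG a (stepW a u) (_root_.zst a z) + GG (!a) (stepW a u) (_root_.zst a z) := by
  have : preS a u = shf u := by unfold preS; rw [if_pos h0]; rfl
  rw [stepW, this]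
  have h1 := h.der_b _ hu.shf
  have h2 := h.der_a _ hu.shf
  constructor
  · rw [h.GG_shf, h0, h1]; simp
  · rw [h.GG_shf, h0, h2]
    have h2 := (h.zst a).ident (der a (shf u))
    have e2 : (1 - z a) * GG a (der a (shf u)) (_root_.zst a z) + (1 - z a * z (!a)) * GG (!a) (der a (shf u)) (_root_.zst a z) = 1 := by
      cases a <;> simp [_root_.zst] at * <;> linarith
    simp only [if_true]
    linear_combination -e2

def zk (x : ℝ) (a : ℕ → Bool) (k : ℕ) : Bool → ℝ := fun c => x ^ (qs a k c)

lemma zk_zero (x : ℝ) (a : ℕ → Bool) : zk x a 0 = fun _ => x := by ext c; simp [zk, qs]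

lemma zk_succ (x : ℝ) (a : ℕ → Bool) (k : ℕ) : zk x a (k+1) = zst (a k) (zk x a k) := by
  ext c
  simp only [zk, qs, zst]
  by_cases h : c = a k
  · simp [h]
  · rw [if_neg h, if_neg h, ne_iff_not.mp h, Bool.not_not, pow_add, mul_comm]

lemma zk_ok {x : ℝ} (h0 : 0 < x) (h1 : x < 1) (a : ℕ → Bool) (k : ℕ) : Zok (zk x a k) x := by
  refine ⟨fun c => pow_pos h0 _, fun c => ?_, h1⟩
  calc x ^ qs a k c ≤ x ^ 1 := pow_le_pow_of_le_one h0.le h1.le (qs_pos a k c)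
    _ = x := pow_one x

def CF (x : ℝ) (U : ℕ → ℕ → Bool) (a : ℕ → Bool) (k : ℕ) (p : Bool → ℕ) (e : ℕ) : Prop :=
  e + 2 ≤ qs a k true + qs a k false ∧ (∀ c, p c * zk x a k c * (1 - x) ≤ 1 - zk x a k c) ∧
  p true * zk x a k true * (1 - zk x a k false) - p false * zk x a k false * (1 - zk x a k true)
    = (1 - x) * x ^ e ∧
  GG true (U 0) (fun _ => x) = p false * zk x a k false * GG false (U k) (zk x a k) +
    p true * zk x a k true * GG true (U k) (zk x a k)

lemma chain_form {U : ℕ → ℕ → Bool} {a : ℕ → Bool}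
    (hU : ∀ k, NA (a k) (U k) ∧ U (k+1) = stepW (a k) (U k)) {b : ℕ} (hb : 2 ≤ b) (k : ℕ) :
    ∃ p e, CF ((b:ℝ)⁻¹) U a k p e := by
  have hb' : (2:ℝ) ≤ b := by exact_mod_cast hb
  set x := (b:ℝ)⁻¹ with hx
  have hx0 : 0 < x := by positivity
  have hbx : (b:ℝ) * x = 1 := by rw [hx]; field_simp
  have hx1 : x < 1 := by nlinarith
  induction k with
  | zero =>
    refine ⟨fun c => if c then b else 0, 0, by simp [qs], ?_, ?_, ?_⟩
    · intro c
      rw [zk_zero]; cases c <;> simp [hbx] <;> linarith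
    · rw [zk_zero]; simp [hbx]
    · rw [zk_zero]; simp [hbx]
  | succ k ih =>
    obtain ⟨p, e, he, hp, hdet, hval⟩ := ih
    have hz := zk_ok hx0 hx1 a k
    have hbq : ∀ c, (b:ℝ) ^ qs a k c * zk x a k c = 1 := by
      intro c; rw [zk, ← mul_pow, hbx, one_pow]
    have hqs : ∀ c, qs a (k+1) c = if c = a k then qs a k c else qs a k c + qs a k (!c) := fun c => rfl
    have hzz := zk_succ x a k
    obtain ⟨hNA, hstep⟩ := hU k
    unfold CF
    rw [hzz, hstep, hval]
    set z := zk x a k with hzd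
    have hzp := hz.pos
    have hzl : ∀ c, z c < 1 := fun c => (hz.le c).trans_lt hx1
    by_cases h0 : U k 0 = a k
    · obtain ⟨g1, g2⟩ := hz.stepL hNA h0
      refine ⟨fun c => if c = a k then p c else b ^ qs a k c * p (a k) + p c, e + qs a k (a k), ?_, ?_, ?_, ?_⟩
      · rw [hqs, hqs]; cases a k <;> simp <;> omega
      · intro c
        have q1 := hp (a k)
        have q2 := hp (!(a k))
        have b1 := hbq (!(a k))
        have l1 := hzl (a k)
        have l2 := hzp (a k)
        by_cases hc : c = a k
        · simpa [zst, hc] using q1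
        · have hc' := ne_iff_not.mp hc
          rw [hc']
          have e1 : zst (a k) z (!(a k)) = z (a k) * z (!(a k)) := by simp [zst]
          rw [e1]
          simp only [if_neg (show ¬ ((!(a k)) = a k) by cases a k <;> simp)]
          push_cast
          have := mul_le_mul_of_nonneg_left q2 l2.le
          have e2 : ((b:ℝ) ^ qs a k (!(a k)) * (p (a k)) + p (!(a k))) * (z (a k) * z (!(a k))) * (1 - x)
            = p (a k) * z (a k) * (1 - x) + z (a k) * (p (!(a k)) * z (!(a k)) * (1 - x)) := by
            linear_combination (p (a k) * z (a k) * (1 - x)) * b1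
          rw [e2]; linarith
      · have b1 := hbq (!(a k))
        have e3 : x ^ (e + qs a k (a k)) = x ^ e * z (a k) := by rw [pow_add]; rfl
        rw [e3]
        cases hak : a k
        · rw [hak] at b1
          simp only [zst] at b1 ⊢; simp at b1 ⊢
          linear_combination z false * hdet + (p false * z false * (1 - z false)) * b1
        · rw [hak] at b1
          simp only [zst] at b1 ⊢; simp at b1 ⊢
          linear_combination z true * hdet - (p true * z true * (1 - z true)) * b1
      · have b1 := hbq (!(a k))
        generalize a k = A at *
        cases A
        · simp only [zst] at b1 g1 g2 ⊢; simp at b1 g1 g2 ⊢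
          rw [g1, g2]; 
          generalize GG true (stepW false (U k)) _ = g
          linear_combination (-p false * z false * g) * b1
        · simp only [zst] at b1 g1 g2 ⊢; simp at b1 g1 g2 ⊢
          rw [g1, g2]; 
          generalize GG false (stepW true (U k)) _ = g
          linear_combination (-p true * z true * g) * b1
    · have h0' := ne_iff_not.mp h0
      obtain ⟨g1, g2⟩ := hz.stepR hNA h0'
      refine ⟨fun c => if c = a k then p c else b ^ qs a k (a k) * p c + p (a k), e, ?_, ?_, ?_, ?_⟩
      · rw [hqs, hqs]; cases a k <;> simp <;> omega
      · intro c
        have q1 := hp (a k)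
        have q2 := hp (!(a k))
        have b1 := hbq ((a k))
        have l1 := hzl (!(a k))
        have l2 := hzp (!(a k))
        by_cases hc : c = a k
        · simpa [zst, hc] using q1
        · have hc' := ne_iff_not.mp hc
          rw [hc']
          have e1 : zst (a k) z (!(a k)) = z (a k) * z (!(a k)) := by simp [zst]
          rw [e1]
          simp only [if_neg (show ¬ ((!(a k)) = a k) by cases a k <;> simp)]
          push_cast
          have := mul_le_mul_of_nonneg_left q1 l2.le
          have e2 : ((b:ℝ) ^ qs a k ((a k)) * (p (!(a k))) + p ((a k))) * (z (a k) * z (!(a k))) * (1 - x)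
            = p (!(a k)) * z (!(a k)) * (1 - x) + z (!(a k)) * (p ((a k)) * z ((a k)) * (1 - x)) := by
            linear_combination (p (!(a k)) * z (!(a k)) * (1 - x)) * b1
          rw [e2]; linarith
      · have b1 := hbq ((a k))
        cases hak : a k
        · rw [hak] at b1
          simp only [zst] at b1 ⊢; simp at b1 ⊢
          linear_combination hdet + (p true * z true * (1 - z false)) * b1
        · rw [hak] at b1
          simp only [zst] at b1 ⊢; simp at b1 ⊢
          linear_combination hdet - (p false * z false * (1 - z true)) * b1
      · have b1 := hbq ((a k))
        generalize a k = A at *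
        cases A
        · simp only [zst] at b1 g1 g2 ⊢; simp at b1 g1 g2 ⊢
          rw [g1, g2]; 
          generalize GG true (stepW false (U k)) _ = g
          linear_combination (-p true * z true * g) * b1
        · simp only [zst] at b1 g1 g2 ⊢; simp at b1 g1 g2 ⊢
          rw [g1, g2]; 
          generalize GG false (stepW true (U k)) _ = g
          linear_combination (-p false * z false * g) * b1

lemma CF.eq0 {x : ℝ} (hx0 : 0 < x) (hx1 : x < 1) {U : ℕ → ℕ → Bool} {a : ℕ → Bool} {k : ℕ} {p : Bool → ℕ} {e : ℕ}
    (h : CF x U a k p e) : GG true (U 0) (fun _ => x) * (1 - zk x a k false) =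
      p false * zk x a k false + (1 - x) * x ^ e * GG true (U k) (zk x a k) := by
  have hi := (zk_ok hx0 hx1 a k).ident (U k)
  obtain ⟨h1, h2, h3, h4⟩ := h
  rw [h4]
  linear_combination (p false * zk x a k false) * hi + GG true (U k) (zk x a k) * h3

lemma CF.eq1 {x : ℝ} (hx0 : 0 < x) (hx1 : x < 1) {U : ℕ → ℕ → Bool} {a : ℕ → Bool} {k : ℕ} {p : Bool → ℕ} {e : ℕ}
    (h : CF x U a k p e) : GG true (U 0) (fun _ => x) * (1 - zk x a k true) =
      p true * zk x a k true - (1 - x) * x ^ e * GG false (U k) (zk x a k) := by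
  have hi := (zk_ok hx0 hx1 a k).ident (U k)
  obtain ⟨h1, h2, h3, h4⟩ := h
  rw [h4]
  linear_combination (p true * zk x a k true) * hi - GG false (U k) (zk x a k) * h3

end

end

section
open Filter

noncomputable section

lemma NP.letter {u : ℕ → Bool} (h : NP u) (c : Bool) (N : ℕ) : ∃ i ≥ N, u i = c := by
  by_contra hcon
  push Not at hcon
  have h1 : ∀ i ≥ N, u i = !c := fun i hi => ne_iff_not.mp (hcon i hi)
  obtain ⟨n, hn⟩ := h N (N+1) (by omega)
  exact hn (by rw [h1 _ (by omega), h1 _ (by omega)])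

lemma Zok.GG_pos {z : Bool → ℝ} {ρ : ℝ} (h : Zok z ρ) {c : Bool} {u : ℕ → Bool} {i : ℕ} (hi : u i = c) :
    0 < GG c u z := by
  refine (h.summable c u).tsum_pos (fun n => ?_) i ?_
  · split_ifs; exacts [(h.pw_pos u n).le, le_rfl]
  · rw [if_pos hi]; exact h.pw_pos u i

lemma Zok.GG_pre {z : Bool → ℝ} {ρ : ℝ} (h : Zok z ρ) {c : Bool} (n : ℕ) : ∀ {u : ℕ → Bool}, 
    (∀ t < n, u t = !c) → GG c u z = z (!c) ^ n * GG c (fun t => u (t + n)) z := by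
  induction n with
  | zero => intro u _; simp
  | succ n ih =>
    intro u hu
    rw [h.GG_shf, hu 0 (by omega), ih (u := shf u) (fun t ht => hu (t+1) (by omega))]
    have : (fun t => shf u (t + n)) = fun t => u (t + (n + 1)) := by
      ext t; rfl
    rw [this, if_neg (by cases c <;> simp)]
    ring

lemma liou_crit {b : ℕ} (hb : 2 ≤ b) {Ξ : ℝ} {n q m t : ℕ} (hq : 1 ≤ q) (hm : 1 ≤ m) (N : ℤ)
    (ht : n * (m + 1) + 3 ≤ t)
    (h0 : Ξ ≠ N / ((b:ℝ) ^ (m * q) * (b ^ q - 1)))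
    (h1 : |Ξ - N / ((b:ℝ) ^ (m * q) * (b ^ q - 1))| ≤ 4 * ((b:ℝ)⁻¹) ^ (q * t)) :
    ∃ c d : ℤ, 1 < d ∧ Ξ ≠ c / d ∧ |Ξ - c / d| < 1 / d ^ n := by
  have hb' : (2:ℝ) ≤ b := by exact_mod_cast hb
  have hbq : (b:ℝ) ≤ b ^ q := by
    calc (b:ℝ) = b ^ 1 := (pow_one _).symm
      _ ≤ _ := pow_le_pow_right₀ (by linarith) hq
  have hbm : (b:ℝ) ≤ b ^ (m*q) := by
    calc (b:ℝ) = b ^ 1 := (pow_one _).symm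
      _ ≤ _ := pow_le_pow_right₀ (by linarith) (by nlinarith)
  refine ⟨N, (b:ℤ) ^ (m * q) * (b ^ q - 1), ?_, ?_, ?_⟩
  · have : (1:ℝ) < (b:ℝ) ^ (m * q) * (b ^ q - 1) := by nlinarith
    exact_mod_cast this
  · push_cast; exact h0
  · push_cast
    refine h1.trans_lt ?_
    set x := (b:ℝ)⁻¹ with hx
    have hx0 : 0 < x := by positivity
    have hbx : (b:ℝ) * x = 1 := by rw [hx]; field_simp
    have hx1 : x ≤ 1/2 := by nlinarith
    have hd : (b:ℝ) ^ (m * q) * (b ^ q - 1) ≤ (b:ℝ) ^ ((m+1) * q) := by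
      rw [add_mul, one_mul, pow_add]
      have : (0:ℝ) ≤ (b:ℝ) ^ (m * q) := by positivity
      nlinarith
    have hdp : 0 < (b:ℝ) ^ (m * q) * (b ^ q - 1) := mul_pos (by positivity) (by linarith)
    have h2 : x ^ ((m+1) * q * n) ≤ 1 / ((b:ℝ) ^ (m * q) * (b ^ q - 1)) ^ n := by
      rw [le_div_iff₀ (pow_pos hdp _)]
      calc _ ≤ x ^ ((m+1) * q * n) * ((b:ℝ) ^ ((m+1) * q)) ^ n := by gcongr
        _ = 1 := by rw [← pow_mul, ← mul_pow, mul_comm x, hbx, one_pow]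
    refine lt_of_lt_of_le ?_ h2
    have h3 : (m+1) * q * n + 3 ≤ q * t := by nlinarith [Nat.mul_le_mul_left q ht]
    calc 4 * x ^ (q * t) ≤ 4 * x ^ ((m+1) * q * n + 3) := by
            gcongr 4 * ?_
            exact pow_le_pow_of_le_one hx0.le (by linarith) h3
      _ = x ^ ((m+1) * q * n) * (4 * (x^3)) := by rw [pow_add]; ring
      _ < x ^ ((m+1) * q * n) * 1 := by
            apply mul_lt_mul_of_pos_left _ (pow_pos hx0 _)
            have : x^3 ≤ (1/2)^3 := pow_le_pow_left₀ hx0.le hx1 3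
            linarith
      _ = _ := mul_one _

lemma CF.eqs {x : ℝ} (hx0 : 0 < x) (hx1 : x < 1) {U : ℕ → ℕ → Bool} {a : ℕ → Bool} {k : ℕ} {p : Bool → ℕ} {e : ℕ}
    (h : CF x U a k p e) (A : Bool) : ∃ s : ℤ, |(s:ℝ)| = 1 ∧ GG true (U 0) (fun _ => x) * (1 - zk x a k A) =
      p A * zk x a k A + s * ((1 - x) * x ^ e) * GG (!A) (U k) (zk x a k) := by
  cases A
  · exact ⟨1, by simp, by simpa using h.eq0 hx0 hx1⟩
  · refine ⟨-1, by simp, ?_⟩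
    have := h.eq1 hx0 hx1
    rw [this]; simp; ring

lemma liouville_case {U : ℕ → ℕ → Bool} {a : ℕ → Bool}
    (hU : ∀ k, NA (a k) (U k) ∧ U (k+1) = stepW (a k) (U k) ∧ NP (U k)) {b : ℕ} (hb : 2 ≤ b)
    (hrun : ∀ L, ∃ k c, ∀ j ≤ L, a (k + j) = c) :
    Liouville (GG true (U 0) (fun _ => (b:ℝ)⁻¹)) := by
  intro n
  obtain ⟨k, A', hk⟩ := hrun (n * (2 * n + 7) + 10)
  set L := n * (2 * n + 7) + 10 with hL
  have hU' : ∀ k, NA (a k) (U k) ∧ U (k+1) = stepW (a k) (U k) := fun k => ⟨(hU k).1, (hU k).2.1⟩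
  obtain ⟨k0, A, hqA, hA⟩ : ∃ k0 A, qs a k0 (!A) ≤ qs a k0 A ∧ ∀ j < L, a (k0 + j) = A := by
    obtain ⟨k0, hk0, c, h1, h2, h3⟩ := qs_start a (k+1)
    by_cases he : k0 = k + 1
    · refine ⟨k0, A', ?_, ?_⟩
      · have := h3 he
        revert this; cases c <;> cases A' <;> simp <;> omega
      · intro j hj
        have := hk (j+1) (by omega)
        rw [he, ← this]; congr 1; ring
    · have hc : c = A' := by rw [← h2 k (by omega) (by omega)]; exact hk 0 (by omega)
      refine ⟨k0, A', hc ▸ h1, fun j hj => ?_⟩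
      by_cases hj' : k0 + j < k + 1
      · rw [h2 _ (by omega) hj', hc]
      · have := hk (k0 + j - k) (by omega)
        rw [← this]; congr 1; omega
  have hRun := chain_run hU' A L k0 hA
  have hNP := (hU k0).2.2
  have hb' : (2:ℝ) ≤ b := by exact_mod_cast hb
  obtain ⟨p, e, hCF⟩ := chain_form hU' hb k0
  set x := (b:ℝ)⁻¹ with hx
  have hx0 : 0 < x := by positivity
  have hbx : (b:ℝ) * x = 1 := by rw [hx]; field_simp
  have hx2 : x ≤ 1/2 := by nlinarith
  have hx1 : x < 1 := by linarith
  obtain ⟨s, hs, heq⟩ := hCF.eqs hx0 hx1 A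
  have he := hCF.1
  have hz := zk_ok hx0 hx1 a k0
  set u := U k0 with hu
  set q := qs a k0 A with hq
  have hq1 : 1 ≤ q := qs_pos _ _ _
  set z := zk x a k0 A with hzd
  have hzx : z = x ^ q := rfl
  set Ξ := GG true (U 0) (fun _ => x) with hΞ
  have he' : e + 1 ≤ 2 * q := by
    have : qs a k0 true + qs a k0 false = qs a k0 A + qs a k0 (!A) := by cases A <;> simp; ring
    omega
  -- first occurrence
  classical
  have hex : ∃ i, u i = !A := by obtain ⟨i, _, hi⟩ := hNP.letter (!A) 0; exact ⟨i, hi⟩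
  have hc := Nat.find_spec hex
  have hcm := fun m hm => Nat.find_min hex (m := m) hm
  set c := Nat.find hex with hcd
  have hG1 := hz.GG_pre (c := !A) c (u := u) (fun t ht => by
    have := hcm t ht; simpa using ne_iff_not.mp this)
  rw [Bool.not_not] at hG1
  set v : ℕ → Bool := fun t => u (t + c) with hv
  have hG2 := hz.GG_shf (!A) v
  have hv0 : v 0 = !A := by simp [hv, hc]
  rw [if_pos hv0] at hG2
  have hG3 := hz.GG_pre (c := !A) L (u := shf v) (fun t ht => by
    have := hRun c hc (t+1) (by omega) (by omega)
    rw [Bool.not_not, ← this]; simp only [shf, hv]; congr 1; ring)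
  rw [Bool.not_not] at hG3
  set y : ℕ → Bool := fun t => shf v (t + L) with hy
  have hypos : 0 < GG (!A) y (zk x a k0) := by
    obtain ⟨i, hi1, hi2⟩ := hNP.letter (!A) (c + 1 + L)
    apply hz.GG_pos (i := i - (c + 1 + L))
    rw [← hi2]; simp only [hy, shf, hv]; congr 1; omega
  have hyle : GG (!A) y (zk x a k0) ≤ 2 := by
    refine (hz.GG_le _ _).trans ?_
    rw [inv_le_comm₀ (by linarith) (by norm_num)]; linarith
  have hzb1 := hz.pos (!A)
  have hzb2 : zk x a k0 (!A) ≤ 1 := (hz.le _).trans hx1.le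
  have hz1 : z ≤ 1/2 := (hz.le A).trans hx2
  have hz0 : 0 < z := hz.pos A
  set θ := zk x a k0 (!A) * (z ^ L * GG (!A) y (zk x a k0)) with hθ
  have hG : GG (!A) u (zk x a k0) = z ^ c * (1 + θ) := by rw [hG1, hG2, hv0, hG3]
  have hθ0 : 0 < θ := by positivity
  have hθ1 : θ ≤ 2 * z ^ L := by
    calc θ ≤ 1 * (z ^ L * 2) := by rw [hθ]; gcongr
      _ = _ := by ring
  have hzL : z ^ L ≤ 1/2 := by
    calc z ^ L ≤ z ^ 1 := pow_le_pow_of_le_one hz0.le (by linarith) (by omega)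
      _ ≤ _ := by simpa using hz1
  set D := (1 - x) * x ^ e with hD
  have hD0 : 0 < D := mul_pos (by linarith) (pow_pos hx0 _)
  have hD1 : D ≤ 1 := by
    calc D ≤ 1 * 1 := mul_le_mul (by linarith) (pow_le_one₀ hx0.le hx1.le) (by positivity) (by norm_num)
      _ = 1 := one_mul 1
  have hbz : (b:ℝ) ^ q * z = 1 := by rw [hzx, ← mul_pow, hbx, one_pow]
  have hbq : (1:ℝ) < b ^ q := one_lt_pow₀ (by linarith) (by omega)
  rw [hG] at heq
  have h1z : 0 < 1 - z := by linarith
  have fin : ∀ (m : ℕ) (N : ℤ) (δ : ℝ) (t : ℕ), 1 ≤ m → n * (m + 1) + 3 ≤ t → 0 < δ → δ ≤ 2 * z ^ t →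
      (N : ℝ) = ((b:ℝ) ^ (m * q) * (b ^ q - 1)) * Ξ - (b:ℝ) ^ ((m+1) * q) * (s * D * δ) →
      ∃ c d : ℤ, 1 < d ∧ Ξ ≠ c / d ∧ |Ξ - c / d| < 1 / d ^ n := by
    intro m N δ t hm ht hδ0 hδ1 hN
    have hden : 0 < ((b:ℝ) ^ (m * q) * (b ^ q - 1)) := mul_pos (by positivity) (by linarith)
    have hdz : (b:ℝ) ^ (m * q) * (b ^ q - 1) = (b:ℝ) ^ ((m+1) * q) * (1 - z) := by
      rw [add_mul, one_mul, pow_add]; linear_combination (b:ℝ) ^ (m * q) * hbz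
    have hdiff : Ξ - N / ((b:ℝ) ^ (m * q) * (b ^ q - 1)) = s * D * δ / (1 - z) := by
      rw [hN, hdz]; field_simp; ring
    have hs0 : (s:ℝ) ≠ 0 := by intro h; rw [h] at hs; simp at hs
    refine liou_crit hb hq1 hm N ht ?_ ?_
    · rw [← sub_ne_zero, hdiff]
      have := h1z.ne'; have := hD0.ne'; have := hδ0.ne'
      positivity
    · rw [hdiff, abs_div, abs_mul, abs_mul, hs, abs_of_pos hD0, abs_of_pos hδ0, abs_of_pos h1z,
        div_le_iff₀ h1z, pow_mul, ← hx, ← hzx]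
      have : 0 < z ^ t := by positivity
      nlinarith
  by_cases hcn : 2 * n + 3 ≤ c
  · refine fin 1 (b ^ q * p A) (z ^ c * (1 + θ)) c le_rfl (by omega) (by positivity) ?_ ?_
    · rw [mul_comm]; gcongr; linarith
    · push_cast
      have : (b:ℝ) ^ (1 * q) * (b ^ q - 1) = (b:ℝ)^q * (b^q * (1 - z)) := by
        rw [one_mul]; linear_combination (b:ℝ)^q * hbz
      rw [this, show (1 + 1) * q = q + q by ring, pow_add]
      linear_combination - (b:ℝ)^q * (b:ℝ)^q * heq - (b:ℝ)^q * p A * hbz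
  · refine fin (c + 3) (b ^ ((c+3) * q) * p A + s * ((b - 1) * b ^ (4 * q - e - 1))) (z ^ c * θ) (c + L)
      (by omega) (by rw [hL]; nlinarith) (by positivity) ?_ ?_
    · rw [pow_add]
      calc _ ≤ z ^ c * (2 * z ^ L) := by gcongr
        _ = _ := by ring
    · push_cast
      have e1 : (b:ℝ) ^ ((c+3) * q) * (b ^ q - 1) = (b:ℝ)^((c+3+1)*q) * (1 - z) := by
        rw [add_mul (c+3), one_mul, pow_add]; linear_combination (b:ℝ)^((c+3)*q) * hbz
      have e2 : (b:ℝ)^((c+3+1)*q) = (b:ℝ)^((c+3)*q) * b ^ q := by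
        rw [add_mul (c+3), one_mul, pow_add]
      have e3 : ((b:ℝ) - 1) * b ^ (4 * q - e - 1) = (b:ℝ)^((c+3+1)*q) * (D * z ^ c) := by
        have : (b:ℝ)^((c+3+1)*q) = b ^ (4 * q - e - 1) * (b * b ^ e * (b^q) ^ c) := by
          rw [← pow_succ', ← pow_mul, ← pow_add, ← pow_add]; congr 1
          have : e + 1 ≤ 4 * q := by omega
          zify [show e ≤ 4 * q by omega, show 1 ≤ 4 * q - e by omega]
          ring
        rw [this, hD]
        have g1 : (b:ℝ)^e * x ^ e = 1 := by rw [← mul_pow, hbx, one_pow]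
        have g2 : ((b:ℝ)^q)^c * z ^ c = 1 := by rw [← mul_pow, hbz, one_pow]
        calc _ = (b:ℝ) ^ (4 * q - e - 1) * (b - b * x) := by rw [hbx]; ring
          _ = (b:ℝ) ^ (4 * q - e - 1) * ((b - b * x) * ((b:ℝ)^e * x ^ e) * (((b:ℝ)^q)^c * z ^ c)) := by
            rw [g1, g2]; ring
          _ = _ := by ring
      rw [e3, e1]
      rw [e2]
      linear_combination - (b:ℝ)^((c+3)*q) * (b:ℝ)^q * heq - (b:ℝ)^((c+3)*q) * p A * hbz

end

end

section
open Filter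

noncomputable section

open Polynomial IntermediateField in
lemma liou_ineq {Ξ : ℝ} (hΞ : IsAlgebraic ℚ Ξ) : ∃ (d : ℕ) (R : ℝ) (a0 : ℕ), 1 ≤ R ∧ 1 ≤ a0 ∧
    ∀ (N : ℕ) (H : ℤ[X]) (B : ℝ), H.natDegree ≤ N → (∀ w : ℂ, ‖w‖ ≤ R → ‖aeval w H‖ ≤ B) →
      aeval Ξ H ≠ 0 → 1 ≤ ((a0:ℝ) ^ N) ^ (d + 1) * B ^ d * |aeval Ξ H| := by
  classical
  let K := ℚ⟮Ξ⟯
  have hfin : FiniteDimensional ℚ K := adjoin.finiteDimensional hΞ.isIntegral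
  let g : K := AdjoinSimple.gen ℚ Ξ
  have hg : algebraMap K ℝ g = Ξ := AdjoinSimple.algebraMap_gen ℚ Ξ
  let σ0 : K →ₐ[ℚ] ℂ := (Complex.ofRealAm.restrictScalars ℚ).comp (IsScalarTower.toAlgHom ℚ K ℝ)
  have hσ0 : ∀ w, σ0 w = ((algebraMap K ℝ w : ℝ) : ℂ) := fun w => rfl
  obtain ⟨a1, ha1, hint⟩ : ∃ y : ℤ, y ≠ 0 ∧ IsIntegral ℤ (y • g) := by
    have : IsAlgebraic ℤ g := (IsFractionRing.isAlgebraic_iff ℤ ℚ K).mpr (Algebra.IsAlgebraic.isAlgebraic g)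
    exact this.exists_integral_multiple
  obtain ⟨a0, ha0, hint⟩ : ∃ y : ℕ, 1 ≤ y ∧ IsIntegral ℤ ((y:K) * g) := by
    refine ⟨a1.natAbs, by omega, ?_⟩
    rcases Int.natAbs_eq a1 with h | h
    · rw [h] at hint; simpa [Algebra.smul_def] using hint
    · rw [h] at hint; have := hint.neg; simpa [Algebra.smul_def] using this
  set R := 1 + ∑ σ : K →ₐ[ℚ] ℂ, ‖σ g‖ with hR
  have hσR : ∀ σ : K →ₐ[ℚ] ℂ, ‖σ g‖ ≤ R := by
    intro σ
    have := Finset.single_le_sum (f := fun σ : K →ₐ[ℚ] ℂ => ‖σ g‖) (fun i _ => norm_nonneg _) (Finset.mem_univ σ)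
    linarith
  refine ⟨(Finset.univ.erase σ0).card, R, a0, ?_, ha0, ?_⟩
  · have : 0 ≤ ∑ σ : K →ₐ[ℚ] ℂ, ‖σ g‖ := Finset.sum_nonneg fun _ _ => norm_nonneg _
    linarith
  intro N H B hN hB hne
  set w : K := (a0:K) ^ N * aeval g H with hw
  have hwint : IsIntegral ℤ w := by
    rw [hw, aeval_eq_sum_range' (n := N + 1) (by omega), Finset.mul_sum]
    refine IsIntegral.sum _ fun i hi => ?_
    have hi' : i ≤ N := by simp at hi; omega
    have e : (a0:K) ^ N * (H.coeff i • g ^ i) = (H.coeff i : K) * (a0:K) ^ (N - i) * ((a0:K) * g) ^ i := by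
      rw [mul_pow, Algebra.smul_def]
      conv_lhs => rw [← Nat.sub_add_cancel hi', pow_add]
      simp; ring
    rw [e]
    refine IsIntegral.mul (IsIntegral.mul ?_ (IsIntegral.pow ?_ _)) (hint.pow _)
    · exact isIntegral_algebraMap (R := ℤ) (x := H.coeff i)
    · have := isIntegral_algebraMap (R := ℤ) (A := K) (x := (a0:ℤ))
      simpa using this
  have hev : ∀ σ : K →ₐ[ℚ] ℂ, σ w = (a0:ℂ) ^ N * aeval (σ g) H := by
    intro σ
    rw [hw, map_mul, map_pow, map_natCast]
    congr 1
    rw [aeval_def, aeval_def, ← AlgHom.coe_toRingHom, Polynomial.hom_eval₂]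
    congr 1
    exact RingHom.ext_int _ _
  have hev0 : aeval (σ0 g) H = ((aeval Ξ H : ℝ) : ℂ) := by
    rw [hσ0, hg]
    exact aeval_algebraMap_apply ℂ Ξ H
  have ha0' : (0:ℝ) < a0 := by exact_mod_cast ha0
  have hw0 : w ≠ 0 := by
    intro h
    have h1 := hev σ0
    rw [h, map_zero, hev0] at h1
    have h2 : ((a0:ℂ) ^ N) ≠ 0 := by
      apply pow_ne_zero; exact_mod_cast (by omega : a0 ≠ 0)
    have := (mul_eq_zero.mp h1.symm).resolve_left h2
    exact hne (by exact_mod_cast this)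
  have hnint : IsIntegral ℤ (Algebra.norm ℚ w) := Algebra.isIntegral_norm ℚ hwint
  obtain ⟨m, hm⟩ := IsIntegrallyClosed.isIntegral_iff.mp hnint
  have hnorm := Algebra.norm_eq_prod_embeddings ℚ ℂ w
  have hm0 : m ≠ 0 := by
    intro h
    rw [h, map_zero] at hm
    exact hw0 (Algebra.norm_eq_zero_iff.mp hm.symm)
  have h1 : (1:ℝ) ≤ ∏ σ : K →ₐ[ℚ] ℂ, ‖σ w‖ := by
    rw [← norm_prod, ← hnorm, ← hm]
    have : (1:ℝ) ≤ |(m:ℝ)| := by exact_mod_cast Int.one_le_abs hm0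
    simpa using this
  rw [← Finset.mul_prod_erase _ _ (Finset.mem_univ σ0)] at h1
  have h2 : ∏ σ ∈ Finset.univ.erase σ0, ‖σ w‖ ≤ ((a0:ℝ)^N * B) ^ (Finset.univ.erase σ0).card := by
    rw [← Finset.prod_const]
    refine Finset.prod_le_prod (fun _ _ => norm_nonneg _) fun σ _ => ?_
    rw [hev σ, norm_mul, norm_pow]
    have := hB _ (hσR σ)
    simp only [Complex.norm_natCast]
    gcongr
  have h3 : ‖σ0 w‖ = (a0:ℝ)^N * |aeval Ξ H| := by
    rw [hev σ0, hev0, norm_mul, norm_pow, Complex.norm_natCast, Complex.norm_real, Real.norm_eq_abs]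
  calc (1:ℝ) ≤ _ := h1
    _ ≤ (a0:ℝ)^N * |aeval Ξ H| * ((a0:ℝ)^N * B) ^ (Finset.univ.erase σ0).card := by
      rw [h3]; gcongr
    _ = _ := by rw [mul_pow]; ring

end

end

section
open Filter

noncomputable section

def fT (V : ℕ → Bool) (T : ℕ) : MvPolynomial Bool ℤ :=
  ∑ n ∈ Finset.range T, if V n then ∏ i ∈ Finset.range n, MvPolynomial.X (V i) else 0

def QT (p : ℕ → MvPolynomial Bool ℤ) (N : ℕ) (V : ℕ → Bool) (T : ℕ) : MvPolynomial Bool ℤ :=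
  ∑ l ∈ Finset.range (N + 1), p l * fT V T ^ l

def ee (i j : ℕ) : Bool →₀ ℕ := Finsupp.single false i + Finsupp.single true j

lemma ee_false (i j : ℕ) : ee i j false = i := by simp [ee]
lemma ee_true (i j : ℕ) : ee i j true = j := by simp [ee]
lemma ee_eta (d : Bool →₀ ℕ) : ee (d false) (d true) = d := by
  ext c; cases c
  · exact ee_false _ _
  · exact ee_true _ _

lemma aux_poly (V : ℕ → Bool) (N M : ℕ) (hM : 1 ≤ M) (h : M * M < (N + 1) * ((N + 1) * (N + 1))) :
    ∃ p : ℕ → MvPolynomial Bool ℤ, (∃ l ≤ N, p l ≠ 0) ∧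
      (∀ l, ∀ d ∈ (p l).support, ∀ c, d c ≤ N) ∧
      ∀ d : Bool →₀ ℕ, d false + d true < M → (QT p N V M).coeff d = 0 := by
  classical
  let A : Matrix (Fin M × Fin M) (Fin (N+1) × Fin (N+1) × Fin (N+1)) ℤ :=
    fun ij lij => MvPolynomial.coeff (ee ij.1 ij.2)
      (MvPolynomial.monomial (ee lij.2.1 lij.2.2) 1 * fT V M ^ (lij.1 : ℕ))
  obtain ⟨t, ht0, ht, -⟩ := Int.Matrix.exists_ne_zero_int_vec_norm_le A (by simpa using h)
    (by simp; omega)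
  set P : ℕ → MvPolynomial Bool ℤ := fun l => if hl : l < N + 1 then
      ∑ ij : Fin (N+1) × Fin (N+1), MvPolynomial.monomial (ee ij.1 ij.2) (t (⟨l, hl⟩, ij)) else 0 with hP
  have hcoef : ∀ (l : Fin (N+1)) (ij : Fin (N+1) × Fin (N+1)),
      MvPolynomial.coeff (ee ij.1 ij.2) (P l) = t (l, ij) := by
    intro l ij
    simp only [hP, l.2, dif_pos, MvPolynomial.coeff_sum, MvPolynomial.coeff_monomial]
    rw [Finset.sum_eq_single ij]
    · simp
    · intro y _ hy
      rw [if_neg]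
      intro hee
      apply hy
      have h1 := congrArg (fun f => f false) hee
      have h2 := congrArg (fun f => f true) hee
      simp only [ee_false, ee_true] at h1 h2
      exact Prod.ext (Fin.ext h1) (Fin.ext h2)
    · simp
  refine ⟨P, ?_, ?_, ?_⟩
  · have : ∃ x, t x ≠ 0 := by
      by_contra hh; push Not at hh; exact ht0 (funext hh)
    obtain ⟨⟨l, ij⟩, hx⟩ := this
    refine ⟨l, by omega, fun h0 => hx ?_⟩
    rw [← hcoef l ij, h0]; simp
  · intro l d hd c
    by_cases hl : l < N + 1
    · simp only [hP, hl, dif_pos] at hd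
      have := MvPolynomial.support_sum hd
      rw [Finset.mem_biUnion] at this
      obtain ⟨ij, _, hij⟩ := this
      have := MvPolynomial.support_monomial_subset hij
      rw [Finset.mem_singleton] at this
      rw [this]; cases c
      · rw [ee_false]; omega
      · rw [ee_true]; omega
    · simp only [hP, dif_neg hl] at hd
      simp at hd
  · intro d hd
    have h1 := congrFun ht (⟨d false, by omega⟩, ⟨d true, by omega⟩)
    simp only [Matrix.mulVec, dotProduct, A, ee_eta, Pi.zero_apply] at h1
    refine Eq.trans ?_ h1
    rw [QT, MvPolynomial.coeff_sum, Finset.sum_range, Fintype.sum_prod_type]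
    refine Finset.sum_congr rfl fun l _ => ?_
    simp only [hP, l.2, dif_pos]
    rw [Finset.sum_mul, MvPolynomial.coeff_sum]
    refine Finset.sum_congr rfl fun ij _ => ?_
    have : MvPolynomial.monomial (ee ij.1 ij.2) (t (l, ij)) =
      MvPolynomial.C (t (l, ij)) * MvPolynomial.monomial (ee ij.1 ij.2) 1 := by
      rw [MvPolynomial.C_mul_monomial, mul_one]
    rw [this, mul_assoc, MvPolynomial.coeff_C_mul, mul_comm]

/-- nonvanishing at low order -/
lemma low_order {V : ℕ → Bool} (hV : ∀ n, RSinf V n) {N : ℕ} {p : ℕ → MvPolynomial Bool ℤ}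
    (hp : ∃ l ≤ N, p l ≠ 0) : ∃ n1, ∀ T > n1, ∃ d : Bool →₀ ℕ, d false + d true = n1 ∧
      (QT p N V T).coeff d ≠ 0 := by
  classical
  obtain ⟨l0, hl0, hp0⟩ := hp
  obtain ⟨α, hα⟩ : ∃ α : Bool → ℚ, MvPolynomial.aeval α (p l0 * MvPolynomial.X false * MvPolynomial.X true) ≠ 0 := by
    by_contra hh
    push Not at hh
    have h1 : p l0 * MvPolynomial.X false * MvPolynomial.X true ≠ 0 :=
      mul_ne_zero (mul_ne_zero hp0 (MvPolynomial.X_ne_zero _)) (MvPolynomial.X_ne_zero _)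
    apply h1
    have h2 : MvPolynomial.map (Int.castRingHom ℚ) (p l0 * MvPolynomial.X false * MvPolynomial.X true) = 0 := by
      apply MvPolynomial.funext
      intro x
      have := hh x
      rw [MvPolynomial.aeval_def] at this
      rw [MvPolynomial.eval_map, map_zero]
      exact this
    exact MvPolynomial.map_injective _ Int.cast_injective (h2.trans (map_zero _).symm)
  simp only [map_mul, MvPolynomial.aeval_X] at hα
  have hα0 : α false ≠ 0 := fun h => hα (by rw [h]; ring)
  have hα1 : α true ≠ 0 := fun h => hα (by rw [h]; ring)
  have hαp : MvPolynomial.aeval α (p l0) ≠ 0 := fun h => hα (by rw [h]; ring)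
  set s := α true / α false with hs
  have hs0 : s ≠ 0 := div_ne_zero hα1 hα0
  -- substitution
  let sv : Bool → Polynomial ℚ := fun c => if c then Polynomial.C s * Polynomial.X else Polynomial.X
  let φ : MvPolynomial Bool ℤ →+* Polynomial ℚ := MvPolynomial.eval₂Hom (Int.castRingHom (Polynomial ℚ)) sv
  have hφX : ∀ c, φ (MvPolynomial.X c) = sv c := fun c => by simp [φ]
  have hφ0 : φ (p l0) ≠ 0 := by
    intro h0
    apply hαp
    have h1 : (Polynomial.evalRingHom (α false)) (φ (p l0)) = 0 := by rw [h0, map_zero]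
    have h2 : (Polynomial.evalRingHom (α false)).comp φ = (MvPolynomial.aeval (R := ℤ) α).toRingHom := by
      apply MvPolynomial.ringHom_ext
      · intro r; simp
      · intro c
        simp only [RingHom.comp_apply, hφX]
        cases c <;> simp [sv, hs, hα0]
    have h3 := RingHom.congr_fun h2 (p l0)
    rw [RingHom.comp_apply, h1] at h3
    exact h3.symm
  set g : ℕ → ℚ := fun n => if V n then s ^ (cnt V n) else 0 with hg
  set F : PowerSeries ℚ := PowerSeries.mk g with hF
  have htr := F_transc hV hs0
  set G : PowerSeries ℚ := ∑ l ∈ Finset.range (N+1), ((φ (p l) : Polynomial ℚ) : PowerSeries ℚ) * F ^ l with hG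
  have hG0 : G ≠ 0 := by
    intro h0
    apply htr
    refine ⟨∑ l ∈ Finset.range (N+1), Polynomial.monomial l (φ (p l)), ?_, ?_⟩
    · intro h
      have := congrArg (fun P => P.coeff l0) h
      simp [Polynomial.finset_sum_coeff, Polynomial.coeff_monomial, hl0] at this
      exact hφ0 this
    · rw [map_sum]
      refine Eq.trans (Finset.sum_congr rfl fun l _ => ?_) h0
      rw [Polynomial.aeval_monomial, PowerSeries.algebraMap_apply']
      rfl
  obtain ⟨n1, hn1⟩ : ∃ n, PowerSeries.coeff n G ≠ 0 := by
    by_contra hh; push Not at hh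
    exact hG0 (PowerSeries.ext (by simpa using hh))
  refine ⟨n1, fun T hT => ?_⟩
  have hprod : ∀ n, φ (∏ i ∈ Finset.range n, MvPolynomial.X (V i)) = Polynomial.C (s ^ cnt V n) * Polynomial.X ^ n := by
    intro n
    induction n with
    | zero => simp [cnt]
    | succ n ih =>
      rw [Finset.prod_range_succ, map_mul, ih, hφX]
      simp only [sv, cnt]
      split_ifs <;> simp [pow_succ] <;> ring
  have hfT : ∃ r : PowerSeries ℚ, F = ((φ (fT V T) : Polynomial ℚ) : PowerSeries ℚ) + PowerSeries.X ^ T * r := by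
    have : PowerSeries.X ^ T ∣ F - ((φ (fT V T) : Polynomial ℚ) : PowerSeries ℚ) := by
      rw [PowerSeries.X_pow_dvd_iff]
      intro m hm
      rw [map_sub, sub_eq_zero, hF, PowerSeries.coeff_mk, Polynomial.coeff_coe, fT, map_sum,
        Polynomial.finset_sum_coeff, Finset.sum_eq_single m]
      · simp only [hg]
        split_ifs
        · rw [hprod, Polynomial.coeff_C_mul_X_pow, if_pos rfl]
        · simp
      · intro n _ hn
        split_ifs
        · rw [hprod, Polynomial.coeff_C_mul_X_pow, if_neg hn.symm]
        · simp
      · intro h; simp at h; omega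
    obtain ⟨r, hr⟩ := this
    exact ⟨r, by rw [← hr]; ring⟩
  obtain ⟨r, hr⟩ := hfT
  have hGQ : PowerSeries.X ^ T ∣ G - ((φ (QT p N V T) : Polynomial ℚ) : PowerSeries ℚ) := by
    have e : ((φ (QT p N V T) : Polynomial ℚ) : PowerSeries ℚ) = ∑ l ∈ Finset.range (N+1),
        ((φ (p l) : Polynomial ℚ) : PowerSeries ℚ) * ((φ (fT V T) : Polynomial ℚ) : PowerSeries ℚ) ^ l := by
      rw [QT, map_sum]
      rw [← Polynomial.coeToPowerSeries.ringHom_apply, map_sum]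
      refine Finset.sum_congr rfl fun l _ => ?_
      simp
    rw [e, hG, ← Finset.sum_sub_distrib]
    refine Finset.dvd_sum fun l _ => ?_
    rw [← mul_sub]
    refine Dvd.dvd.mul_left ?_ _
    refine Dvd.dvd.trans ⟨r, ?_⟩ (sub_dvd_pow_sub_pow _ _ l)
    rw [hr]; ring
  rw [PowerSeries.X_pow_dvd_iff] at hGQ
  have h1 := hGQ n1 hT
  rw [map_sub, sub_eq_zero, Polynomial.coeff_coe] at h1
  rw [h1] at hn1
  -- expand
  by_contra hcon
  push Not at hcon
  apply hn1
  rw [MvPolynomial.as_sum (QT p N V T), map_sum, Polynomial.finset_sum_coeff]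
  refine Finset.sum_eq_zero fun d hd => ?_
  have e : φ (MvPolynomial.monomial d ((QT p N V T).coeff d)) = Polynomial.C ((((QT p N V T).coeff d : ℤ) : ℚ) * s ^ (d true)) *
      Polynomial.X ^ (d false + d true) := by
    simp only [φ, MvPolynomial.coe_eval₂Hom, MvPolynomial.eval₂_monomial]
    rw [Finsupp.prod_fintype _ _ (by simp)]
    simp [sv, mul_pow]; ring
  rw [e, Polynomial.coeff_C_mul_X_pow]
  split_ifs with h
  · rw [hcon d h.symm]; simp
  · rfl

end

end

section
open Filter

noncomputable section

lemma theta_exists {a : ℕ → Bool} {L : ℕ} (hL : ∀ k c, ∃ j ≤ L, a (k + j) = c) (F : Ultrafilter ℕ)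
    (hF : (F : Filter ℕ) ≤ atTop) : ∃ θ : ℝ, 0 < θ ∧
      Tendsto (fun k => (qs a k false : ℝ) / qs a k true) F (nhds θ) ∧
      ∀ i j i' j' : ℕ, i * θ + j = i' * θ + j' → i = i' ∧ j = j' := by
  have pos : ∀ k c, (0:ℝ) < qs a k c := fun k c => by exact_mod_cast qs_pos a k c
  have rat : ∀ k c, (qs a k c : ℝ) ≤ (L + 1) * qs a k (!c) := fun k c => by
    exact_mod_cast qs_ratio hL k c
  have hL0 : (0:ℝ) < L + 1 := by positivity
  obtain ⟨θ, hθ, ht⟩ := (isCompact_Icc (a := ((L:ℝ)+1)⁻¹) (b := (L:ℝ)+1)).ultrafilter_le_nhds'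
    (F.map (fun k => (qs a k false : ℝ) / qs a k true)) (by
      apply Ultrafilter.mem_map.2
      apply Filter.mem_of_superset Filter.univ_mem
      intro k _
      constructor
      · rw [le_div_iff₀ (pos k true), inv_mul_le_iff₀ hL0]
        exact rat k true
      · rw [div_le_iff₀ (pos k true)]
        exact rat k false)
  have hθ0 : 0 < θ := lt_of_lt_of_le (by positivity) hθ.1
  have ht' : Tendsto (fun k => (qs a k false : ℝ) / qs a k true) F (nhds θ) := ht
  refine ⟨θ, hθ0, ht', ?_⟩
  have key : ∀ i j i' j' : ℕ, i * θ + j = i' * θ + j' → i ≤ i' := by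
    intro i j i' j' h
    by_contra hc
    push Not at hc
    have h1 : ((i:ℝ) - i') * θ = j' - j := by linarith
    have h2 : (0:ℝ) < (i:ℝ) - i' := by
      have : (i':ℝ) < i := by exact_mod_cast hc
      linarith
    have h3 : (0:ℝ) < (j':ℝ) - j := by rw [← h1]; positivity
    have h4 : j < j' := by
      have : (j:ℝ) < j' := by linarith
      exact_mod_cast this
    apply ratio_irrational hL ((j' - j) + (i - i')) (j' - j) (i - i') (by omega) (by omega) le_rfl F
      inferInstance hF
    have : ((j' - j : ℕ) : ℝ) / ((i - i' : ℕ) : ℝ) = θ := by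
      rw [Nat.cast_sub h4.le, Nat.cast_sub hc.le, ← h1]
      field_simp
    rw [this]; exact ht'
  intro i j i' j' h
  have e := le_antisymm (key i j i' j' h) (key i' j' i j h.symm)
  refine ⟨e, ?_⟩
  rw [e] at h
  have : (j:ℝ) = j' := by linarith
  exact_mod_cast this

lemma q1_atTop {a : ℕ → Bool} {L : ℕ} (hL : ∀ k c, ∃ j ≤ L, a (k + j) = c) :
    Tendsto (fun k => (qs a k true : ℝ)) atTop atTop := by
  have : ∀ k : ℕ, (k:ℝ) / (L + 2) ≤ qs a k true := by
    intro k
    rw [div_le_iff₀ (by positivity)]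
    have h1 := qs_sum_ge a k
    have h2 := qs_ratio hL k false
    simp only [Bool.not_false] at h2
    have h1' : (k:ℝ) + 2 ≤ qs a k true + qs a k false := by exact_mod_cast h1
    have h2' : (qs a k false : ℝ) ≤ (L + 1) * qs a k true := by exact_mod_cast h2
    linarith
  refine tendsto_atTop_mono this ?_
  exact tendsto_natCast_atTop_atTop.atTop_div_const (by positivity)

lemma mono_ratio {a : ℕ → Bool} {F : Filter ℕ} {θ x : ℝ} (hx0 : 0 < x) (hx1 : x < 1)
    (hq : Tendsto (fun k => (qs a k true : ℝ)) F atTop)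
    (ht : Tendsto (fun k => (qs a k false : ℝ) / qs a k true) F (nhds θ)) {i j i' j' : ℕ}
    (h : i' * θ + j' < i * θ + j) :
    Tendsto (fun k => (zk x a k false ^ i * zk x a k true ^ j) / (zk x a k false ^ i' * zk x a k true ^ j'))
      F (nhds 0) := by
  have pos : ∀ k c, (0:ℝ) < qs a k c := fun k c => by exact_mod_cast qs_pos a k c
  have hlog : Real.log x < 0 := Real.log_neg hx0 hx1
  have e : ∀ k, (zk x a k false ^ i * zk x a k true ^ j) / (zk x a k false ^ i' * zk x a k true ^ j')
      = Real.exp (-((qs a k true : ℝ) * (((i:ℝ) - i') * ((qs a k false : ℝ) / qs a k true) + (j - j')) * (-Real.log x))) := by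
    intro k
    have ex : x = Real.exp (Real.log x) := (Real.exp_log hx0).symm
    simp only [zk]
    nth_rewrite 1 2 3 4 [ex]
    simp only [← Real.exp_nat_mul, ← Real.exp_add, ← Real.exp_sub]
    congr 1
    have := (pos k true).ne'
    field_simp
    ring
  simp_rw [e]
  refine Real.tendsto_exp_neg_atTop_nhds_zero.comp ?_
  refine Tendsto.atTop_mul_const (by linarith) ?_
  refine hq.atTop_mul_pos (C := ((i:ℝ) - i') * θ + (j - j')) (by linarith) ?_
  exact (ht.const_mul _).add_const _

lemma aeval_z (z : Bool → ℝ) (Q : MvPolynomial Bool ℤ) :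
    MvPolynomial.aeval z Q = ∑ d ∈ Q.support, ((Q.coeff d : ℤ) : ℝ) * (z false ^ d false * z true ^ d true) := by
  rw [MvPolynomial.aeval_def, MvPolynomial.eval₂_eq']
  refine Finset.sum_congr rfl fun d _ => ?_
  simp [mul_comm]

def nrm (Q : MvPolynomial Bool ℤ) : ℝ := ∑ d ∈ Q.support, |((Q.coeff d : ℤ) : ℝ)|

lemma nrm_nonneg (Q : MvPolynomial Bool ℤ) : 0 ≤ nrm Q := Finset.sum_nonneg fun _ _ => abs_nonneg _

lemma Zok.mv_bound {z : Bool → ℝ} {ρ : ℝ} (h : Zok z ρ) (Q : MvPolynomial Bool ℤ) (M : ℕ)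
    (hM : ∀ d ∈ Q.support, M ≤ d false + d true) : |MvPolynomial.aeval z Q| ≤ nrm Q * ρ ^ M := by
  rw [aeval_z, nrm, Finset.sum_mul]
  refine (Finset.abs_sum_le_sum_abs _ _).trans (Finset.sum_le_sum fun d hd => ?_)
  rw [abs_mul]
  refine mul_le_mul_of_nonneg_left ?_ (abs_nonneg _)
  rw [abs_of_nonneg (mul_nonneg (pow_nonneg (h.pos _).le _) (pow_nonneg (h.pos _).le _))]
  calc z false ^ d false * z true ^ d true ≤ ρ ^ d false * ρ ^ d true :=
        mul_le_mul (pow_le_pow_left₀ (h.pos _).le (h.le _) _) (pow_le_pow_left₀ (h.pos _).le (h.le _) _)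
          (pow_nonneg (h.pos _).le _) (pow_nonneg h.rpos.le _)
    _ = ρ ^ (d false + d true) := (pow_add _ _ _).symm
    _ ≤ ρ ^ M := pow_le_pow_of_le_one h.rpos.le h.lt.le (hM d hd)

def EE (p : ℕ → MvPolynomial Bool ℤ) (N : ℕ) (z : Bool → ℝ) (y : ℝ) : ℝ :=
  ∑ l ∈ Finset.range (N + 1), MvPolynomial.aeval z (p l) * y ^ l

lemma aeval_fT (z : Bool → ℝ) (u V : ℕ → Bool) (T : ℕ) (h : ∀ t < T, u t = V t) :
    MvPolynomial.aeval z (fT V T) = ∑ n ∈ Finset.range T, if u n = true then pw z u n else 0 := by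
  have hp : ∀ n ≤ T, (∏ i ∈ Finset.range n, z (V i)) = pw z u n := by
    intro n hn
    induction n with
    | zero => simp [pw]
    | succ n ih => rw [Finset.prod_range_succ, ih (by omega), pw, h n (by omega)]
  rw [fT, map_sum]
  refine Finset.sum_congr rfl fun n hn => ?_
  rw [Finset.mem_range] at hn
  rw [h n hn]
  split_ifs
  · rw [map_prod]; simp only [MvPolynomial.aeval_X]; exact hp n hn.le
  · simp

lemma EE_diff (p : ℕ → MvPolynomial Bool ℤ) (N : ℕ) : ∃ C : ℝ, 0 ≤ C ∧ ∀ (z : Bool → ℝ) (ρ : ℝ) (u V : ℕ → Bool) (T : ℕ),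
    Zok z ρ → ρ ≤ 1/2 → (∀ t < T, u t = V t) →
    |EE p N z (GG true u z) - MvPolynomial.aeval z (QT p N V T)| ≤ C * ρ ^ T := by
  refine ⟨∑ l ∈ Finset.range (N+1), nrm (p l) * (2 * l * 2 ^ (l - 1)), ?_, ?_⟩
  · exact Finset.sum_nonneg fun l _ => mul_nonneg (nrm_nonneg _) (by positivity)
  intro z ρ u V T hz hρ hu
  have hρ0 := hz.rpos
  set y := GG true u z with hy
  set f := MvPolynomial.aeval z (fT V T) with hf
  have hinv : (1 - ρ)⁻¹ ≤ 2 := by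
    rw [inv_le_comm₀ (by linarith) (by norm_num)]; linarith
  obtain ⟨t1, t2⟩ := hz.GG_tail true u T
  rw [← aeval_fT z u V T hu, ← hf, ← hy] at t1 t2
  have hy2 : |y| ≤ 2 := (hz.GG_abs true u).trans hinv
  have hf0 : 0 ≤ f := by
    rw [hf, aeval_fT z u V T hu]
    refine Finset.sum_nonneg fun n _ => ?_
    split_ifs; exacts [(hz.pw_pos u n).le, le_rfl]
  have hf2 : |f| ≤ 2 := by
    rw [abs_of_nonneg hf0]; exact t1.trans ((le_abs_self _).trans hy2)
  have hyf : |y - f| ≤ 2 * ρ ^ T := by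
    rw [abs_of_nonneg (by linarith)]
    have := mul_le_mul_of_nonneg_left hinv (pow_nonneg hρ0.le T)
    linarith
  have e : EE p N z y - MvPolynomial.aeval z (QT p N V T) =
      ∑ l ∈ Finset.range (N+1), MvPolynomial.aeval z (p l) * (y ^ l - f ^ l) := by
    rw [EE, QT, map_sum, ← Finset.sum_sub_distrib]
    refine Finset.sum_congr rfl fun l _ => ?_
    rw [map_mul, map_pow]; ring
  rw [e, Finset.sum_mul]
  refine (Finset.abs_sum_le_sum_abs _ _).trans (Finset.sum_le_sum fun l _ => ?_)
  rw [abs_mul]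
  have h1 : |MvPolynomial.aeval z (p l)| ≤ nrm (p l) := by
    have := hz.mv_bound (p l) 0 (fun _ _ => Nat.zero_le _)
    simpa using this
  have h2 : |y ^ l - f ^ l| ≤ 2 * ρ ^ T * l * 2 ^ (l-1) := by
    refine (abs_pow_sub_pow_le y f l).trans ?_
    gcongr
    exact max_le hy2 hf2
  calc _ ≤ nrm (p l) * (2 * ρ ^ T * l * 2 ^ (l-1)) := mul_le_mul h1 h2 (abs_nonneg _) (nrm_nonneg _)
    _ = _ := by ring

def mq (a : ℕ → Bool) (k : ℕ) : ℕ := min (qs a k false) (qs a k true)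

lemma zk_ok' {x : ℝ} (h0 : 0 < x) (h1 : x < 1) (a : ℕ → Bool) (k : ℕ) : Zok (zk x a k) (x ^ mq a k) := by
  refine ⟨fun c => pow_pos h0 _, fun c => ?_, ?_⟩
  · refine pow_le_pow_of_le_one h0.le h1.le ?_
    cases c
    · exact min_le_left _ _
    · exact min_le_right _ _
  · exact pow_lt_one₀ h0.le h1 (by have := qs_pos a k false; have := qs_pos a k true; unfold mq; omega)

lemma rho_le {x : ℝ} (h0 : 0 < x) (h1 : x ≤ 1/2) (a : ℕ → Bool) (k : ℕ) : x ^ mq a k ≤ 1/2 := by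
  refine le_trans (le_trans (pow_le_pow_of_le_one h0.le (by linarith) (n := mq a k) (m := 1) ?_) (pow_one x).le) h1
  have := qs_pos a k false; have := qs_pos a k true; unfold mq; omega

lemma E_ne_zero {a : ℕ → Bool} {U : ℕ → ℕ → Bool} {V : ℕ → Bool} {F : Filter ℕ} {θ x : ℝ}
    (hx0 : 0 < x) (hx1 : x ≤ 1/2) (hθ : 0 < θ)
    (hq : Tendsto (fun k => (qs a k true : ℝ)) F atTop)
    (ht : Tendsto (fun k => (qs a k false : ℝ) / qs a k true) F (nhds θ))
    (hirr : ∀ i j i' j' : ℕ, i * θ + j = i' * θ + j' → i = i' ∧ j = j')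
    (hUV : ∀ N, ∀ᶠ k in F, ∀ t < N, U k t = V t) (hV : ∀ n, RSinf V n) {N : ℕ}
    {p : ℕ → MvPolynomial Bool ℤ} (hp : ∃ l ≤ N, p l ≠ 0) :
    ∀ᶠ k in F, EE p N (zk x a k) (GG true (U k) (zk x a k)) ≠ 0 := by
  classical
  have hx1' : x < 1 := by linarith
  obtain ⟨n1, hn1⟩ := low_order hV hp
  obtain ⟨T, hT⟩ := exists_nat_gt (max (n1:ℝ) (max (n1 * (θ + 1)) (n1 * (θ+1) / θ)))
  have hT1 : n1 < T := by exact_mod_cast (le_max_left _ _).trans_lt hT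
  have hT2 : n1 * (θ + 1) < T := ((le_max_left _ _).trans (le_max_right _ _)).trans_lt hT
  have hT3 : n1 * (θ + 1) < T * θ := by
    have := ((le_max_right _ _).trans (le_max_right _ _)).trans_lt hT
    rwa [div_lt_iff₀ hθ] at this
  obtain ⟨d1, hd1, hd1'⟩ := hn1 T hT1
  set Q := QT p N V T with hQ
  have hd1s : d1 ∈ Q.support := MvPolynomial.mem_support_iff.2 hd1'
  obtain ⟨μ, hμ, hmin⟩ := Finset.exists_min_image Q.support (fun d => (d false : ℝ) * θ + d true) ⟨d1, hd1s⟩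
  have hμn : (μ false : ℝ) * θ + μ true ≤ n1 * (θ + 1) := by
    refine (hmin d1 hd1s).trans ?_
    rw [← hd1]; push_cast
    have h1 : (0:ℝ) ≤ d1 false := Nat.cast_nonneg _
    have h2 : (0:ℝ) ≤ d1 true := Nat.cast_nonneg _
    nlinarith
  set Z : ℕ → ℝ := fun k => zk x a k false ^ μ false * zk x a k true ^ μ true with hZ
  have hZpos : ∀ k, 0 < Z k := fun k => mul_pos (pow_pos (pow_pos hx0 _) _) (pow_pos (pow_pos hx0 _) _)
  -- Q / Z → coeff
  have hlim : Tendsto (fun k => MvPolynomial.aeval (zk x a k) Q / Z k) F (nhds ((Q.coeff μ : ℤ) : ℝ)) := by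
    have e : ∀ k, MvPolynomial.aeval (zk x a k) Q / Z k = ∑ d ∈ Q.support, ((Q.coeff d : ℤ) : ℝ) *
        ((zk x a k false ^ d false * zk x a k true ^ d true) / Z k) := by
      intro k
      rw [aeval_z, Finset.sum_div]
      exact Finset.sum_congr rfl fun d _ => by rw [mul_div_assoc]
    simp_rw [e]
    have e2 : ((Q.coeff μ : ℤ) : ℝ) = ∑ d ∈ Q.support, if d = μ then ((Q.coeff d : ℤ) : ℝ) else 0 := by
      rw [Finset.sum_ite_eq' Q.support μ, if_pos hμ]
    rw [e2]
    refine tendsto_finset_sum _ fun d hd => ?_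
    by_cases hdμ : d = μ
    · subst hdμ
      simp only [if_true]
      refine Tendsto.congr (fun k => ?_) tendsto_const_nhds
      rw [show zk x a k false ^ d false * zk x a k true ^ d true = Z k from rfl, div_self (hZpos k).ne', mul_one]
    · rw [if_neg hdμ]
      have := (mono_ratio hx0 hx1' hq ht (i := d false) (j := d true) (i' := μ false) (j' := μ true) ?_).const_mul ((Q.coeff d : ℤ) : ℝ)
      · simpa using this
      · refine lt_of_le_of_ne (hmin d hd) fun h => hdμ ?_
        obtain ⟨h1, h2⟩ := hirr _ _ _ _ h
        rw [← ee_eta d, ← ee_eta μ, h1, h2]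
  obtain ⟨C, hC0, hC⟩ := EE_diff p N
  have hr0 := mono_ratio hx0 hx1' hq ht (i := T) (j := 0) (i' := μ false) (j' := μ true) (by push_cast; linarith)
  have hr1 := mono_ratio hx0 hx1' hq ht (i := 0) (j := T) (i' := μ false) (j' := μ true) (by push_cast; linarith)
  have hdiff : Tendsto (fun k => (EE p N (zk x a k) (GG true (U k) (zk x a k)) - MvPolynomial.aeval (zk x a k) Q) / Z k)
      F (nhds 0) := by
    have hs := (hr0.add hr1).const_mul C
    simp only [add_zero, mul_zero] at hs
    refine squeeze_zero_norm' ?_ hs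
    filter_upwards [hUV T] with k hk
    have := hC (zk x a k) (x ^ mq a k) (U k) V T (zk_ok' hx0 hx1' a k) (rho_le hx0 hx1 a k) hk
    rw [Real.norm_eq_abs, abs_div, abs_of_pos (hZpos k), ← add_div, ← mul_div_assoc]
    refine div_le_div_of_nonneg_right (this.trans (mul_le_mul_of_nonneg_left ?_ hC0)) (hZpos k).le
    have p0 : 0 ≤ zk x a k false ^ T := pow_nonneg (pow_nonneg hx0.le _) _
    have p1 : 0 ≤ zk x a k true ^ T := pow_nonneg (pow_nonneg hx0.le _) _
    simp only [pow_zero, one_mul, mul_one]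
    unfold mq
    rcases min_choice (qs a k false) (qs a k true) with h | h <;> rw [h]
    · change zk x a k false ^ T ≤ _; linarith
    · change zk x a k true ^ T ≤ _; linarith
  have hsum := hdiff.add hlim
  rw [zero_add] at hsum
  have hne : ((Q.coeff μ : ℤ) : ℝ) ≠ 0 := by exact_mod_cast MvPolynomial.mem_support_iff.1 hμ
  filter_upwards [hsum.eventually_ne hne] with k hk h0
  apply hk
  rw [h0]; ring

end

end

section
open Filter

noncomputable section

lemma sum_bound (N : ℕ) (p : ℕ → MvPolynomial Bool ℤ) {K : Type} [NormedField K] (f : ℕ → (Bool →₀ ℕ) → K) (B : ℝ)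
    (cst : ℕ → (Bool →₀ ℕ) → K)
    (hc : ∀ l d, ‖cst l d‖ ≤ |(((p l).coeff d : ℤ) : ℝ)|)
    (hf : ∀ l ≤ N, ∀ d ∈ (p l).support, ‖f l d‖ ≤ B) :
    ‖∑ l ∈ Finset.range (N+1), ∑ d ∈ (p l).support, cst l d * f l d‖ ≤
      (∑ l ∈ Finset.range (N+1), nrm (p l)) * B := by
  rw [Finset.sum_mul]
  refine (norm_sum_le _ _).trans (Finset.sum_le_sum fun l hl => ?_)
  rw [nrm, Finset.sum_mul]
  refine (norm_sum_le _ _).trans (Finset.sum_le_sum fun d hd => ?_)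
  rw [norm_mul]
  exact mul_le_mul (hc l d) (hf l (by rw [Finset.mem_range] at hl; omega) d hd) (norm_nonneg _) (abs_nonneg _)

lemma lower_bound {U : ℕ → ℕ → Bool} {a : ℕ → Bool}
    (hU : ∀ k, NA (a k) (U k) ∧ U (k+1) = stepW (a k) (U k)) {b : ℕ} (hb : 2 ≤ b)
    {N : ℕ} {p : ℕ → MvPolynomial Bool ℤ} (hpN : ∀ l, ∀ d ∈ (p l).support, ∀ c, d c ≤ N)
    {d : ℕ} {R : ℝ} {a0 : ℕ} (hR : 1 ≤ R)
    (hli : ∀ (N : ℕ) (H : Polynomial ℤ) (B : ℝ), H.natDegree ≤ N →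
      (∀ w : ℂ, ‖w‖ ≤ R → ‖Polynomial.aeval w H‖ ≤ B) →
      Polynomial.aeval (GG true (U 0) (fun _ => (b:ℝ)⁻¹)) H ≠ 0 →
      1 ≤ ((a0:ℝ) ^ N) ^ (d + 1) * B ^ d * |Polynomial.aeval (GG true (U 0) (fun _ => (b:ℝ)⁻¹)) H|) :
    ∃ K : ℝ, 0 ≤ K ∧ ∀ k, EE p N (zk (b:ℝ)⁻¹ a k) (GG true (U k) (zk (b:ℝ)⁻¹ a k)) ≠ 0 →
      1 ≤ K * (b:ℝ) ^ (3 * N * (d + 1) * (qs a k false + qs a k true)) *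
        |EE p N (zk (b:ℝ)⁻¹ a k) (GG true (U k) (zk (b:ℝ)⁻¹ a k))| := by
  classical
  set S := ∑ l ∈ Finset.range (N+1), nrm (p l) with hS
  have hS0 : 0 ≤ S := Finset.sum_nonneg fun _ _ => nrm_nonneg _
  refine ⟨((a0:ℝ) ^ N) ^ (d + 1) * (S * (R + 2) ^ N) ^ d, by positivity, ?_⟩
  intro k hk
  have hb' : (2:ℝ) ≤ b := by exact_mod_cast hb
  have hb0 : (0:ℝ) < b := by linarith
  have hb1 : (1:ℝ) ≤ b := by linarith
  set x := (b:ℝ)⁻¹ with hx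
  have hx0 : 0 < x := by positivity
  have hbx : (b:ℝ) * x = 1 := by rw [hx]; field_simp
  have hx12 : x ≤ 1/2 := by rw [hx, inv_le_comm₀ hb0 (by norm_num)]; norm_num; exact hb
  have hx1 : x < 1 := by linarith
  obtain ⟨P, e, hCF⟩ := chain_form hU hb k
  rw [← hx] at hCF
  have heq := hCF.eq0 hx0 hx1
  obtain ⟨he, hP, -, -⟩ := hCF
  have hP0 := hP false
  set Ξ := GG true (U 0) (fun _ => x) with hΞ
  set y := GG true (U k) (zk x a k) with hy
  set q0 := qs a k false with hq0
  set q1 := qs a k true with hq1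
  have hq0p : 1 ≤ q0 := qs_pos a k false
  have hq1p : 1 ≤ q1 := qs_pos a k true
  have z0 : zk x a k false = x ^ q0 := rfl
  have z1 : zk x a k true = x ^ q1 := rfl
  rw [z0] at heq hP0
  have hbq : ∀ n, (b:ℝ) ^ n * x ^ n = 1 := fun n => by rw [← mul_pow, hbx, one_pow]
  set Q := q0 + q1 with hQ
  let Dn : ℤ := ((b:ℤ) - 1) * (b:ℤ) ^ q0
  let A : ℤ := (b:ℤ) ^ (e+1) * ((b:ℤ)^q0 - 1)
  let B : ℤ := - ((b:ℤ) ^ (e+1) * P false)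
  have hyD : (Dn:ℝ) * y = A * Ξ + B := by
    simp only [Dn, A, B]; push_cast
    have := hbq q0
    have h2 := hbq e
    rw [pow_succ]
    linear_combination (-(b:ℝ)^e * b * b^q0) * heq + ((b:ℝ)^e*b*Ξ + (b:ℝ)^e*b*P false) * this*(-1)+ ((b:ℝ)*(1-x)*b^q0*y)*h2*(-1) + ((b:ℝ)^q0 * y)*hbx
  have hPle : (P false : ℝ) ≤ 2 * (b:ℝ)^q0 := by
    have h1 := hbq q0
    have h2 : 0 < x ^ q0 := by positivity
    have h3 : (P false : ℝ) * x^q0 * (1/2) ≤ 1 := by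
      have : (P false : ℝ) * x^q0 * (1/2) ≤ P false * x^q0 * (1-x) :=
        mul_le_mul_of_nonneg_left (by linarith) (by positivity)
      linarith
    have h4 : (P false : ℝ) = P false * x^q0 * (1/2) * (2 * b^q0) := by linear_combination (-(P false:ℝ)) * h1
    rw [h4]
    have h5 : (0:ℝ) ≤ 2 * b^q0 := by positivity
    nlinarith
  have hbm : ∀ m n : ℕ, m ≤ n → (b:ℝ)^m ≤ (b:ℝ)^n := fun m n h => pow_le_pow_right₀ hb1 h
  have hDn0 : (0:ℝ) ≤ Dn := by simp only [Dn]; push_cast; exact mul_nonneg (by linarith) (by positivity)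
  have hDnp : (0:ℝ) < Dn := by simp only [Dn]; push_cast; exact mul_pos (by linarith) (by positivity)
  have hDnle : (Dn:ℝ) ≤ (b:ℝ)^(2*Q) := by
    simp only [Dn]; push_cast
    calc ((b:ℝ) - 1) * b^q0 ≤ b * b^q0 := mul_le_mul_of_nonneg_right (by linarith) (by positivity)
      _ = b^(q0+1) := by ring
      _ ≤ _ := hbm _ _ (by omega)
  have hA0 : (0:ℝ) ≤ A := by
    simp only [A]; push_cast
    have := one_le_pow₀ hb1 (n := q0)
    exact mul_nonneg (by positivity) (by linarith)
  have hAle : (A:ℝ) ≤ (b:ℝ)^(2*Q) := by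
    simp only [A]; push_cast
    calc (b:ℝ)^(e+1) * (b^q0 - 1) ≤ b^(e+1) * b^q0 := mul_le_mul_of_nonneg_left (by linarith) (by positivity)
      _ = b^(e+1+q0) := by ring
      _ ≤ _ := hbm _ _ (by omega)
  have hBle : |(B:ℝ)| ≤ 2 * (b:ℝ)^(2*Q) := by
    simp only [B]; push_cast
    rw [abs_neg, abs_of_nonneg (by positivity)]
    calc (b:ℝ)^(e+1) * P false ≤ b^(e+1) * (2 * b^q0) := mul_le_mul_of_nonneg_left hPle (by positivity)
      _ = 2 * b^(e+1+q0) := by ring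
      _ ≤ _ := mul_le_mul_of_nonneg_left (hbm _ _ (by omega)) (by norm_num)
  let ex : (Bool →₀ ℕ) → ℕ := fun δ => N * Q - (δ false * q0 + δ true * q1)
  let H : Polynomial ℤ := ∑ l ∈ Finset.range (N+1), ∑ δ ∈ (p l).support,
    Polynomial.C ((p l).coeff δ) * (Polynomial.C ((b:ℤ) ^ ex δ * Dn ^ (N - l)) * (Polynomial.C A * Polynomial.X + Polynomial.C B) ^ l)
  have hdeg : H.natDegree ≤ N := by
    refine Polynomial.natDegree_sum_le_of_forall_le _ _ fun l hl => ?_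
    refine Polynomial.natDegree_sum_le_of_forall_le _ _ fun δ _ => ?_
    refine (Polynomial.natDegree_C_mul_le _ _).trans ((Polynomial.natDegree_C_mul_le _ _).trans ?_)
    refine (Polynomial.natDegree_pow_le_of_le l Polynomial.natDegree_linear_le).trans ?_
    rw [Finset.mem_range] at hl; omega
  have hHw : ∀ w : ℂ, Polynomial.aeval w H = ∑ l ∈ Finset.range (N+1), ∑ δ ∈ (p l).support,
      (((p l).coeff δ : ℤ) : ℂ) * (((b:ℂ) ^ ex δ * (Dn:ℂ) ^ (N - l)) * (A * w + B) ^ l) := by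
    intro w; simp [H]
  have hHΞ : Polynomial.aeval Ξ H = ∑ l ∈ Finset.range (N+1), ∑ δ ∈ (p l).support,
      (((p l).coeff δ : ℤ) : ℝ) * (((b:ℝ) ^ ex δ * (Dn:ℝ) ^ (N - l)) * (A * Ξ + B) ^ l) := by
    simp [H]
  have hHE : Polynomial.aeval Ξ H = (b:ℝ)^(N*Q) * (Dn:ℝ)^N * EE p N (zk x a k) y := by
    rw [hHΞ, EE, Finset.mul_sum]
    refine Finset.sum_congr rfl fun l hl => ?_
    rw [aeval_z, Finset.sum_mul, Finset.mul_sum]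
    refine Finset.sum_congr rfl fun δ hδ => ?_
    rw [z0, z1, ← hyD]
    have hl' : l ≤ N := by rw [Finset.mem_range] at hl; omega
    have e1 : (Dn:ℝ)^N = (Dn:ℝ)^(N-l) * (Dn:ℝ)^l := by rw [← pow_add]; congr 1; omega
    have e2 : (b:ℝ)^(N*Q) = (b:ℝ)^(ex δ) * (b^q0)^(δ false) * (b^q1)^(δ true) := by
      rw [← pow_mul, ← pow_mul, ← pow_add, ← pow_add]
      congr 1
      have h1 := Nat.mul_le_mul_right q0 (hpN l δ hδ false)
      have h2 := Nat.mul_le_mul_right q1 (hpN l δ hδ true)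
      simp only [ex, hQ, mul_add]
      have := mul_comm q0 (δ false)
      have := mul_comm q1 (δ true)
      omega
    have e3 : ((b:ℝ)^q0)^(δ false) * (x^q0)^(δ false) = 1 := by rw [← mul_pow, hbq, one_pow]
    have e4 : ((b:ℝ)^q1)^(δ true) * (x^q1)^(δ true) = 1 := by rw [← mul_pow, hbq, one_pow]
    rw [e1, e2, mul_pow]
    set c := (((p l).coeff δ : ℤ) : ℝ)
    calc c * ((b:ℝ) ^ ex δ * (Dn:ℝ) ^ (N - l) * ((Dn:ℝ)^l * y^l)) =
        c * ((b:ℝ) ^ ex δ * (Dn:ℝ) ^ (N - l) * ((Dn:ℝ)^l * y^l)) *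
          (((b:ℝ)^q0)^(δ false) * (x^q0)^(δ false)) * (((b:ℝ)^q1)^(δ true) * (x^q1)^(δ true)) := by
          rw [e3, e4]; ring
      _ = _ := by ring
  have hbound : ∀ w : ℂ, ‖w‖ ≤ R → ‖Polynomial.aeval w H‖ ≤ S * ((R+2)^N * (b:ℝ)^(3*N*Q)) := by
    intro w hw
    rw [hHw]
    refine sum_bound N p _ _ _ (fun l δ => ?_) (fun l hl δ hδ => ?_)
    · rw [Complex.norm_intCast]
    · rw [norm_mul, norm_mul, norm_pow, norm_pow, norm_pow, Complex.norm_natCast, Complex.norm_intCast, abs_of_nonneg hDn0]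
      have hAB : ‖(A:ℂ) * w + B‖ ≤ (R+2) * (b:ℝ)^(2*Q) := by
        refine (norm_add_le _ _).trans ?_
        rw [norm_mul, Complex.norm_intCast, Complex.norm_intCast, abs_of_nonneg hA0]
        have : (A:ℝ) * ‖w‖ ≤ (b:ℝ)^(2*Q) * R := mul_le_mul hAle hw (norm_nonneg _) (by positivity)
        linarith
      have h1 : (b:ℝ)^ex δ ≤ (b:ℝ)^(N*Q) := hbm _ _ (Nat.sub_le _ _)
      have h2 : (Dn:ℝ)^(N-l) ≤ ((b:ℝ)^(2*Q))^(N-l) := pow_le_pow_left₀ hDn0 hDnle _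
      have h3 : ‖(A:ℂ) * w + B‖^l ≤ ((R+2) * (b:ℝ)^(2*Q))^l := pow_le_pow_left₀ (norm_nonneg _) hAB _
      have h4 : (R+2)^l ≤ (R+2)^N := pow_le_pow_right₀ (by linarith) hl
      calc (b:ℝ)^ex δ * (Dn:ℝ)^(N-l) * ‖(A:ℂ) * w + B‖^l
          ≤ (b:ℝ)^(N*Q) * ((b:ℝ)^(2*Q))^(N-l) * ((R+2) * (b:ℝ)^(2*Q))^l := by gcongr
        _ = (R+2)^l * ((b:ℝ)^(N*Q) * (((b:ℝ)^(2*Q))^(N-l) * ((b:ℝ)^(2*Q))^l)) := by rw [mul_pow]; ring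
        _ = (R+2)^l * (b:ℝ)^(3*N*Q) := by
            rw [← pow_add, Nat.sub_add_cancel hl, ← pow_mul, ← pow_add]; congr 2; ring
        _ ≤ _ := by gcongr
  have hne : Polynomial.aeval Ξ H ≠ 0 := by
    rw [hHE]
    exact mul_ne_zero (mul_ne_zero (by positivity) (by positivity)) hk
  have hfin := hli N H _ hdeg hbound hne
  refine hfin.trans ?_
  rw [hHE, abs_mul, abs_of_nonneg (by positivity : (0:ℝ) ≤ (b:ℝ)^(N*Q) * (Dn:ℝ)^N)]
  set E := |EE p N (zk x a k) y|
  have hE0 : 0 ≤ E := abs_nonneg _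
  have h5 : (b:ℝ)^(N*Q) * (Dn:ℝ)^N ≤ (b:ℝ)^(3*N*Q) := by
    calc (b:ℝ)^(N*Q) * (Dn:ℝ)^N ≤ (b:ℝ)^(N*Q) * ((b:ℝ)^(2*Q))^N := by gcongr
      _ = _ := by rw [← pow_mul, ← pow_add]; congr 1; ring
  calc ((a0:ℝ) ^ N) ^ (d + 1) * (S * ((R+2)^N * (b:ℝ)^(3*N*Q)))^d * ((b:ℝ)^(N*Q) * (Dn:ℝ)^N * E)
      ≤ ((a0:ℝ) ^ N) ^ (d + 1) * (S * ((R+2)^N * (b:ℝ)^(3*N*Q)))^d * ((b:ℝ)^(3*N*Q) * E) := by gcongr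
    _ = ((a0:ℝ) ^ N) ^ (d + 1) * (S * (R + 2) ^ N) ^ d * (((b:ℝ)^(3*N*Q))^d * (b:ℝ)^(3*N*Q)) * E := by
        rw [← mul_assoc S, mul_pow (S * (R+2)^N)]; ring
    _ = _ := by
        have e6 : ((b:ℝ)^(3*N*Q))^d * (b:ℝ)^(3*N*Q) = (b:ℝ)^(3*N*(d+1)*Q) := by
          rw [← pow_mul, ← pow_add]; congr 1; ring
        rw [e6]

end

end

section
open Filter

noncomputable section

lemma mahler_case {U : ℕ → ℕ → Bool} {a : ℕ → Bool}
    (hU : ∀ k, NA (a k) (U k) ∧ U (k+1) = stepW (a k) (U k)) {b : ℕ} (hb : 2 ≤ b) {L : ℕ}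
    (hL : ∀ k c, ∃ j ≤ L, a (k + j) = c) :
    ¬ IsAlgebraic ℚ (GG true (U 0) (fun _ => (b:ℝ)⁻¹)) := by
  intro halg
  have hb' : (2:ℝ) ≤ b := by exact_mod_cast hb
  have hb0 : (0:ℝ) < b := by linarith
  have hb1 : (1:ℝ) ≤ b := by linarith
  obtain ⟨d, R, a0, hR, ha0, hli⟩ := liou_ineq halg
  set x := (b:ℝ)⁻¹ with hx
  have hx0 : 0 < x := by positivity
  have hbx : (b:ℝ) * x = 1 := by rw [hx]; field_simp
  have hx12 : x ≤ 1/2 := by rw [hx, inv_le_comm₀ hb0 (by norm_num)]; norm_num; exact hb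
  have hx1 : x < 1 := by linarith
  set F : Ultrafilter ℕ := Filter.hyperfilter ℕ with hFdef
  have hF : (F : Filter ℕ) ≤ atTop := Nat.hyperfilter_le_atTop
  obtain ⟨V, hUV, hV⟩ := limit_word hU hL F
  obtain ⟨θ, hθ, ht, hirr⟩ := theta_exists hL F hF
  have hq := (q1_atTop hL).mono_left hF
  -- parameters
  set κ := 3 * (L + 2) * (d + 1) with hκ
  set n := κ + 1 with hn
  have hκ6 : 6 ≤ κ := by
    have : 1 ≤ (L+1) * (d+1) := Nat.mul_pos (by omega) (by omega)
    nlinarith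
  obtain ⟨N, hN⟩ : ∃ N, N + 1 = n * n := ⟨n * n - 1, Nat.sub_add_cancel (by rw [hn]; apply Nat.succ_le_of_lt; positivity)⟩
  obtain ⟨M, hM⟩ : ∃ M, M + 1 = n * (n * n) := ⟨n * (n * n) - 1, Nat.sub_add_cancel (by rw [hn]; apply Nat.succ_le_of_lt; positivity)⟩
  have hM1 : 1 ≤ M := by
    have : 7 * (7 * 7) ≤ n * (n * n) := Nat.mul_le_mul (by omega) (Nat.mul_le_mul (by omega) (by omega))
    omega
  have hMN : M * M < (N+1) * ((N+1) * (N+1)) := by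
    rw [hN]
    calc M * M < (M + 1) * (M + 1) := Nat.mul_lt_mul_of_lt_of_lt (by omega) (by omega)
      _ = _ := by rw [hM]; ring
  have hMbig : (L + 2) * (3 * N * (d+1) + 1) ≤ M := by
    have e1 : (L + 2) * (3 * N * (d+1) + 1) = κ * N + (L + 2) := by rw [hκ]; ring
    have e2 : L + 2 ≤ κ := by rw [hκ]; nlinarith
    have e3 : M + 1 = κ * (N + 1) + (N + 1) := by rw [hM, ← hN, hn]; ring
    rw [e1]
    have : κ * (N+1) = κ * N + κ := by ring
    omega
  obtain ⟨p, hp, hpN, hpM⟩ := aux_poly V N M hM1 hMN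
  have hne := E_ne_zero hx0 hx12 hθ hq ht hirr hUV hV hp
  obtain ⟨K, hK0, hK⟩ := lower_bound hU hb hpN hR hli
  rw [← hx] at hK
  obtain ⟨C, hC0, hC⟩ := EE_diff p N
  set Q := QT p N V M with hQ
  have hub : ∀ᶠ k in (F : Filter ℕ), |EE p N (zk x a k) (GG true (U k) (zk x a k))| ≤ (C + nrm Q) * (x ^ mq a k) ^ M := by
    filter_upwards [hUV M] with k hk
    have h1 := hC (zk x a k) (x ^ mq a k) (U k) V M (zk_ok' hx0 hx1 a k) (rho_le hx0 hx12 a k) hk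
    have h2 := (zk_ok' hx0 hx1 a k).mv_bound Q M (fun δ hδ => by
      by_contra hc
      push Not at hc
      exact MvPolynomial.mem_support_iff.1 hδ (hpM δ hc))
    have h3 := abs_sub_abs_le_abs_sub (EE p N (zk x a k) (GG true (U k) (zk x a k))) (MvPolynomial.aeval (zk x a k) Q)
    rw [add_mul]; linarith
  have hmain : ∀ᶠ k in (F : Filter ℕ), 1 ≤ K * (C + nrm Q) * x ^ k := by
    filter_upwards [hne, hub] with k h1 h2
    have h3 := hK k h1
    set q := qs a k false + qs a k true with hqd
    have hqk : k ≤ q := by have := qs_sum_ge a k; omega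
    have hmq : q ≤ (L + 2) * mq a k := by
      have r0 := qs_ratio hL k false
      have r1 := qs_ratio hL k true
      simp only [Bool.not_false, Bool.not_true] at r0 r1
      have e : (L+2) * mq a k = (L+1) * mq a k + mq a k := by ring
      rw [e]; unfold mq
      rcases min_choice (qs a k false) (qs a k true) with h | h <;> rw [h] <;> omega
    have hexp : 3 * N * (d+1) * q + k ≤ mq a k * M := by
      calc 3 * N * (d+1) * q + k ≤ 3 * N * (d+1) * q + q := by omega
        _ = (3 * N * (d+1) + 1) * q := by ring
        _ ≤ (3 * N * (d+1) + 1) * ((L+2) * mq a k) := Nat.mul_le_mul_left _ hmq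
        _ = mq a k * ((L + 2) * (3 * N * (d+1) + 1)) := by ring
        _ ≤ _ := Nat.mul_le_mul_left _ hMbig
    have hS0 := nrm_nonneg Q
    calc (1:ℝ) ≤ K * (b:ℝ) ^ (3 * N * (d+1) * q) * ((C + nrm Q) * (x ^ mq a k) ^ M) :=
          h3.trans (mul_le_mul_of_nonneg_left h2 (by positivity))
      _ = K * (C + nrm Q) * ((b:ℝ) ^ (3 * N * (d+1) * q) * x ^ (mq a k * M)) := by rw [← pow_mul]; ring
      _ ≤ K * (C + nrm Q) * ((b:ℝ) ^ (3 * N * (d+1) * q) * x ^ (3 * N * (d+1) * q + k)) := by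
          have := pow_le_pow_of_le_one hx0.le hx1.le hexp
          gcongr
      _ = K * (C + nrm Q) * x ^ k := by
          rw [pow_add, ← mul_assoc ((b:ℝ) ^ _), ← mul_pow, hbx, one_pow, one_mul]
  have hlim : Tendsto (fun k => K * (C + nrm Q) * x ^ k) F (nhds 0) := by
    have := ((tendsto_pow_atTop_nhds_zero_of_lt_one hx0.le hx1).const_mul (K * (C + nrm Q))).mono_left hF
    simpa using this
  have := ge_of_tendsto hlim hmain
  linarith

end

end

section
open Filter

noncomputable section

def win (w : ℕ → Bool) (m i : ℕ) : Fin m → Bool := fun t => w (i + t)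

def WW (w : ℕ → Bool) (m : ℕ) : Set (Fin m → Bool) := Set.range (win w m)

lemma complexity_eq {s : ℕ → ℤ} {w : ℕ → Bool} {k : ℤ} (hs : ∀ n, s n = if w n then k + 1 else k) (m : ℕ) :
    complexity s m = (WW w m).ncard := by
  let f : (Fin m → Bool) → List ℤ := fun g => List.ofFn (fun t => if g t then k + 1 else k)
  have hf : Function.Injective f := by
    intro g h hgh
    have := List.ofFn_injective hgh
    ext t
    have h1 := congrFun this t
    cases hg : g t <;> cases hh : h t <;> simp [hg, hh] at h1 ⊢
  rw [← Set.ncard_image_of_injective _ hf, complexity]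
  congr 1
  have hw : ∀ i, window s i m = f (win w m i) := by
    intro i
    apply List.ext_getElem
    · simp [window, f]
    · intro t h1 h2
      simp [window, f, win, hs]
      congr
  ext l
  constructor
  · rintro ⟨h1, i, hi⟩
    rw [h1] at hi
    exact ⟨win w m i, ⟨i, rfl⟩, by rw [hi, hw]⟩
  · rintro ⟨_, ⟨i, rfl⟩, rfl⟩
    have : (f (win w m i)).length = m := by simp [f]
    refine ⟨this, i, ?_⟩
    rw [this, hw]

lemma win_eq_iff {w : ℕ → Bool} {m i j : ℕ} : win w m i = win w m j ↔ Ag w m i j := by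
  constructor
  · intro h t ht
    exact congrFun h ⟨t, ht⟩
  · intro h
    funext t
    exact h t t.2

lemma NP_of_card {w : ℕ → Bool} (h : ∀ m ≥ 1, (WW w m).ncard = m + 1) : NP w := by
  have key : ∀ i j, i < j → ∃ n, w (i + n) ≠ w (j + n) := by
    intro i j hij
    by_contra hc
    push Not at hc
    have hsub : WW w j ⊆ (win w j) '' (Finset.range j : Set ℕ) := by
      rintro _ ⟨i0, rfl⟩
      induction i0 using Nat.strong_induction_on with
      | _ i0 ih =>
        by_cases hi : i0 < j
        · exact ⟨i0, by simpa using hi, rfl⟩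
        · have : win w j i0 = win w j (i0 - (j - i)) := by
            rw [win_eq_iff]
            intro t ht
            have := hc (i0 - j + t)
            rw [show i0 + t = j + (i0 - j + t) by omega, show i0 - (j - i) + t = i + (i0 - j + t) by omega, this]
          rw [this]
          exact ih _ (by omega)
    have h1 := Set.ncard_le_ncard hsub (Set.toFinite _)
    have h2 := Set.ncard_image_le (f := win w j) (Finset.finite_toSet (Finset.range j))
    rw [Set.ncard_coe_finset, Finset.card_range] at h2
    rw [h j (by omega)] at h1
    omega
  intro i j hij
  rcases lt_or_gt_of_ne hij with h1 | h1
  · exact key i j h1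
  · obtain ⟨n, hn⟩ := key j i h1
    exact ⟨n, hn.symm⟩

lemma UR_of_card {w : ℕ → Bool} (h : ∀ m ≥ 1, (WW w m).ncard = m + 1) : UR w := by
  rintro n i i' ⟨j, hj, hj'⟩ ⟨l, hl, hl'⟩
  by_contra hc
  have hn : 1 ≤ n := by
    by_contra h0
    exact hc fun t ht => by omega
  let r : (Fin (n+1) → Bool) → (Fin n → Bool) := fun g t => g t.castSucc
  have hr : ∀ i, r (win w (n+1) i) = win w n i := fun i => rfl
  set a1 := win w (n+1) i with ha1
  set a2 := win w (n+1) i' with ha2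
  have lastne : ∀ i j, w (i + n) ≠ w (j + n) → win w (n+1) j ≠ win w (n+1) i := by
    intro i j hij h1
    rw [win_eq_iff] at h1
    exact hij (h1 n (by omega)).symm
  have rne : ∀ i j, ¬ Ag w n i j → win w (n+1) i ≠ win w (n+1) j := by
    intro i j hij h1
    apply hij
    rw [← win_eq_iff, ← hr, ← hr, h1]
  have hsub : WW w n ⊆ r '' (WW w (n+1) \ {a1, a2}) := by
    rintro _ ⟨i0, rfl⟩
    by_cases e1 : win w (n+1) i0 = a1
    · have hA : Ag w n i0 i := by
        by_contra hh; exact rne _ _ hh e1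
      refine ⟨win w (n+1) j, ⟨⟨j, rfl⟩, ?_⟩, ?_⟩
      · simp only [Set.mem_insert_iff, Set.mem_singleton_iff, not_or]
        exact ⟨lastne i j hj', rne j i' fun hh => hc (hj.trans hh)⟩
      · rw [hr, win_eq_iff]; exact (hA.trans hj).symm
    · by_cases e2 : win w (n+1) i0 = a2
      · have hA : Ag w n i0 i' := by
          by_contra hh; exact rne _ _ hh e2
        refine ⟨win w (n+1) l, ⟨⟨l, rfl⟩, ?_⟩, ?_⟩
        · simp only [Set.mem_insert_iff, Set.mem_singleton_iff, not_or]
          exact ⟨rne l i fun hh => hc (hl.trans hh).symm, lastne i' l hl'⟩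
        · rw [hr, win_eq_iff]; exact (hA.trans hl).symm
      · exact ⟨win w (n+1) i0, ⟨⟨i0, rfl⟩, by simp [e1, e2]⟩, rfl⟩
  have hne : a1 ≠ a2 := rne _ _ hc
  have h1 := Set.ncard_le_ncard hsub (Set.toFinite _)
  have h2 := Set.ncard_image_le (f := r) (Set.toFinite (WW w (n+1) \ {a1, a2}))
  have h3 : (WW w (n+1) \ {a1, a2}).ncard = (WW w (n+1)).ncard - ({a1, a2} : Set _).ncard :=
    Set.ncard_sdiff (by
      intro g hg
      rcases hg with rfl | rfl
      · exact ⟨i, rfl⟩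
      · exact ⟨i', rfl⟩) (Set.toFinite _)
  rw [Set.ncard_pair hne, h (n+1) (by omega)] at h3
  rw [h n hn] at h1
  omega

lemma pw_const (x : ℝ) (u : ℕ → Bool) (n : ℕ) : pw (fun _ => x) u n = x ^ n := by
  induction n with
  | zero => simp [pw]
  | succ n ih => rw [pw, ih, pow_succ]

lemma expansion {b : ℕ} (hb : 2 ≤ b) (ξ : ℝ) (k : ℤ) (w : ℕ → Bool)
    (hs : ∀ n, ⌊(b : ℝ) * Int.fract (ξ * (b : ℝ) ^ n)⌋ = if w n then k + 1 else k) :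
    Int.fract ξ = (b:ℝ)⁻¹ * (k * (1 - (b:ℝ)⁻¹)⁻¹ + GG true w (fun _ => (b:ℝ)⁻¹)) := by
  have hb' : (2:ℝ) ≤ b := by exact_mod_cast hb
  have hb0 : (0:ℝ) < b := by linarith
  set x := (b:ℝ)⁻¹ with hx
  have hx0 : 0 < x := by positivity
  have hbx : (b:ℝ) * x = 1 := by rw [hx]; field_simp
  have hx1 : x < 1 := by
    rw [hx]; exact inv_lt_one_of_one_lt₀ (by linarith)
  have hz : Zok (fun _ : Bool => x) x := ⟨fun _ => hx0, fun _ => le_rfl, hx1⟩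
  set r : ℕ → ℝ := fun n => Int.fract (ξ * (b:ℝ)^n) with hr
  have hstep : ∀ n, r n = x * ((if w n then (k:ℝ) + 1 else k) + r (n+1)) := by
    intro n
    have h1 : r (n+1) = b * r n - ⌊(b:ℝ) * r n⌋ := by
      have e1 : r (n+1) = Int.fract ((b:ℝ) * r n) := by
        simp only [hr]
        rw [Int.fract_eq_fract]
        refine ⟨b * ⌊ξ * (b:ℝ)^n⌋, ?_⟩
        push_cast
        have := Int.self_sub_floor (ξ * (b:ℝ)^n)
        rw [← this, pow_succ]; ring
      rw [e1, Int.self_sub_floor]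
    have h2 : (⌊(b:ℝ) * r n⌋ : ℝ) = if w n then (k:ℝ) + 1 else k := by
      rw [show ⌊(b:ℝ) * r n⌋ = if w n then k + 1 else k from hs n]
      split_ifs <;> simp
    rw [← h2, h1]
    linear_combination (-(r n)) * hbx
  have hT : ∀ T, r 0 = x * (k * ∑ n ∈ Finset.range T, x ^ n +
      ∑ n ∈ Finset.range T, if w n = true then pw (fun _ => x) w n else 0) + x ^ T * r T := by
    intro T
    induction T with
    | zero => simp
    | succ T ih =>
      rw [ih, Finset.sum_range_succ, Finset.sum_range_succ, hstep T, pw_const, pow_succ]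
      split_ifs <;> ring
  have h0 : r 0 = Int.fract ξ := by simp [hr]
  rw [← h0]
  have l1 : Tendsto (fun T => ∑ n ∈ Finset.range T, x ^ n) atTop (nhds (1 - x)⁻¹) :=
    (hasSum_geometric_of_lt_one hx0.le hx1).tendsto_sum_nat
  have l2 : Tendsto (fun T => ∑ n ∈ Finset.range T, if w n = true then pw (fun _ => x) w n else 0) atTop
      (nhds (GG true w (fun _ => x))) := (hz.summable true w).hasSum.tendsto_sum_nat
  have l3 : Tendsto (fun T => x ^ T * r T) atTop (nhds 0) := by
    refine squeeze_zero (fun T => mul_nonneg (by positivity) (Int.fract_nonneg _)) (fun T => ?_)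
      (tendsto_pow_atTop_nhds_zero_of_lt_one hx0.le hx1)
    exact mul_le_of_le_one_right (by positivity) (Int.fract_lt_one _).le
  have l4 := (((l1.const_mul (k:ℝ)).add l2).const_mul x).add l3
  rw [add_zero] at l4
  refine tendsto_nhds_unique (tendsto_const_nhds.congr hT) l4

lemma main_transc {w : ℕ → Bool} (h1 : NP w) (h2 : UR w) {b : ℕ} (hb : 2 ≤ b) :
    ¬ IsAlgebraic ℚ (GG true w (fun _ => (b:ℝ)⁻¹)) := by
  obtain ⟨U, a, rfl, hU⟩ := exists_chain h1 h2
  by_cases h : ∃ L, ∀ k c, ∃ j ≤ L, a (k + j) = c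
  · obtain ⟨L, hL⟩ := h
    exact mahler_case (fun k => ⟨(hU k).1, (hU k).2.1⟩) hb hL
  · have hrun : ∀ L, ∃ k c, ∀ j ≤ L, a (k + j) = c := by
      intro L
      by_contra hc
      apply h
      refine ⟨L, fun k c => ?_⟩
      by_contra hcc
      apply hc
      refine ⟨k, !c, fun j hj => ?_⟩
      rw [← ne_iff_not]
      intro hh
      exact hcc ⟨j, hj, hh⟩
    intro halg
    have := (liouville_case hU hb hrun).transcendental
    exact this ((IsFractionRing.isAlgebraic_iff ℤ ℚ ℝ).mpr halg)

end


end

end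

/-- If the base-`b` digit sequence of the fractional part of a positive real `ξ`
takes values in `{k, k+1}` for some `0 ≤ k ≤ b − 2` and is Sturmian, then `ξ`
is transcendental. -/
theorem stmt17 (b : ℕ) (hb : 2 ≤ b) (ξ : ℝ) (hξpos : 0 < ξ)
    (k : ℤ) (hk0 : 0 ≤ k) (hk : k ≤ (b : ℤ) - 2)
    (hvals : ∀ n : ℕ, ⌊(b : ℝ) * Int.fract (ξ * (b : ℝ) ^ n)⌋ = k ∨
      ⌊(b : ℝ) * Int.fract (ξ * (b : ℝ) ^ n)⌋ = k + 1)
    (hst : ∀ m ≥ 1,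
      complexity (fun n : ℕ => ⌊(b : ℝ) * Int.fract (ξ * (b : ℝ) ^ n)⌋) m = m + 1) :
    Transcendental ℚ ξ := by
  classical
  obtain ⟨w, hw⟩ : ∃ w : ℕ → Bool, ∀ n, ⌊(b : ℝ) * Int.fract (ξ * (b : ℝ) ^ n)⌋ = if w n then k + 1 else k := by
    refine ⟨fun n => decide (⌊(b : ℝ) * Int.fract (ξ * (b : ℝ) ^ n)⌋ = k + 1), fun n => ?_⟩
    rcases hvals n with h | h
    · rw [h]; simp; omega
    · rw [h]; simp; exact h
  have hcard : ∀ m ≥ 1, (WW w m).ncard = m + 1 := by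
    intro m hm
    rw [← hst m hm]
    exact (complexity_eq hw m).symm
  have hmain := main_transc (NP_of_card hcard) (UR_of_card hcard) hb
  have hexp := expansion hb ξ k w hw
  intro halg
  apply hmain
  have hb0 : (b:ℝ) ≠ 0 := by
    have : (2:ℝ) ≤ b := by exact_mod_cast hb
    intro h; rw [h] at this; norm_num at this
  have e : GG true w (fun _ => (b:ℝ)⁻¹) = algebraMap ℚ ℝ (b:ℚ) * ξ -
      algebraMap ℚ ℝ ((b:ℚ) * ⌊ξ⌋ + k * (1 - (b:ℚ)⁻¹)⁻¹) := by
    have h1 := Int.self_sub_floor ξ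
    rw [hexp] at h1
    simp only [eq_ratCast]
    push_cast
    have h2 : (b:ℝ) * (b:ℝ)⁻¹ = 1 := mul_inv_cancel₀ hb0
    linear_combination (-(b:ℝ)) * h1 - (k * (1 - (b:ℝ)⁻¹)⁻¹ + GG true w (fun _ => (b:ℝ)⁻¹)) * h2
  rw [e]
  exact ((isAlgebraic_algebraMap _).mul halg).sub (isAlgebraic_algebraMap _)
end

section
/- Let Γ̃ = { x ∈ [0,1] : for all k ≥ 0, 1 − x ≤ {2^k x} ≤ x }, and let α = Σ_{n≥0} a_n/2^n, where (a_n)_{n≥0} is the Thue–Morse sequence (a_n is the parity of the number of 1's in the binary expansion of n). Then: (1) α is a limit point (accumulation point in ℝ) of Γ̃ and every limit point of Γ̃ is ≥ α, i.e., α is the smallest limit point of Γ̃; (2) the set Γ̃ ∩ [0, α) is countable and every element of Γ̃ less than α is rational. -/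
/-- The Thue–Morse sequence: `thueMorse n` is the parity of the number of `1`'s
in the binary expansion of `n`. -/
def thueMorse (n : ℕ) : ℕ := (Nat.digits 2 n).sum % 2

/-- `α = Σ aₙ/2ⁿ` where `(aₙ)` is the Thue–Morse sequence. -/
noncomputable def tmConst : ℝ := ∑' n : ℕ, (thueMorse n : ℝ) / 2 ^ n

/-- The set `Γ̃ = { x ∈ [0,1] : ∀ k ≥ 0, 1 − x ≤ {2ᵏx} ≤ x }`. -/
def GammaTilde : Set ℝ :=
  {x : ℝ | x ∈ Set.Icc (0 : ℝ) 1 ∧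
    ∀ k : ℕ, 1 - x ≤ Int.fract (2 ^ k * x) ∧ Int.fract (2 ^ k * x) ≤ x}

/-- `y` is a limit point of `S`. -/
def IsLimitPoint (y : ℝ) (S : Set ℝ) : Prop :=
  ∀ ε > 0, ∃ x ∈ S, x ≠ y ∧ |x - y| < ε


namespace TMProof

lemma tm_even (n : ℕ) : thueMorse (2 * n) = thueMorse n := by
  unfold thueMorse
  rcases Nat.eq_zero_or_pos n with h | h
  · simp [h]
  · rw [Nat.digits_def' (by norm_num) (by omega)]
    simp

lemma tm_odd (n : ℕ) : thueMorse (2 * n + 1) = 1 - thueMorse n := by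
  unfold thueMorse
  rw [Nat.digits_def' (by norm_num) (by omega)]
  have h1 : (2 * n + 1) % 2 = 1 := by omega
  have h2 : (2 * n + 1) / 2 = n := by omega
  rw [h1, h2, List.sum_cons]
  omega

lemma tm_le (n : ℕ) : thueMorse n ≤ 1 := by
  unfold thueMorse
  omega

lemma tm_add (n : ℕ) : ∀ i < 2 ^ n, thueMorse (2 ^ n + i) = 1 - thueMorse i := by
  induction n with
  | zero =>
    intro i hi
    have : i = 0 := by simpa using hi
    subst this
    simp [thueMorse]
  | succ n ih =>
    intro i hi
    rw [pow_succ] at *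
    rcases Nat.even_or_odd' i with ⟨j, rfl | rfl⟩
    · rw [show 2 ^ n * 2 + 2 * j = 2 * (2 ^ n + j) by ring, tm_even, tm_even, ih j (by omega)]
    · rw [show 2 ^ n * 2 + (2 * j + 1) = 2 * (2 ^ n + j) + 1 by ring, tm_odd, tm_odd,
        ih j (by omega)]

lemma tm_pow (n : ℕ) : thueMorse (2 ^ n) = 1 := by
  have := tm_add n 0 (by positivity)
  simpa [thueMorse] using this

noncomputable def MM (n : ℕ) : ℝ := 2 ^ (2 ^ n)

def AA : ℕ → ℤ
  | 0 => 2
  | n + 1 => AA n * (2 ^ (2 ^ n) - 1) + 2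

noncomputable def xx (n : ℕ) : ℝ := AA n / (MM n + 1)

lemma MM_succ (n : ℕ) : MM (n + 1) = MM n ^ 2 := by
  unfold MM
  rw [← pow_mul, pow_succ]

lemma AA_succ (n : ℕ) : (AA (n + 1) : ℝ) = AA n * (MM n - 1) + 2 := by
  simp [AA, MM]

lemma MM_ge (n : ℕ) : 2 ≤ MM n := by
  induction n with
  | zero => simp [MM]
  | succ n ih => rw [MM_succ]; nlinarith

lemma AA_le (n : ℕ) : (AA n : ℝ) ≤ MM n := by
  induction n with
  | zero => simp [MM, AA]
  | succ n ih =>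
    rw [MM_succ, AA_succ]
    have := MM_ge n
    nlinarith

lemma xx_eq (n : ℕ) : MM n * xx n = AA n - xx n := by
  have := MM_ge n
  unfold xx
  field_simp
  ring

lemma xx_lt_one (n : ℕ) : xx n < 1 := by
  have := MM_ge n
  have := AA_le n
  unfold xx
  rw [div_lt_one (by linarith)]
  linarith

noncomputable def dd (n : ℕ) : ℝ := xx (n + 1) - xx n

lemma dd_eq (n : ℕ) : (MM n ^ 2 + 1) * dd n = 2 * (1 - xx n) := by
  have h1 := xx_eq n
  have h2 := xx_eq (n + 1)
  rw [MM_succ, AA_succ] at h2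
  unfold dd
  have h3 : (AA n : ℝ) = MM n * xx n + xx n := by linarith
  rw [h3] at h2
  linarith

lemma dd_pos (n : ℕ) : 0 < dd n := by
  have h := dd_eq n
  have := xx_lt_one n
  by_contra hc
  push Not at hc
  nlinarith [sq_nonneg (MM n)]

lemma xx_mono : StrictMono xx := by
  apply strictMono_nat_of_lt_succ
  intro n
  have := dd_pos n
  unfold dd at this
  linarith

lemma xx_zero : xx 0 = 2 / 3 := by
  norm_num [xx, AA, MM]

lemma xx_ge (n : ℕ) : 2 / 3 ≤ xx n := by
  rw [← xx_zero]
  exact xx_mono.monotone (Nat.zero_le n)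

lemma key (n : ℕ) : ∀ k, 0 < k → k < 2 ^ n →
    ∃ p : ℤ, 1 - xx n < 2 ^ k * xx n - p ∧ 2 ^ k * xx n - p < xx n := by
  induction n with
  | zero =>
    intro k h1 h2
    simp at h2
    omega
  | succ n ih =>
    have hM := MM_ge n
    have hx := xx_eq n
    have hx1 := xx_lt_one n
    have hx2 := xx_ge n
    have hd := dd_eq n
    have hd0 := dd_pos n
    have hx' : xx (n + 1) = xx n + dd n := by unfold dd; ring
    rw [hx']
    have hMd : (MM n + 1) * (MM n * dd n) ≤ 2 * MM n * (1 - xx n) * (MM n + 1) / MM n ^ 2 := by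
      rw [le_div_iff₀ (by positivity)]
      nlinarith [mul_pos (show 0 < MM n + 1 by linarith) (show 0 < MM n by linarith),
        mul_pos (mul_pos (show 0 < MM n + 1 by linarith) (show 0 < MM n by linarith)) hd0]
    have small : ∀ k, 0 < k → k < 2 ^ n → ∀ p : ℤ,
        1 - xx n < 2 ^ k * xx n - p → 2 ^ k * xx n - p < xx n →
        1 - (xx n + dd n) < 2 ^ k * (xx n + dd n) - p ∧
        2 ^ k * (xx n + dd n) - p < xx n + dd n := by
      intro k hk0 hk p hp1 hp2
      have h2k : (0 : ℝ) < 2 ^ k := by positivity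
      have hkM : 2 * (2 : ℝ) ^ k ≤ MM n := by
        unfold MM
        rw [← pow_succ']
        exact pow_le_pow_right₀ (by norm_num) hk
      refine ⟨by nlinarith, ?_⟩
      have hgap : (MM n + 1) * (2 ^ k * xx n - p - xx n) ≤ -1 := by
        have e : (MM n + 1) * (2 ^ k * xx n - p - xx n) =
            ((2 ^ k * AA n - p * (2 ^ (2 ^ n) + 1) - AA n : ℤ) : ℝ) := by
          push_cast
          rw [show (AA n : ℝ) = MM n * xx n + xx n by linarith]
          simp only [MM]
          ring
        have hneg : (MM n + 1) * (2 ^ k * xx n - p - xx n) < 0 :=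
          mul_neg_of_pos_of_neg (by linarith) (by linarith)
        rw [e] at hneg ⊢
        have : (2 ^ k * AA n - p * (2 ^ (2 ^ n) + 1) - AA n : ℤ) < 0 := by exact_mod_cast hneg
        have : (2 ^ k * AA n - p * (2 ^ (2 ^ n) + 1) - AA n : ℤ) ≤ -1 := by omega
        exact_mod_cast this
      -- (M+1) * 2^k d ≤ 1
      have hb : (MM n + 1) * (2 ^ k * dd n) ≤ 1 := by
        have h1 : (MM n + 1) * (2 ^ k * dd n) * 2 ≤ (MM n + 1) * (MM n * dd n) := by
          have := mul_le_mul_of_nonneg_right hkM hd0.le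
          nlinarith
        have h3 : (MM n + 1) * (MM n * dd n) ≤ 2 * (MM n ^ 2 + 1) * dd n := by
          nlinarith [mul_nonneg (show 0 ≤ MM n ^ 2 - MM n + 2 by nlinarith) hd0.le]
        nlinarith
      have : (MM n + 1) * (2 ^ k * (xx n + dd n) - p - xx n) ≤ 0 := by
        nlinarith
      have : 2 ^ k * (xx n + dd n) - p - xx n ≤ 0 := by
        by_contra hc
        push Not at hc
        nlinarith
      linarith
    intro k hk0 hk
    rcases lt_trichotomy k (2 ^ n) with h | h | h
    · obtain ⟨p, hp1, hp2⟩ := ih k hk0 h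
      exact ⟨p, small k hk0 h p hp1 hp2⟩
    · subst h
      refine ⟨AA n - 1, ?_⟩
      change 1 - _ < MM n * _ - _ ∧ MM n * _ - _ < _
      push_cast
      have h1 : 0 < MM n * dd n := by positivity
      constructor
      · nlinarith
      · have : 4 * (MM n - 1) * dd n ≤ 2 * (1 - xx n) := by
          rw [← hd]
          apply mul_le_mul_of_nonneg_right _ hd0.le
          nlinarith [sq_nonneg (MM n - 2)]
        nlinarith
    · obtain ⟨j, rfl⟩ := Nat.exists_eq_add_of_lt h
      set jj := j + 1 with hjj
      have hj : jj < 2 ^ n := by rw [pow_succ] at hk; omega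
      obtain ⟨i, hi⟩ := Nat.exists_eq_add_of_lt hj
      set ii := i + 1 with hii
      have hi' : ii < 2 ^ n := by omega
      obtain ⟨p, hp1, hp2⟩ := ih jj (by omega) hj
      obtain ⟨q, hq1, hq2⟩ := ih ii (by omega) hi'
      obtain ⟨hs1, hs2⟩ := small ii (by omega) hi' q hq1 hq2
      have hkk : (2 : ℝ) ^ (2 ^ n + j + 1) = 2 ^ jj * MM n := by
        unfold MM
        rw [← pow_add]
        congr 1
        omega
      have hMij : (2 : ℝ) ^ ii * 2 ^ jj = MM n := by
        unfold MM
        rw [← pow_add]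
        congr 1
        omega
      have hipos : (0 : ℝ) < 2 ^ ii := by positivity
      have hjpos : (0 : ℝ) < 2 ^ jj := by positivity
      refine ⟨2 ^ jj * AA n - p - 1, ?_⟩
      rw [hkk]
      push_cast
      have e : 2 ^ jj * MM n * (xx n + dd n) - (2 ^ jj * AA n - p - 1 : ℝ) =
          1 - (2 ^ jj * xx n - p) + 2 ^ jj * MM n * dd n := by
        linear_combination (2 : ℝ) ^ jj * hx
      rw [e]
      have h0 : 0 < 2 ^ jj * MM n * dd n := by positivity
      refine ⟨by linarith, ?_⟩
      have e2 : (2 : ℝ) ^ ii * (1 - (2 ^ jj * xx n - p) + 2 ^ jj * MM n * dd n) =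
          2 ^ ii - (AA n - 1 - 2 ^ ii * p) + 1 - (xx n + dd n) := by
        linear_combination (MM n * dd n - xx n) * hMij + hd - hx
      have hR : (2 : ℝ) ^ ii * (1 - xx n) < 2 ^ ii * (2 ^ jj * xx n - p) :=
        mul_lt_mul_of_pos_left hp1 hipos
      have e3 : (2 : ℝ) ^ ii * (2 ^ jj * xx n - p) = AA n - xx n - 2 ^ ii * p := by
        linear_combination xx n * hMij + hx
      rw [e3] at hR
      have hint : (2 : ℝ) ^ ii - (AA n - 1 - 2 ^ ii * p) - 1 < q := by linarith
      have hint' : (2 : ℤ) ^ ii - (AA n - 1 - 2 ^ ii * p) - 1 < q := by exact_mod_cast hint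
      have hint2 : (2 : ℤ) ^ ii - (AA n - 1 - 2 ^ ii * p) - 1 ≤ q - 1 := by omega
      have hint3 : (2 : ℝ) ^ ii - (AA n - 1 - 2 ^ ii * p) - 1 ≤ q - 1 := by exact_mod_cast hint2
      have : (2 : ℝ) ^ ii * (1 - (2 ^ jj * xx n - p) + 2 ^ jj * MM n * dd n) <
          2 ^ ii * (xx n + dd n) := by
        rw [e2]
        linarith
      exact lt_of_mul_lt_mul_left this hipos.le

lemma xx_mem (n : ℕ) : xx n ∈ GammaTilde := by
  have hx := xx_eq n
  have hx1 := xx_lt_one n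
  have hx2 := xx_ge n
  have main : ∀ k : ℕ, ∃ p : ℤ, 1 - xx n ≤ 2 ^ k * xx n - p ∧ 2 ^ k * xx n - p ≤ xx n := by
    intro k
    induction k using Nat.strong_induction_on with
    | _ k ih =>
      rcases Nat.eq_zero_or_pos k with h | h
      · subst h
        refine ⟨0, ?_, ?_⟩ <;> simp
        linarith
      · rcases lt_or_ge k (2 ^ n) with h' | h'
        · obtain ⟨p, h1, h2⟩ := key n k h h'
          exact ⟨p, h1.le, h2.le⟩
        · obtain ⟨j, rfl⟩ := Nat.exists_eq_add_of_le h'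
          have : 0 < 2 ^ n := by positivity
          obtain ⟨p, h1, h2⟩ := ih j (by omega)
          refine ⟨2 ^ j * AA n - p - 1, ?_⟩
          have e : (2 : ℝ) ^ (2 ^ n + j) * xx n = 2 ^ j * AA n - 2 ^ j * xx n := by
            rw [pow_add]
            change MM n * _ * _ = _
            linear_combination (2 : ℝ) ^ j * hx
          rw [e]
          push_cast
          constructor <;> linarith
  refine ⟨⟨by linarith, by linarith⟩, fun k => ?_⟩
  obtain ⟨p, h1, h2⟩ := main k
  have : Int.fract (2 ^ k * xx n) = 2 ^ k * xx n - p := by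
    rw [Int.fract_eq_iff]
    exact ⟨by linarith, by linarith, p, by ring⟩
  rw [this]
  exact ⟨h1, h2⟩

lemma tm_term_le (i : ℕ) : (thueMorse i : ℝ) / 2 ^ i ≤ (1 / 2) ^ i := by
  have : (thueMorse i : ℝ) ≤ 1 := by exact_mod_cast tm_le i
  rw [one_div, inv_pow, div_eq_mul_inv]
  exact mul_le_of_le_one_left (by positivity) this

lemma tm_summable : Summable fun n : ℕ => (thueMorse n : ℝ) / 2 ^ n :=
  Summable.of_nonneg_of_le (fun _ => by positivity) tm_term_le
    (summable_geometric_of_lt_one (by norm_num) (by norm_num))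

lemma partial_sum (n : ℕ) :
    ∑ i ∈ Finset.range (2 ^ n), (thueMorse i : ℝ) / 2 ^ i = (AA n - 2) / MM n := by
  induction n with
  | zero => simp [AA, thueMorse]
  | succ n ih =>
    have hM := MM_ge n
    rw [pow_succ, mul_two, Finset.sum_range_add, ih]
    have : ∀ i ∈ Finset.range (2 ^ n), (thueMorse (2 ^ n + i) : ℝ) / 2 ^ (2 ^ n + i) =
        (1 / MM n) * ((1 / 2) ^ i - (thueMorse i : ℝ) / 2 ^ i) := by
      intro i hi
      rw [tm_add n i (Finset.mem_range.1 hi), Nat.cast_sub (tm_le i), pow_add]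
      unfold MM
      simp only [one_div, inv_pow]
      field_simp
      simp
    rw [Finset.sum_congr rfl this, ← Finset.mul_sum, Finset.sum_sub_distrib, ih,
      geom_sum_eq (by norm_num), AA_succ, MM_succ]
    have : ((1 : ℝ) / 2) ^ (2 ^ n) = 1 / MM n := by simp [MM]
    rw [this]
    field_simp
    ring

lemma alpha_ge (n : ℕ) : (AA n - 1) / MM n ≤ tmConst := by
  have h := tm_summable.sum_le_tsum (Finset.range (2 ^ n + 1)) (fun _ _ => by positivity)
  rw [Finset.sum_range_succ, partial_sum, tm_pow] at h
  refine le_trans (le_of_eq ?_) h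
  change _ = _ + _ / MM n
  push_cast
  ring

lemma alpha_le (n : ℕ) : tmConst ≤ AA n / MM n := by
  unfold tmConst
  rw [← tm_summable.sum_add_tsum_nat_add (2 ^ n), partial_sum]
  have hs : Summable fun i : ℕ => ((1 : ℝ) / MM n) * (1 / 2) ^ i :=
    (summable_geometric_of_lt_one (by norm_num) (by norm_num)).mul_left _
  have : ∑' i : ℕ, (thueMorse (i + 2 ^ n) : ℝ) / 2 ^ (i + 2 ^ n) ≤
      ∑' i : ℕ, ((1 : ℝ) / MM n) * (1 / 2) ^ i := by
    apply Summable.tsum_le_tsum _ ((summable_nat_add_iff (2 ^ n)).2 tm_summable) hs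
    intro i
    refine (tm_term_le _).trans (le_of_eq ?_)
    rw [pow_add, mul_comm]
    simp [MM]
  rw [tsum_mul_left, tsum_geometric_two] at this
  calc _ ≤ (AA n - 2) / MM n + 1 / MM n * 2 := by linarith
    _ = _ := by ring

lemma xx_ge' (n : ℕ) : (AA n - 1) / MM n ≤ xx n := by
  have := MM_ge n
  rw [div_le_iff₀ (by linarith)]
  have := xx_eq n
  have := xx_lt_one n
  linarith

lemma xx_le' (n : ℕ) : xx n ≤ AA n / MM n := by
  have := MM_ge n
  rw [le_div_iff₀ (by linarith)]
  have := xx_eq n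
  have := xx_ge n
  linarith

lemma xx_close (n : ℕ) : |xx n - tmConst| ≤ 1 / MM n := by
  have h1 := xx_ge' n
  have h2 := xx_le' n
  have h3 := alpha_ge n
  have h4 := alpha_le n
  rw [sub_div] at h1 h3
  rw [abs_le]
  constructor <;> linarith

lemma MM_big (n : ℕ) : (n : ℝ) < MM n := by
  unfold MM
  have h1 : n < 2 ^ n := Nat.lt_two_pow_self
  have h2 : 2 ^ n < 2 ^ (2 ^ n) := Nat.lt_two_pow_self
  exact_mod_cast h1.trans h2

lemma xx_close' (ε : ℝ) (hε : 0 < ε) : ∃ n, |xx n - tmConst| < ε := by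
  obtain ⟨n, hn⟩ := exists_nat_gt (1 / ε)
  refine ⟨n, (xx_close n).trans_lt ?_⟩
  have := MM_big n
  have h0 := MM_ge n
  rw [div_lt_iff₀ (by linarith)]
  rw [div_lt_iff₀ hε] at hn
  nlinarith

lemma xx_le_alpha (n : ℕ) : xx n ≤ tmConst := by
  by_contra hc
  push Not at hc
  obtain ⟨k, hk⟩ := xx_close' (xx n - tmConst) (by linarith)
  obtain ⟨hk1, hk2⟩ := abs_lt.1 hk
  have h1 : xx k < xx n := by linarith
  have h2 : k < n := xx_mono.lt_iff_lt.1 h1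
  -- limit of increasing sequence: use index far beyond
  have : ∀ m, n ≤ m → xx n - tmConst ≤ 1 / MM m := fun m hm =>
    le_trans (by have := xx_mono.monotone hm; have := le_abs_self (xx m - tmConst); linarith)
      (xx_close m)
  obtain ⟨N, hN⟩ := exists_nat_gt (1 / (xx n - tmConst))
  have h3 := this (max n N) (le_max_left _ _)
  have h4 := MM_big (max n N)
  have h5 : (N : ℝ) ≤ (max n N : ℕ) := by exact_mod_cast le_max_right _ _
  have h0 := MM_ge (max n N)
  rw [le_div_iff₀ (by linarith)] at h3
  rw [div_lt_iff₀ (by linarith)] at hN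
  nlinarith

lemma xx_lt_alpha (n : ℕ) : xx n < tmConst :=
  (xx_mono (Nat.lt_succ_self n)).trans_le (xx_le_alpha _)

lemma step (n : ℕ) (x : ℝ) (hx : x ∈ GammaTilde) (ha : x < tmConst) (h : xx n ≤ x) :
    x = xx n ∨ xx (n + 1) ≤ x := by
  obtain ⟨⟨hx0, hx1⟩, hG⟩ := hx
  have hM := MM_ge n
  have hxx := xx_eq n
  have hxx1 := xx_eq (n + 1)
  have hM' := MM_succ n
  have hA' := AA_succ n
  have u1 : x * MM n < AA n := by
    rw [← lt_div_iff₀ (by linarith)]; exact ha.trans_le (alpha_le n)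
  have u2 : x * MM n ^ 2 < AA (n + 1) := by
    rw [← lt_div_iff₀ (by positivity), ← hM']; exact ha.trans_le (alpha_le (n + 1))
  have hG2 := hG (2 ^ (n + 1))
  have hMM : (2 : ℝ) ^ (2 ^ (n + 1)) = MM n ^ 2 := by rw [← hM']; rfl
  rw [hMM] at hG2
  rcases lt_or_ge (MM n ^ 2 * x) (AA (n + 1) - 1) with hc | hc
  · left
    -- fract = M²x - (A' - 2)
    have hd : 0 ≤ (MM n + 1) * x - AA n := by nlinarith
    have hf : Int.fract (MM n ^ 2 * x) = MM n ^ 2 * x - (AA (n + 1) - 2) := by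
      rw [Int.fract_eq_iff]
      refine ⟨?_, by linarith, AA (n + 1) - 2, by push_cast; ring⟩
      rw [hA']
      nlinarith
    rw [hf, hA'] at hG2
    have h2 := hG2.2
    have h3 : (MM n - 1) * ((MM n + 1) * x - AA n) ≤ 0 := by nlinarith
    have h4 : (MM n + 1) * x - AA n ≤ 0 := by
      by_contra hcc
      push Not at hcc
      nlinarith
    have h5 : (MM n + 1) * (x - xx n) ≤ 0 := by linarith
    nlinarith
  · right
    have hf : Int.fract (MM n ^ 2 * x) = MM n ^ 2 * x - (AA (n + 1) - 1) := by
      rw [Int.fract_eq_iff]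
      exact ⟨by linarith, by linarith, AA (n + 1) - 1, by push_cast; ring⟩
    rw [hf] at hG2
    have h1 := hG2.1
    rw [hM'] at hxx1
    by_contra hcc
    push Not at hcc
    nlinarith [sq_nonneg (MM n)]

lemma base (x : ℝ) (hx : x ∈ GammaTilde) (ha : x < tmConst) : xx 0 ≤ x := by
  obtain ⟨⟨hx0, hx1⟩, hG⟩ := hx
  have h1 : x < 1 := by
    have := alpha_le 0
    norm_num [AA, MM] at this
    linarith
  have h0 := (hG 0).1
  rw [pow_zero, one_mul, Int.fract_eq_self.2 ⟨hx0, h1⟩] at h0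
  have h2 := (hG 1).1
  have : Int.fract (2 ^ 1 * x) = 2 ^ 1 * x - 1 := by
    rw [Int.fract_eq_iff]
    exact ⟨by linarith, by linarith, 1, by push_cast; ring⟩
  rw [this] at h2
  rw [xx_zero]
  linarith

lemma classify (x : ℝ) (hx : x ∈ GammaTilde) (ha : x < tmConst) (n : ℕ) :
    (∃ k < n, x = xx k) ∨ xx n ≤ x := by
  induction n with
  | zero => right; exact base x hx ha
  | succ n ih =>
    rcases ih with ⟨k, hk, e⟩ | h
    · left; exact ⟨k, by omega, e⟩
    · rcases step n x hx ha h with h | h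
      · left; exact ⟨n, by omega, h⟩
      · right; exact h

lemma classify' (c : ℝ) (hc : c < tmConst) :
    ∃ n, ∀ x ∈ GammaTilde, x < c → ∃ k < n, x = xx k := by
  obtain ⟨n, hn⟩ := xx_close' (tmConst - c) (by linarith)
  refine ⟨n, fun x hx hxc => ?_⟩
  rcases classify x hx (hxc.trans hc) n with h | h
  · exact h
  · have := (abs_lt.1 hn).1
    linarith

lemma classify'' (x : ℝ) (hx : x ∈ GammaTilde) (ha : x < tmConst) : ∃ k, x = xx k := by
  obtain ⟨n, hn⟩ := classify' ((x + tmConst) / 2) (by linarith)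
  obtain ⟨k, _, h⟩ := hn x hx (by linarith)
  exact ⟨k, h⟩

end TMProof

/-- The smallest limit point of `Γ̃` is the Thue–Morse constant `α`; the
elements of `Γ̃` below `α` form a countable set and are all rational. -/
theorem stmt18 :
    IsLimitPoint tmConst GammaTilde ∧
    (∀ y : ℝ, IsLimitPoint y GammaTilde → tmConst ≤ y) ∧
    (GammaTilde ∩ Set.Iio tmConst).Countable ∧
    (∀ x ∈ GammaTilde, x < tmConst → ∃ q : ℚ, x = (q : ℝ)) := by
  refine ⟨?_, ?_, ?_, ?_⟩
  · intro ε hε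
    obtain ⟨n, hn⟩ := TMProof.xx_close' ε hε
    exact ⟨TMProof.xx n, TMProof.xx_mem n, (TMProof.xx_lt_alpha n).ne, hn⟩
  · intro y hy
    by_contra hc
    push Not at hc
    obtain ⟨n, hn⟩ := TMProof.classify' ((y + tmConst) / 2) (by linarith)
    have hfin : ((TMProof.xx '' Set.Iio n) \ {y}).Finite :=
      ((Set.finite_Iio n).image _).subset Set.diff_subset
    have hmem : ((TMProof.xx '' Set.Iio n) \ {y})ᶜ ∈ nhds y :=
      hfin.isClosed.isOpen_compl.mem_nhds (by simp)
    obtain ⟨ε, hε, hball⟩ := Metric.mem_nhds_iff.1 hmem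
    obtain ⟨x, hx, hne, hlt⟩ := hy (min ε ((tmConst - y) / 2)) (lt_min hε (by linarith))
    have h1 := lt_of_lt_of_le hlt (min_le_left _ _)
    have h2 := (abs_lt.1 (lt_of_lt_of_le hlt (min_le_right _ _))).2
    obtain ⟨k, hk, e⟩ := hn x hx (by linarith)
    have : x ∈ Metric.ball y ε := by rwa [Metric.mem_ball, Real.dist_eq]
    exact hball this ⟨⟨k, hk, e.symm⟩, hne⟩
  · apply (Set.countable_range TMProof.xx).mono
    rintro x ⟨hx, ha⟩
    obtain ⟨k, h⟩ := TMProof.classify'' x hx ha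
    exact ⟨k, h.symm⟩
  · intro x hx ha
    obtain ⟨k, h⟩ := TMProof.classify'' x hx ha
    refine ⟨(TMProof.AA k : ℚ) / (2 ^ (2 ^ k) + 1), ?_⟩
    rw [h]
    simp [TMProof.xx, TMProof.MM]
end
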